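/- Let G be a finite 2-group. Then G is filled if and only if G is elementary abelian, or isomorphic to one of: D₈, D₈ × C₂, D₈ ∗ Q₈ (the extraspecial group of order 32 of plus type), or (D₈ ∗ Q₈) × C₂. -/

import Mathlib

open Pointwise

/-- `S` is product-free if `S ∩ SS = ∅`. -/
def ProductFree {G : Type*} [Group G] (S : Set G) : Prop :=
  Disjoint S (S * S)

/-- `S` is locally maximal product-free if it is product-free and not properly
contained in any product-free set. -/
def LocallyMaximalPF {G : Type*} [Group G] (S : Set G) : Prop :=
  ProductFree S ∧ ∀ T : Set G, ProductFree T → S ⊆ T → S = T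

/-- `S` fills `G` (is complete) if every non-identity element lies in `S ∪ SS`. -/
def Fills {G : Type*} [Group G] (S : Set G) : Prop :=
  ∀ g : G, g ≠ 1 → g ∈ S ∪ S * S

/-- `G` is filled if every locally maximal product-free set fills `G`. -/
def Filled (G : Type*) [Group G] : Prop :=
  ∀ S : Set G, LocallyMaximalPF S → Fills S


/-- The central element used to form the central product `D₈ ∗ Q₈`. -/
def d8q8Center : Subgroup (DihedralGroup 4 × QuaternionGroup 2) :=
  Subgroup.zpowers (DihedralGroup.r 2, QuaternionGroup.a 2)

instance : d8q8Center.Normal := by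
  constructor
  intro n hn g
  obtain ⟨k, rfl⟩ := hn
  have hc : ∀ h : DihedralGroup 4 × QuaternionGroup 2,
      h * (DihedralGroup.r 2, QuaternionGroup.a 2) =
        (DihedralGroup.r 2, QuaternionGroup.a 2) * h := by decide
  have hcm := (show Commute g (DihedralGroup.r 2, QuaternionGroup.a 2) from hc g).zpow_right k
  exact Subgroup.mem_zpowers_iff.mpr
    ⟨k, by rw [hcm.eq, mul_assoc, mul_inv_cancel, mul_one]⟩

/-- The central product `D₈ ∗ Q₈`, an extraspecial group of order 32. -/
def D8Q8 : Type := (DihedralGroup 4 × QuaternionGroup 2) ⧸ d8q8Center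

instance : Group D8Q8 := QuotientGroup.Quotient.group d8q8Center

namespace FG

section basics
variable {G : Type*} [Group G]

theorem pf_iff {S : Set G} : ProductFree S ↔ ∀ a ∈ S, ∀ b ∈ S, a * b ∉ S := by
  unfold ProductFree
  rw [Set.disjoint_right]
  constructor
  · intro h a ha b hb
    exact h (Set.mul_mem_mul ha hb)
  · rintro h _ ⟨a, ha, b, hb, rfl⟩
    exact h a ha b hb

theorem pf_one {S : Set G} (h : ProductFree S) : (1 : G) ∉ S := by
  intro h1
  exact pf_iff.1 h 1 h1 1 h1 (by simpa using h1)

/-- `x` is excluded by `S`: no product-free set containing `S` contains `x`. -/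
def Ex (S : Set G) (x : G) : Prop :=
  (∃ a ∈ S, ∃ b ∈ S, x = a * b ∨ x * a = b ∨ a * x = b) ∨ x * x ∈ S

theorem Ex.not_mem {S T : Set G} (hT : ProductFree T) (hST : S ⊆ T) {x : G} (h : Ex S x) :
    x ∉ T := by
  intro hx
  rw [pf_iff] at hT
  rcases h with ⟨a, ha, b, hb, h | h | h⟩ | h
  · exact hT a (hST ha) b (hST hb) (h ▸ hx)
  · exact hT x hx a (hST ha) (h ▸ hST hb)
  · exact hT a (hST ha) x hx (h ▸ hST hb)
  · exact hT x hx x hx (hST h)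

theorem lm_reason {T : Set G} (hT : LocallyMaximalPF T) {x : G} (hx : x ∉ T) (h1 : x ≠ 1) :
    Ex T x := by
  by_contra hE
  have hpf := pf_iff.1 hT.1
  have : ProductFree (insert x T) := by
    rw [pf_iff]
    intro a ha b hb hab
    unfold Ex at hE
    push Not at hE
    obtain ⟨hE1, hE2⟩ := hE
    rcases ha with rfl | ha <;> rcases hb with rfl | hb <;> rcases hab with hab | hab
    · exact h1 (by simpa using hab)
    · exact hE2 hab
    · have : b = 1 := by simpa using hab
      exact pf_one hT.1 (this ▸ hb)
    · exact (hE1 b hb _ hab).2.1 rfl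
    · have : a = 1 := by simpa using hab
      exact pf_one hT.1 (this ▸ ha)
    · exact (hE1 a ha _ hab).2.2 rfl
    · exact (hE1 a ha b hb).1 hab.symm
    · exact hpf a ha b hb hab
  have h := hT.2 _ this (Set.subset_insert _ _)
  exact hx (h ▸ Set.mem_insert _ _)

theorem exists_lm [Finite G] {S : Set G} (hS : ProductFree S) :
    ∃ T, LocallyMaximalPF T ∧ S ⊆ T := by
  obtain ⟨T, hST, hT⟩ := (Set.toFinite {T : Set G | ProductFree T}).exists_le_maximal hS
  refine ⟨T, ⟨hT.1, fun U hU hTU => ?_⟩, hST⟩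
  exact le_antisymm hTU (hT.2 hU hTU)

theorem not_filled_of [Finite G] {S : Set G} (hS : ProductFree S) {g : G} (hg : g ≠ 1)
    (h : ∀ T, ProductFree T → S ⊆ T → g ∉ T ∧ ∀ a ∈ T, ∀ b ∈ T, a * b ≠ g) : ¬ Filled G := by
  intro hF
  obtain ⟨T, hT, hST⟩ := exists_lm hS
  obtain ⟨h1, h2⟩ := h T hT.1 hST
  rcases hF T hT g hg with h | h
  · exact h1 h
  · obtain ⟨a, ha, b, hb, hab⟩ := h
    exact h2 a ha b hb hab

theorem not_filled_cert [Finite G] {S : Set G} (hS : ProductFree S) {g : G} (hg : g ≠ 1)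
    (hE : Ex S g) (h : ∀ a b, a * b = g → Ex S a ∨ Ex S b) : ¬ Filled G := by
  refine not_filled_of hS hg fun T hT hST => ⟨hE.not_mem hT hST, fun a ha b hb hab => ?_⟩
  rcases h a b hab with h | h
  · exact h.not_mem hT hST ha
  · exact h.not_mem hT hST hb

theorem filled_of_exp2 (h : ∀ g : G, g * g = 1) : Filled G := by
  intro T hT g hg
  by_cases hx : g ∈ T
  · exact Or.inl hx
  right
  have hi : ∀ a : G, a⁻¹ = a := fun a => inv_eq_of_mul_eq_one_left (h a)
  rcases lm_reason hT hx hg with ⟨a, ha, b, hb, h' | h' | h'⟩ | h'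
  · exact ⟨a, ha, b, hb, h'.symm⟩
  · exact ⟨b, hb, a, ha, by simp only; rw [← h', mul_assoc, h, mul_one]⟩
  · exact ⟨a, ha, b, hb, by simp only; rw [← h', ← mul_assoc, h, one_mul]⟩
  · exact absurd (h g ▸ h') (pf_one hT.1)

theorem filled_of_surj {H : Type*} [Group H] (f : G →* H) (hf : Function.Surjective f)
    (hG : Filled G) : Filled H := by
  intro T hT g hg
  have hpf : ProductFree (f ⁻¹' T) := by
    rw [pf_iff]; intro a ha b hb hab
    exact pf_iff.1 hT.1 _ ha _ hb (by simpa using hab)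
  have hLM : LocallyMaximalPF (f ⁻¹' T) := by
    refine ⟨hpf, fun U hU hTU => le_antisymm hTU ?_⟩
    intro u hu
    by_contra hn
    have h1 : f u ≠ 1 ∨ f u = 1 := (em _).symm
    have key : ¬ Ex (f ⁻¹' T) u := fun h => h.not_mem hU hTU hu
    rcases h1 with h1 | h1
    · apply key
      rcases lm_reason hT (x := f u) hn h1 with ⟨a, ha, b, hb, h' | h' | h'⟩ | h'
      · obtain ⟨a, rfl⟩ := hf a
        refine Or.inl ⟨a, ha, a⁻¹ * u, ?_, Or.inl (by group)⟩
        simpa [h'] using hb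
      · obtain ⟨a, rfl⟩ := hf a
        refine Or.inl ⟨a, ha, u * a, ?_, Or.inr (Or.inl rfl)⟩
        simpa [h'] using hb
      · obtain ⟨a, rfl⟩ := hf a
        refine Or.inl ⟨a, ha, a * u, ?_, Or.inr (Or.inr rfl)⟩
        simpa [h'] using hb
      · exact Or.inr (by simpa using h')
    · by_cases hne : T.Nonempty
      · obtain ⟨t, ht⟩ := hne
        obtain ⟨t, rfl⟩ := hf t
        exact key (Or.inl ⟨t, ht, u * t, by simpa [h1] using ht, Or.inr (Or.inl rfl)⟩)
      · rw [Set.not_nonempty_iff_eq_empty] at hne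
        subst hne
        rcases lm_reason hT (x := g) (by simp) hg with ⟨a, ha, _⟩ | h'
        · exact ha
        · exact h'
  obtain ⟨g, rfl⟩ := hf g
  rcases hG _ hLM g (by rintro rfl; simp at hg) with h | h
  · exact Or.inl h
  · obtain ⟨a, ha, b, hb, rfl⟩ := h
    exact Or.inr ⟨f a, ha, f b, hb, by simp⟩

end basics

/-! ### Models of class two groups -/

class XN (N : Type) where
  z : N
  add : N → N → N

instance : XN Bool := ⟨false, xor⟩
instance : XN (Bool × Bool) := ⟨(false, false), fun a b => (xor a.1 b.1, xor a.2 b.2)⟩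

def El (N : Type) : ℕ → Type
  | 0 => N
  | k + 1 => El N k × Bool

section model
variable {N : Type}

def El.deq [DecidableEq N] : (k : ℕ) → DecidableEq (El N k)
  | 0 => inferInstanceAs (DecidableEq N)
  | k + 1 => @instDecidableEqProd _ _ (El.deq k) _

instance [DecidableEq N] (k : ℕ) : DecidableEq (El N k) := El.deq k

def elems (l : List N) : (k : ℕ) → List (El N k)
  | 0 => l
  | k + 1 => (elems l k).map (fun p => (p, false)) ++ (elems l k).map (fun p => (p, true))

theorem mem_elems {l : List N} (hl : ∀ n, n ∈ l) : ∀ k (p : El N k), p ∈ elems l k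
  | 0, p => hl p
  | k + 1, (p, e) => by
    have := mem_elems hl k p
    cases e
    · exact List.mem_append_left _ (List.mem_map.2 ⟨p, this, rfl⟩)
    · exact List.mem_append_right _ (List.mem_map.2 ⟨p, this, rfl⟩)

def inN : (k : ℕ) → N → El N k
  | 0, n => n
  | k + 1, n => (inN k n, false)

def topE (k : ℕ) (n : N) : El N (k + 1) := (inN k n, true)

variable {G : Type*} [Group G]

def phi (ν : N → G) (x : ℕ → G) : (k : ℕ) → El N k → G
  | 0, a => ν a
  | k + 1, p => match p.2 with
    | true => phi ν x k p.1 * x k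
    | false => phi ν x k p.1

theorem phi_inN {ν : N → G} {x : ℕ → G} : ∀ (k : ℕ) (n : N), phi ν x k (inN k n) = ν n
  | 0, _ => rfl
  | k + 1, n => phi_inN k n

variable [XN N]

def addc : (k : ℕ) → El N k → N → El N k
  | 0, a, n => XN.add (N := N) a n
  | k + 1, p, n => (addc k p.1 n, p.2)

def lam (com : ℕ → ℕ → N) (i : ℕ) : (k : ℕ) → El N k → N
  | 0, _ => XN.z
  | k + 1, p => match p.2 with
    | true => XN.add (lam com i k p.1) (com i k)
    | false => lam com i k p.1

def mul (sq : ℕ → N) (com : ℕ → ℕ → N) : (k : ℕ) → El N k → El N k → El N k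
  | 0, a, b => XN.add (N := N) a b
  | k + 1, p, q => match p.2, q.2 with
    | false, f => (mul sq com k p.1 q.1, f)
    | true, false => (addc k (mul sq com k p.1 q.1) (lam com k k q.1), true)
    | true, true => (addc k (mul sq com k p.1 q.1) (XN.add (lam com k k q.1) (sq k)), false)

/-- the relations of the model hold in `G` -/
structure Rels (sq : ℕ → N) (com : ℕ → ℕ → N) (k : ℕ) (ν : N → G) (x : ℕ → G) : Prop where
  zero : ν XN.z = 1
  add : ∀ a b, ν (XN.add a b) = ν a * ν b
  cen : ∀ a g, ν a * g = g * ν a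
  sq : ∀ i < k, x i * x i = ν (sq i)
  com : ∀ i < k, ∀ j < i, x i * x j = x j * x i * ν (com i j)

variable {sq : ℕ → N} {com : ℕ → ℕ → N} {ν : N → G} {x : ℕ → G}

theorem Rels.mono {k l : ℕ} (h : Rels sq com k ν x) (hl : l ≤ k) : Rels sq com l ν x :=
  ⟨h.zero, h.add, h.cen, fun i hi => h.sq i (by omega), fun i hi => h.com i (by omega)⟩

theorem phi_addc {k : ℕ} (h : Rels sq com k ν x) : ∀ (l : ℕ) (p : El N l) (n : N),
    phi ν x l (addc l p n) = phi ν x l p * ν n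
  | 0, p, n => h.add p n
  | l + 1, (p, true), n => by
    simp only [phi, addc]
    rw [phi_addc h l, mul_assoc, mul_assoc, h.cen]
  | l + 1, (p, false), n => by
    simp only [phi, addc]
    rw [phi_addc h l]

theorem phi_lam {k : ℕ} (h : Rels sq com k ν x) {i : ℕ} (hi : i < k) : ∀ (l : ℕ), l ≤ i →
    ∀ (q : El N l), x i * phi ν x l q = phi ν x l q * x i * ν (lam com i l q)
  | 0, _, q => by simp only [phi, lam, h.zero, mul_one]; exact (h.cen _ _).symm
  | l + 1, hl, (q, true) => by
    simp only [phi, lam]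
    rw [← mul_assoc, phi_lam h hi l (by omega) q, h.add, mul_assoc _ _ (x l),
      h.cen (lam com i l q) (x l), ← mul_assoc, mul_assoc _ (x i) (x l), h.com i hi l (by omega),
      h.cen (lam com i l q) (ν (com i l))]
    simp only [mul_assoc]
  | l + 1, hl, (q, false) => by
    simp only [phi, lam]
    exact phi_lam h hi l (by omega) q

theorem phi_mul : ∀ {k : ℕ}, Rels sq com k ν x → ∀ (p q : El N k),
    phi ν x k (mul sq com k p q) = phi ν x k p * phi ν x k q
  | 0, h, p, q => h.add p q
  | k + 1, h, (p, false), (q, false) => by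
    simp only [phi, mul]; exact phi_mul (h.mono (by omega)) p q
  | k + 1, h, (p, false), (q, true) => by
    simp only [phi, mul]; rw [phi_mul (h.mono (by omega)) p q, mul_assoc]
  | k + 1, h, (p, true), (q, false) => by
    simp only [phi, mul]
    rw [phi_addc h, phi_mul (h.mono (by omega)) p q, mul_assoc _ (x k) _,
      phi_lam h (by omega) k le_rfl, mul_assoc _ _ (x k), h.cen (lam com k k q) (x k)]
    simp only [mul_assoc]
  | k + 1, h, (p, true), (q, true) => by
    simp only [phi, mul]
    rw [phi_addc h, phi_mul (h.mono (by omega)) p q, mul_assoc _ (x k) _, ← mul_assoc (x k) _ _,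
      phi_lam h (by omega) k le_rfl, h.add, mul_assoc _ _ (x k), h.cen (lam com k k q) (x k),
      h.cen (lam com k k q) (ν (sq k)), ← h.sq k (by omega)]
    simp only [mul_assoc]

end model
end FG

namespace FG

section back
variable {G : Type*} [Group G]

theorem inv_of_sq {z : G} (hzz : z * z = 1) {a : G} (h : a * a = z) : a⁻¹ = z * a := by
  apply inv_eq_of_mul_eq_one_left
  rw [mul_assoc, h, hzz]

theorem inv_of_sq1 {a : G} (h : a * a = 1) : a⁻¹ = a := inv_eq_of_mul_eq_one_left h

theorem com_of_sq {z : G} (hzz : z * z = 1) (hzc : ∀ g, z * g = g * z)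
    (hsq : ∀ g : G, g * g = 1 ∨ g * g = z) (a b : G) : a * b = b * a ∨ a * b = z * (b * a) := by
  have hinv : ∀ a : G, a⁻¹ = a ∨ a⁻¹ = z * a := fun a => by
    rcases hsq a with h | h
    · exact Or.inl (inv_of_sq1 h)
    · exact Or.inr (inv_of_sq hzz h)
  have e : ∀ g, z * (z * g) = g := fun g => by rw [← mul_assoc, hzz, one_mul]
  have hb : ∀ g, b * (z * g) = z * (b * g) := fun g => by
    rw [← mul_assoc, ← hzc, mul_assoc]
  have h1 : (a * b)⁻¹ = b⁻¹ * a⁻¹ := mul_inv_rev a b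
  rcases hinv (a * b) with h | h <;> rcases hinv a with h2 | h2 <;> rcases hinv b with h3 | h3 <;>
    rw [h, h2, h3] at h1 <;> (try simp only [mul_assoc, hb, e] at h1)
  · exact Or.inl h1
  · exact Or.inr h1
  · exact Or.inr h1
  · exact Or.inl h1
  · right; rw [← h1, e]
  · left; have := congrArg (z * ·) h1; simpa only [e] using this
  · left; have := congrArg (z * ·) h1; simpa only [e] using this
  · right; rw [← h1, e]

theorem filled_case1 {z : G} (hzz : z * z = 1) (hzc : ∀ g, z * g = g * z)
    (hsq : ∀ g : G, g * g = 1 ∨ g * g = z) {T : Set G} (hT : LocallyMaximalPF T) (hz : z ∉ T) :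
    Fills T := by
  have hcom := com_of_sq hzz hzc hsq
  have e : ∀ g, z * (z * g) = g := fun g => by rw [← mul_assoc, hzz, one_mul]
  have hm : ∀ (b g : G), b * (z * g) = z * (b * g) := fun b g => by
    rw [← mul_assoc, ← hzc, mul_assoc]
  have hpf := pf_iff.1 hT.1
  have hinv : ∀ x ∈ T, x⁻¹ ∈ T := by
    intro x hx
    rcases hsq x with h | h
    · rwa [inv_of_sq1 h]
    rw [inv_of_sq hzz h]
    by_contra hn
    have hy1 : z * x ≠ 1 := by
      intro h1
      have := e x
      rw [h1, mul_one] at this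
      exact hz (this ▸ hx)
    have hyy : (z * x) * (z * x) = z := by rw [mul_assoc, hm, e, h]
    rcases lm_reason hT hn hy1 with ⟨s, hs, t, ht, h' | h' | h'⟩ | h'
    · have hx' : x = z * (s * t) := by rw [← h', e]
      rcases hcom s t with hc | hc
      · rcases hsq s with hs2 | hs2
        · rcases hsq t with ht2 | ht2
          · have : (s * t) * (s * t) = 1 := by
              rw [mul_assoc, ← mul_assoc t s t, ← hc, mul_assoc s t t, ht2, mul_one, hs2]
            rw [← h', hyy] at this
            rw [this, one_mul] at h'
            rw [this] at h
            rw [this, one_mul] at hyy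
            exact hpf s hs t ht (h' ▸ hx)
          · refine hpf x hx t ht ?_
            rw [hx', mul_assoc, mul_assoc, ht2, ← hzc, e]; exact hs
        · refine hpf s hs x hx ?_
          rw [hx', hm, ← mul_assoc s s t, hs2, e]; exact ht
      · refine hpf t ht s hs ?_
        rw [hc, e] at hx'
        exact hx' ▸ hx
    · have hx' : x = z * (t * s⁻¹) := by rw [← h', mul_assoc, mul_assoc, mul_inv_cancel, mul_one, e]
      rcases hsq s with hs2 | hs2
      · rw [inv_of_sq1 hs2] at hx'
        rcases hcom t s with hc | hc
        · have : t * t = z := by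
            rw [← h, hx', mul_assoc, hm, e, mul_assoc, ← mul_assoc s t s, ← hc, mul_assoc t s s,
              hs2, mul_one]
          refine hpf t ht x hx ?_
          rw [hx', hm, ← mul_assoc t t s, this, e]; exact hs
        · rw [hc, e] at hx'
          exact hpf s hs t ht (hx' ▸ hx)
      · rw [inv_of_sq hzz hs2, hm, e] at hx'
        exact hpf t ht s hs (hx' ▸ hx)
    · have hx' : x = z * (s⁻¹ * t) := by rw [← h', hm, hm, e, inv_mul_cancel_left]
      rcases hsq s with hs2 | hs2
      · rw [inv_of_sq1 hs2] at hx'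
        rcases hcom s t with hc | hc
        · have : t * t = z := by
            rw [← h, hx', mul_assoc, hm, e, hc, mul_assoc, ← mul_assoc s t s, hc, mul_assoc t s s,
              hs2, mul_one]
          refine hpf x hx t ht ?_
          rw [hx', mul_assoc, mul_assoc, this, ← hzc, e]; exact hs
        · rw [hc, e] at hx'
          exact hpf t ht s hs (hx' ▸ hx)
      · rw [inv_of_sq hzz hs2, mul_assoc, e] at hx'
        exact hpf s hs t ht (hx' ▸ hx)
    · rw [hyy] at h'; exact hz h'
  intro g hg
  by_cases hgT : g ∈ T
  · exact Or.inl hgT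
  right
  rcases lm_reason hT hgT hg with ⟨s, hs, t, ht, h' | h' | h'⟩ | h'
  · exact ⟨s, hs, t, ht, h'.symm⟩
  · exact ⟨t, ht, s⁻¹, hinv s hs, by simp [← h']⟩
  · exact ⟨s⁻¹, hinv s hs, t, ht, by simp [← h']⟩
  · rcases hsq g with h | h
    · exact absurd (h ▸ h') (pf_one hT.1)
    · exact absurd (h ▸ h') hz

/-- The facts about the groups of the list that yield filledness. -/
structure Facts (z c : G) : Prop where
  z1 : z ≠ 1
  zz : z * z = 1
  zc : ∀ g, z * g = g * z
  sqs : ∀ g : G, g * g = 1 ∨ g * g = z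
  one : ∀ g : G, g * g = z → ∃ u : G, u * u = 1 ∧ u * g ≠ g * u
  two : ∀ u v : G, u * u = 1 → v * v = 1 → u * v = v * u → (¬ ∀ h, u * h = h * u) →
    (¬ ∀ h, v * h = h * v) → ∀ h, (u * v) * h = h * (u * v)
  three : ∀ g : G, (∀ h, g * h = h * g) → g = 1 ∨ g = z ∨ g = c ∨ g = z * c

theorem Facts.filled {z c : G} (F : Facts z c) : Filled G := by
  intro T hT
  by_cases hz : z ∈ T
  swap
  · exact filled_case1 F.zz F.zc F.sqs hT hz
  have hzz := F.zz
  have hzc := F.zc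
  have hsq := F.sqs
  have hcom := com_of_sq hzz hzc hsq
  have e : ∀ g, z * (z * g) = g := fun g => by rw [← mul_assoc, hzz, one_mul]
  have hm : ∀ (b g : G), b * (z * g) = z * (b * g) := fun b g => by
    rw [← mul_assoc, ← hzc, mul_assoc]
  have hpf := pf_iff.1 hT.1
  have hT2 : ∀ s ∈ T, s * s = 1 := fun s hs => by
    rcases hsq s with h | h
    · exact h
    · exact absurd (h ▸ hz) (hpf s hs s hs)
  have inv : ∀ u, u * u = 1 → u ≠ 1 → u ∉ T → ∃ s ∈ T, ∃ t ∈ T, s * t = u := by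
    intro u hu hu1 huT
    rcases lm_reason hT huT hu1 with ⟨s, hs, t, ht, h' | h' | h'⟩ | h'
    · exact ⟨s, hs, t, ht, h'.symm⟩
    · exact ⟨t, ht, s, hs, by rw [← h', mul_assoc, hT2 s hs, mul_one]⟩
    · exact ⟨s, hs, t, ht, by rw [← h', ← mul_assoc, hT2 s hs, one_mul]⟩
    · exact absurd (hu ▸ h') (pf_one hT.1)
  have key : ∀ u, u * u = 1 → (¬ ∀ h, u * h = h * u) → u ∉ T → z * u ∉ T →
      ∃ s ∈ T, (∀ h, s * h = h * s) ∧ s ≠ z ∧ s * u ∈ T := by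
    intro u hu hun huT hzu
    have hu1 : u ≠ 1 := by rintro rfl; simp at hun
    obtain ⟨s, hs, t, ht, rfl⟩ := inv u hu hu1 huT
    have hst : s * t = t * s := by
      have h1 := inv_of_sq1 hu
      rw [mul_inv_rev, inv_of_sq1 (hT2 s hs), inv_of_sq1 (hT2 t ht)] at h1
      exact h1.symm
    have hst' : s * (s * t) = t := by rw [← mul_assoc, hT2 s hs, one_mul]
    have hst'' : t * (s * t) = s := by rw [hst, ← mul_assoc, hT2 t ht, one_mul]
    by_cases hsc : ∀ h, s * h = h * s
    · refine ⟨s, hs, hsc, ?_, ?_⟩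
      · rintro rfl
        rw [hst'] at hzu; exact hzu ht
      · rwa [hst']
    · by_cases htc : ∀ h, t * h = h * t
      · refine ⟨t, ht, htc, ?_, ?_⟩
        · rintro rfl
          rw [hst''] at hzu; exact hzu hs
        · rwa [hst'']
      · exact absurd (F.two s t (hT2 s hs) (hT2 t ht) hst hsc htc) hun
  have key2 : ∀ u, u * u = 1 → (¬ ∀ h, u * h = h * u) → u ∈ T ∨ z * u ∈ T := by
    intro u hu hun
    by_contra hcon
    push Not at hcon
    obtain ⟨s, hs, hsc, hsz, hsu⟩ := key u hu hun hcon.1 hcon.2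
    obtain ⟨s', hs', hsc', hsz', hsu'⟩ := key (z * u) (by rw [mul_assoc, hm, e, hu])
      (by
        intro h; apply hun; intro g
        have := h g
        rw [mul_assoc, hm] at this
        exact mul_left_cancel this) hcon.2 (by rw [e]; exact hcon.1)
    have h1 : ∀ s ∈ T, (∀ h, s * h = h * s) → s ≠ z → s = c ∨ s = z * c := by
      intro s hs h1 h2
      rcases F.three s h1 with h | h | h | h
      · exact absurd (h ▸ hs) (pf_one hT.1)
      · exact absurd h h2
      · exact Or.inl h
      · exact Or.inr h
    have h2 : s = s' := by
      rcases h1 s hs hsc hsz with h | h <;> rcases h1 s' hs' hsc' hsz' with h' | h'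
      · rw [h, h']
      · exact absurd (by rw [h, ← h']; exact hs') (hpf z hz s hs)
      · exact absurd (by rw [h', ← h]; exact hs) (hpf z hz s' hs')
      · rw [h, h']
    subst h2
    rw [hm] at hsu'
    exact hpf z hz _ hsu hsu'
  intro g hg
  by_cases hgT : g ∈ T
  · exact Or.inl hgT
  right
  rcases hsq g with h | h
  · obtain ⟨s, hs, t, ht, h'⟩ := inv g h hg hgT
    exact ⟨s, hs, t, ht, h'⟩
  obtain ⟨u, hu, hug⟩ := F.one g h
  have hug' : u * g = z * (g * u) := (hcom u g).resolve_left hug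
  have hv : (u * g) * (u * g) = 1 := by
    rw [mul_assoc, hug', hm, hm, ← mul_assoc g g u, h, hm, hu, ← mul_assoc, hzz, one_mul]
  have hvn : ¬ ∀ h, (u * g) * h = h * (u * g) := by
    intro h1
    have := h1 u
    rw [mul_assoc] at this
    exact hug (mul_left_cancel this).symm
  have hun : ¬ ∀ h, u * h = h * u := fun h1 => hug (h1 g)
  have hgu' : g * u = z * (u * g) := by rw [hug', e]
  have p1 : u * (u * g) = g := by rw [← mul_assoc, hu, one_mul]
  have p2 : (u * g) * u = z * g := by rw [mul_assoc, hgu', hm, p1]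
  rcases key2 u hu hun with a | a <;> rcases key2 _ hv hvn with b | b
  · exact ⟨_, a, _, b, p1⟩
  · exact ⟨_, b, _, a, by simp only; rw [mul_assoc, p2, e]⟩
  · exact ⟨_, b, _, a, by simp only; rw [hm, p2, e]⟩
  · exact ⟨_, a, _, b, by simp only; rw [mul_assoc, hm, e, p1]⟩

end back
end FG

namespace FG

class FinN (N : Type) where
  l : List N
  mem : ∀ n, n ∈ l

instance : FinN Bool := ⟨[false, true], by decide⟩
instance : FinN (Bool × Bool) := ⟨[(false, false), (true, false), (false, true), (true, true)], by decide⟩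

instance decAll {N : Type} [FinN N] (k : ℕ) (P : El N k → Prop) [DecidablePred P] :
    Decidable (∀ p, P p) :=
  decidable_of_iff ((elems (FinN.l : List N) k).all (fun p => decide (P p)) = true)
    ⟨fun h p => of_decide_eq_true (List.all_eq_true.1 h p (mem_elems FinN.mem k p)),
      fun h => List.all_eq_true.2 fun p _ => decide_eq_true (h p)⟩

instance decEx {N : Type} [FinN N] (k : ℕ) (P : El N k → Prop) [DecidablePred P] :
    Decidable (∃ p, P p) :=
  decidable_of_iff (∃ p ∈ elems FinN.l k, P p)
    ⟨fun ⟨p, _, h⟩ => ⟨p, h⟩, fun ⟨p, h⟩ => ⟨p, mem_elems FinN.mem k p, h⟩⟩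

instance finEl {N : Type} [FinN N] (k : ℕ) : Finite (El N k) :=
  Set.finite_univ_iff.1 ((List.finite_toSet (elems FinN.l k)).subset
    fun p _ => mem_elems FinN.mem k p)

theorem card_El {N : Type} (k : ℕ) : Nat.card (El N k) = Nat.card N * 2 ^ k := by
  induction k with
  | zero => simp [El]
  | succ k ih =>
    rw [El, Nat.card_prod, ih, pow_succ, mul_assoc]
    simp

section
variable {N : Type} [XN N] {G : Type*} [Group G]
variable {sq : ℕ → N} {com : ℕ → ℕ → N} {ν : N → G} {x : ℕ → G}

theorem phi_succ_inj [FinN N] {k : ℕ} (h : Rels sq com (k + 1) ν x)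
    (hi : Function.Injective (phi ν x k)) (hx : ∀ p, phi ν x k p ≠ x k) :
    Function.Injective (phi ν x (k + 1)) := by
  have hk : Rels sq com k ν x := h.mono (by omega)
  have hx' : ∀ p q, phi ν x k p * x k ≠ phi ν x k q := by
    intro p q hpq
    -- left multiplication by `p` permutes the model
    have hinj : Function.Injective (mul sq com k p) := by
      intro a b hab
      have := congrArg (phi ν x k) hab
      rw [phi_mul hk, phi_mul hk] at this
      exact hi (mul_left_cancel this)
    obtain ⟨r, hr⟩ := (Finite.injective_iff_surjective.1 hinj) q
    apply hx r
    rw [← hr, phi_mul hk] at hpq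
    exact (mul_left_cancel hpq).symm
  rintro ⟨p, e⟩ ⟨q, f⟩ hpq
  cases e <;> cases f <;> simp only [phi] at hpq
  · rw [hi hpq]
  · exact absurd hpq.symm (hx' _ _)
  · exact absurd hpq (hx' _ _)
  · rw [hi (mul_right_cancel hpq)]

def exB {M : Type} [DecidableEq M] (m : M → M → M) (l : List M) (x : M) : Bool :=
  (l.any fun a => l.any fun b => decide (x = m a b) || decide (m x a = b) || decide (m a x = b))
    || decide (m x x ∈ l)

def certB {M : Type} [DecidableEq M] (m : M → M → M) (al l : List M) (g : M) : Bool :=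
  (l.all fun a => l.all fun b => decide (m a b ∉ l)) && decide (m g g ≠ g) && exB m l g &&
    al.all fun a => exB m l a || al.all fun b => decide (m a b ≠ g) || exB m l b

theorem ex_of_exB {M : Type} [DecidableEq M] {m : M → M → M} {l : List M} {φ : M → G}
    (hm : ∀ p q, φ (m p q) = φ p * φ q) {p : M} (hp : exB m l p = true) :
    Ex (φ '' {p | p ∈ l}) (φ p) := by
  simp only [exB, Bool.or_eq_true, List.any_eq_true, decide_eq_true_eq] at hp
  rcases hp with ⟨a, ha, b, hb, h⟩ | h
  · refine Or.inl ⟨φ a, ⟨a, ha, rfl⟩, φ b, ⟨b, hb, rfl⟩, ?_⟩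
    simp only [← hm]
    rcases h with (rfl | rfl) | rfl <;> simp
  · exact Or.inr (by rw [← hm]; exact ⟨_, h, rfl⟩)

theorem cert_model [Finite G] {M : Type} [DecidableEq M] {m : M → M → M} {al l : List M} {g : M}
    (hal : ∀ p, p ∈ al) {φ : M → G} (hφ : Function.Bijective φ)
    (hm : ∀ p q, φ (m p q) = φ p * φ q) (hc : certB m al l g = true) : ¬ Filled G := by
  have hmem : ∀ p, φ p ∈ φ '' {p | p ∈ l} ↔ p ∈ l := fun p => by
    simp [hφ.1.eq_iff]
  have hE : ∀ p, exB m l p = true → Ex (φ '' {p | p ∈ l}) (φ p) := fun p => ex_of_exB hm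
  simp only [certB, Bool.and_eq_true, Bool.or_eq_true, List.all_eq_true, decide_eq_true_eq] at hc
  obtain ⟨⟨⟨h1, h2⟩, h3⟩, h4⟩ := hc
  refine not_filled_cert (S := φ '' {p | p ∈ l}) ?_ (g := φ g) ?_ (hE g h3) ?_
  · rw [pf_iff]
    rintro _ ⟨a, ha, rfl⟩ _ ⟨b, hb, rfl⟩
    rw [← hm, hmem]
    exact h1 a ha b hb
  · intro h
    apply h2
    apply hφ.1
    rw [hm, h, one_mul]
  · intro a b hab
    obtain ⟨a, rfl⟩ := hφ.2 a
    obtain ⟨b, rfl⟩ := hφ.2 b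
    rw [← hm, hφ.1.eq_iff] at hab
    rcases h4 a (hal a) with h | h
    · exact Or.inl (hE a h)
    · rcases h b (hal b) with h | h
      · exact absurd hab h
      · exact Or.inr (hE b h)

end

/-! ### The groups of the list -/

section std
variable {G : Type*} [Group G]

def nu (z : G) : Bool → G
  | true => z
  | false => 1

def sqS (k i : ℕ) : Bool := decide (i = 0) || (decide (4 ≤ k) && (decide (i = 2) || decide (i = 3)))
def comS (k i j : ℕ) : Bool := (decide (i = 1) && decide (j = 0)) ||
  (decide (4 ≤ k) && decide (i = 3) && decide (j = 2))

def mulS (k : ℕ) : El Bool k → El Bool k → El Bool k := mul (sqS k) (comS k) k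

theorem nu_add {z : G} (hzz : z * z = 1) (a b : Bool) : nu z (XN.add a b) = nu z a * nu z b := by
  cases a <;> cases b <;> simp [nu, XN.add, hzz]

structure IsStdW (k : ℕ) (G : Type*) [Group G] (z : G) (x : ℕ → G) : Prop where
  z1 : z ≠ 1
  rels : Rels (sqS k) (comS k) k (nu z) x
  bij : Function.Bijective (phi (nu z) x k)

def IsStd (k : ℕ) (G : Type*) [Group G] : Prop := ∃ (z : G) (x : ℕ → G), IsStdW k G z x

theorem rels_nu {z : G} (hzz : z * z = 1) (hzc : ∀ g, z * g = g * z) {sq : ℕ → Bool}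
    {com : ℕ → ℕ → Bool} {k : ℕ} {x : ℕ → G} (h1 : ∀ i < k, x i * x i = nu z (sq i))
    (h2 : ∀ i < k, ∀ j < i, x i * x j = x j * x i * nu z (com i j)) :
    Rels sq com k (nu z) x :=
  ⟨rfl, nu_add hzz, fun a g => by cases a <;> simp [nu, hzc], h1, h2⟩

theorem IsStdW.zz {k : ℕ} {z : G} {x : ℕ → G} (h : IsStdW k G z x) : z * z = 1 := by
  have := h.rels.add true true
  simpa [nu, XN.add] using this.symm

theorem IsStdW.zc {k : ℕ} {z : G} {x : ℕ → G} (h : IsStdW k G z x) (g : G) : z * g = g * z :=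
  h.rels.cen true g

theorem IsStdW.mul {k : ℕ} {z : G} {x : ℕ → G} (h : IsStdW k G z x) (p q : El Bool k) :
    phi (nu z) x k (mulS k p q) = phi (nu z) x k p * phi (nu z) x k q := phi_mul h.rels p q

theorem IsStd.card {k : ℕ} (h : IsStd k G) : Nat.card G = 2 ^ (k + 1) := by
  obtain ⟨z, x, h⟩ := h
  rw [← Nat.card_congr (Equiv.ofBijective _ h.bij), card_El]
  simp [pow_succ, mul_comm]

theorem IsStd.finite {k : ℕ} (h : IsStd k G) : Finite G := by
  obtain ⟨z, x, h⟩ := h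
  exact Finite.of_surjective _ h.bij.2

theorem iso_of_models {M : Type} {m : M → M → M} {H : Type*} [Group H] {φ : M → G} {ψ : M → H}
    (hφ : Function.Bijective φ) (hψ : Function.Bijective ψ)
    (h1 : ∀ p q, φ (m p q) = φ p * φ q) (h2 : ∀ p q, ψ (m p q) = ψ p * ψ q) :
    Nonempty (G ≃* H) := by
  let e := (Equiv.ofBijective φ hφ).symm.trans (Equiv.ofBijective ψ hψ)
  have he : ∀ p, e (φ p) = ψ p := fun p => by
    simp [e, Equiv.ofBijective_symm_apply_apply]
  refine ⟨⟨e, fun a b => ?_⟩⟩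
  obtain ⟨a, rfl⟩ := hφ.2 a
  obtain ⟨b, rfl⟩ := hφ.2 b
  simp only [Equiv.toFun_as_coe]
  rw [← h1, he, he, he, h2]

theorem IsStd.iso {k : ℕ} {H : Type*} [Group H] (h : IsStd k G) (h' : IsStd k H) :
    Nonempty (G ≃* H) := by
  obtain ⟨z, x, h⟩ := h
  obtain ⟨z', x', h'⟩ := h'
  exact iso_of_models h.bij h'.bij h.mul h'.mul

def MF (k : ℕ) (z c : El Bool k) : Prop :=
  (∀ g : El Bool k, mulS k g g = inN k false ∨ mulS k g g = z) ∧
  (∀ g : El Bool k, mulS k g g = z → ∃ u, mulS k u u = inN k false ∧ mulS k u g ≠ mulS k g u) ∧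
  (∀ u : El Bool k, mulS k u u = inN k false → (¬ ∀ h, mulS k u h = mulS k h u) →
    ∀ v, mulS k v v = inN k false → mulS k u v = mulS k v u → (¬ ∀ h, mulS k v h = mulS k h v) →
    ∀ h, mulS k (mulS k u v) h = mulS k h (mulS k u v)) ∧
  (∀ g : El Bool k, (∀ h, mulS k g h = mulS k h g) →
    g = inN k false ∨ g = z ∨ g = c ∨ g = mulS k z c)

set_option synthInstance.maxSize 2000 in
set_option synthInstance.maxHeartbeats 400000 in
instance (k : ℕ) (z c : El Bool k) : Decidable (MF k z c) := by
  unfold MF; infer_instance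

theorem mf2 : MF 2 (inN 2 true) (inN 2 true) := by decide +kernel
theorem mf3 : MF 3 (inN 3 true) (topE 2 false) := by decide +kernel
theorem mf4 : MF 4 (inN 4 true) (inN 4 true) := by decide +kernel
theorem mf5 : MF 5 (inN 5 true) (topE 4 false) := by decide +kernel

theorem IsStdW.facts_of {k : ℕ} {z : G} {x : ℕ → G} (h : IsStdW k G z x) {c : El Bool k}
    (hM : MF k (inN k true) c) : Facts z (phi (nu z) x k c) := by
  obtain ⟨m1, m2, m3, m4⟩ := hM
  have h1 : phi (nu z) x k (inN k false) = 1 := phi_inN k false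
  have hz : phi (nu z) x k (inN k true) = z := phi_inN k true
  have hc : ∀ p, (∀ h, phi (nu z) x k p * h = h * phi (nu z) x k p) ↔
      ∀ q, mulS k p q = mulS k q p := fun p => by
    rw [h.bij.2.forall]
    simp only [← h.mul, h.bij.1.eq_iff]
  refine ⟨h.z1, h.zz, h.zc, ?_, ?_, ?_, ?_⟩
  · intro p
    obtain ⟨p, rfl⟩ := h.bij.2 p
    rcases m1 p with e | e
    · left; rw [← h.mul, e, h1]
    · right; rw [← h.mul, e, hz]
  · intro p
    obtain ⟨p, rfl⟩ := h.bij.2 p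
    intro hp
    rw [← h.mul] at hp
    obtain ⟨u, hu1, hu2⟩ := m2 p (h.bij.1 (by rw [hp, hz]))
    refine ⟨phi (nu z) x k u, by rw [← h.mul, hu1, h1], ?_⟩
    rw [← h.mul, ← h.mul]
    exact fun h' => hu2 (h.bij.1 h')
  · intro u v
    obtain ⟨u, rfl⟩ := h.bij.2 u
    obtain ⟨v, rfl⟩ := h.bij.2 v
    rw [hc, hc]
    simp only [← h.mul]
    rw [hc, ← h1, h.bij.1.eq_iff, h.bij.1.eq_iff, h.bij.1.eq_iff]
    exact fun a b c d e => m3 u a d v b c e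
  · intro g
    obtain ⟨g, rfl⟩ := h.bij.2 g
    rw [hc]
    intro hg
    rcases m4 g hg with e | e | e | e
    · left; rw [e, h1]
    · right; left; rw [e, hz]
    · right; right; left; rw [e]
    · right; right; right; rw [e, h.mul, hz]

theorem IsStdW.facts {k : ℕ} {z : G} {x : ℕ → G} (hk : 2 ≤ k ∧ k ≤ 5) (h : IsStdW k G z x) :
    ∃ c, Facts z c := by
  obtain ⟨h2, h5⟩ := hk
  interval_cases k
  · exact ⟨_, h.facts_of mf2⟩
  · exact ⟨_, h.facts_of mf3⟩
  · exact ⟨_, h.facts_of mf4⟩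
  · exact ⟨_, h.facts_of mf5⟩

theorem IsStd.filled {k : ℕ} (hk : 2 ≤ k ∧ k ≤ 5) (h : IsStd k G) : Filled G := by
  obtain ⟨z, x, h⟩ := h
  obtain ⟨c, h⟩ := h.facts hk
  exact h.filled

theorem IsStd.of_iso {k : ℕ} {H : Type*} [Group H] (h : IsStd k G) (f : G ≃* H) : IsStd k H := by
  obtain ⟨z, x, h⟩ := h
  have hν : ∀ b, nu (f z) b = f (nu z b) := fun b => by cases b <;> simp [nu]
  have hφ : ∀ l p, phi (nu (f z)) (fun i => f (x i)) l p = f (phi (nu z) x l p) := by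
    intro l
    induction l with
    | zero => exact hν
    | succ l ih =>
      rintro ⟨p, e⟩
      cases e <;> simp [phi, ih]
  refine ⟨f z, fun i => f (x i), by simpa using h.z1, ⟨rfl, ?_, ?_, ?_, ?_⟩, ?_⟩
  · intro a b; rw [hν, h.rels.add]; simp [hν]
  · intro a g
    obtain ⟨g, rfl⟩ := f.surjective g
    rw [hν, ← map_mul, h.rels.cen, map_mul]
  · intro i hi; rw [← map_mul, h.rels.sq i hi, hν]
  · intro i hi j hj; rw [← map_mul, h.rels.com i hi j hj, hν]; simp
  · have : phi (nu (f z)) (fun i => f (x i)) k = f ∘ phi (nu z) x k := funext (hφ k)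
    rw [this]
    exact f.bijective.comp h.bij

theorem isStd_prod {k : ℕ} (hk : k = 2 ∨ k = 4) (h : IsStd k G) :
    IsStd (k + 1) (G × Multiplicative (ZMod 2)) := by
  obtain ⟨z, x, h⟩ := h
  have hν : ∀ b, nu ((z, 1) : G × Multiplicative (ZMod 2)) b = (nu z b, 1) :=
    fun b => by cases b <;> rfl
  let x' : ℕ → G × Multiplicative (ZMod 2) :=
    fun i => if i < k then (x i, 1) else (1, Multiplicative.ofAdd 1)
  have hx : ∀ i < k, x' i = (x i, 1) := fun i hi => by simp [x', hi]
  have hxk : x' k = (1, Multiplicative.ofAdd 1) := by simp [x']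
  have hsq : ∀ i < k, sqS (k + 1) i = sqS k i := by
    rcases hk with rfl | rfl
    · decide
    · decide
  have hcom : ∀ i < k, ∀ j < i, comS (k + 1) i j = comS k i j := by
    rcases hk with rfl | rfl
    · decide
    · decide
  have hsqk : sqS (k + 1) k = false := by rcases hk with rfl | rfl <;> decide
  have hcomk : ∀ j < k, comS (k + 1) k j = false := by rcases hk with rfl | rfl <;> decide
  have h11 : Multiplicative.ofAdd (1 : ZMod 2) * Multiplicative.ofAdd 1 = 1 := by decide
  have hR : Rels (sqS (k + 1)) (comS (k + 1)) (k + 1) (nu ((z, 1) : G × Multiplicative (ZMod 2))) x' := by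
    refine rels_nu (by simp [h.zz]) (fun g => by ext <;> simp [h.zc]) ?_ ?_
    · intro i hi
      rcases Nat.lt_succ_iff_lt_or_eq.1 hi with hi | rfl
      · rw [hsq i hi, hx i hi, hν, ← h.rels.sq i hi]; simp
      · rw [hsqk, hxk]; simp [nu, h11]
    · intro i hi j hj
      rcases Nat.lt_succ_iff_lt_or_eq.1 hi with hi | rfl
      · rw [hcom i hi j hj, hx i hi, hx j (by omega), hν]
        simp [h.rels.com i hi j hj]
      · rw [hcomk j hj, hxk, hx j hj]; simp [nu]
  have hφ : ∀ l ≤ k, ∀ p, phi (nu ((z, 1) : G × Multiplicative (ZMod 2))) x' l p =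
      (phi (nu z) x l p, 1) := by
    intro l
    induction l with
    | zero => exact fun _ => hν
    | succ l ih =>
      rintro hl ⟨p, e⟩
      cases e <;> simp [phi, ih (by omega), hx l (by omega)]
  refine ⟨(z, 1), x', by simp [h.z1], hR, ?_, ?_⟩
  · refine phi_succ_inj hR ?_ ?_
    · intro p q hpq
      rw [hφ k le_rfl, hφ k le_rfl] at hpq
      exact h.bij.1 (by simpa using hpq)
    · intro p hp
      rw [hφ k le_rfl, hxk] at hp
      have := congrArg Prod.snd hp
      revert this
      simp only
      decide
  · rintro ⟨g, a⟩
    obtain ⟨p, rfl⟩ := h.bij.2 g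
    have ha : a = 1 ∨ a = Multiplicative.ofAdd 1 := by revert a; decide
    rcases ha with rfl | rfl
    · exact ⟨(p, false), hφ k le_rfl p⟩
    · refine ⟨(p, true), ?_⟩
      change phi (nu ((z, 1) : G × Multiplicative (ZMod 2))) x' k p * x' k = _
      rw [hφ k le_rfl p, hxk]; simp

def xD (i : ℕ) : DihedralGroup 4 × QuaternionGroup 2 :=
  match i with
  | 0 => (.r 1, 1)
  | 1 => (.sr 0, 1)
  | 2 => (1, .a 1)
  | _ => (1, .xa 0)

theorem isStd_D8 : IsStd 2 (DihedralGroup 4) := by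
  refine ⟨.r 2, fun i => (xD i).1, by decide, rels_nu (by decide) (by decide) (by decide) (by decide),
    ?_, ?_⟩
  · unfold Function.Injective; decide
  · unfold Function.Surjective; decide

theorem isStd_D8Q8 : IsStd 4 D8Q8 := by
  let π : DihedralGroup 4 × QuaternionGroup 2 →* D8Q8 := QuotientGroup.mk' d8q8Center
  have hπ : Function.Surjective π := QuotientGroup.mk'_surjective _
  let c : DihedralGroup 4 × QuaternionGroup 2 := (.r 2, .a 2)
  have hmem : ∀ g, g ∈ d8q8Center ↔ g = 1 ∨ g = c := by
    intro g
    constructor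
    · rintro ⟨k, rfl⟩
      have h2 : c ^ (2 : ℤ) = 1 := by decide
      rcases Int.even_or_odd' k with ⟨m, rfl | rfl⟩
      · left; change c ^ (2 * m) = 1; rw [zpow_mul, h2, one_zpow]
      · right; change c ^ (2 * m + 1) = c; rw [zpow_add, zpow_mul, h2, one_zpow, one_mul, zpow_one]
    · rintro (rfl | rfl)
      · exact one_mem _
      · exact Subgroup.mem_zpowers _
  have hker : ∀ a b, π a = π b ↔ a = b ∨ a * c = b := by
    intro a b
    change (QuotientGroup.mk a : (DihedralGroup 4 × QuaternionGroup 2) ⧸ d8q8Center) =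
      QuotientGroup.mk b ↔ _
    rw [QuotientGroup.eq, hmem, inv_mul_eq_one, inv_mul_eq_iff_eq_mul, eq_comm (a := b)]
  have h1 : ∀ g, π g = 1 ↔ 1 = g ∨ 1 * c = g := fun g => by
    rw [← hker, map_one, eq_comm]
  let Z : DihedralGroup 4 × QuaternionGroup 2 := (.r 2, 1)
  have hν : ∀ b, nu (π Z) b = π (nu Z b) := fun b => by cases b <;> simp [nu]
  have hφ : ∀ l p, phi (nu (π Z)) (fun i => π (xD i)) l p = π (phi (nu Z) xD l p) := by
    intro l
    induction l with
    | zero => exact hν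
    | succ l ih =>
      rintro ⟨p, e⟩
      cases e <;> simp [phi, ih]
  refine ⟨π Z, fun i => π (xD i), ?_, rels_nu ?_ ?_ ?_ ?_, ?_, ?_⟩
  · rw [Ne, h1]; decide
  · rw [← map_mul, h1]; decide
  · intro g
    obtain ⟨g, rfl⟩ := hπ g
    rw [← map_mul, ← map_mul, hker]
    left; revert g; decide
  · intro i hi
    rw [hν, ← map_mul, hker]
    revert i; decide
  · intro i hi j hj
    rw [hν, ← map_mul, ← map_mul, ← map_mul, hker]
    revert hj; revert j; revert hi; revert i; decide
  · intro p q
    rw [hφ, hφ, hker]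
    revert p q; decide +kernel
  · intro g
    obtain ⟨g, rfl⟩ := hπ g
    simp only [hφ, hker]
    revert g; decide +kernel

end std
end FG

namespace FG

section caseA
variable {G : Type*} [Group G]

structure Z2 (z : G) : Prop where
  z1 : z ≠ 1
  zz : z * z = 1
  zc : ∀ g, z * g = g * z
  sqs : ∀ g : G, g * g = 1 ∨ g * g = z

variable {z : G}

theorem Z2.e (h : Z2 z) (g : G) : z * (z * g) = g := by rw [← mul_assoc, h.zz, one_mul]
theorem Z2.m (h : Z2 z) (b g : G) : b * (z * g) = z * (b * g) := by
  rw [← mul_assoc, ← h.zc, mul_assoc]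
theorem Z2.com (h : Z2 z) (a b : G) : a * b = b * a ∨ a * b = z * (b * a) :=
  com_of_sq h.zz h.zc h.sqs a b
theorem Z2.ne (h : Z2 z) (g : G) : g ≠ z * g := by
  intro h'
  exact h.z1 (by simpa using h'.symm)
theorem Z2.ncm (h : Z2 z) {a b : G} (hn : ¬ Commute a b) : a * b = z * (b * a) :=
  (h.com a b).resolve_left hn
theorem Z2.nq (h : Z2 z) {a : G} : ¬ a * a = z ↔ a * a = 1 := by
  constructor
  · exact fun h' => (h.sqs a).resolve_right h'
  · intro h1 h2; exact h.z1 (h2.symm.trans h1)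

theorem Z2.cm_mul (h : Z2 z) (a b c : G) :
    Commute (a * b) c ↔ (Commute a c ↔ Commute b c) := by
  have key : ∀ a b : G, (Commute a b ↔ a * b = b * a) ∧ (¬ Commute a b → a * b = z * (b * a)) :=
    fun a b => ⟨Iff.rfl, h.ncm⟩
  by_cases h1 : Commute a c <;> by_cases h2 : Commute b c <;> simp only [h1, h2, iff_true,
    iff_false, iff_self, not_true]
  · exact h1.mul_left h2
  · intro h3
    have h4 := h.ncm h2
    have h5 : a * b * c = z * (c * (a * b)) := by
      rw [mul_assoc, h4, h.m, ← mul_assoc a c b, h1.eq, mul_assoc]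
    rw [h3.eq] at h5
    exact h.ne _ h5
  · intro h3
    have h4 := h.ncm h1
    have h5 : a * b * c = z * (c * (a * b)) := by
      rw [mul_assoc, h2.eq, ← mul_assoc, h4]; simp only [mul_assoc]
    rw [h3.eq] at h5
    exact h.ne _ h5
  · have h4 := h.ncm h1
    have h5 := h.ncm h2
    change a * b * c = c * (a * b)
    rw [mul_assoc, h5, h.m, ← mul_assoc a c b, h4]
    simp only [mul_assoc, h.e]

theorem Z2.nn (h : Z2 z) {a b c : G} (h1 : ¬ Commute a c) (h2 : ¬ Commute b c) :
    Commute (a * b) c := by rw [h.cm_mul]; simp [h1, h2]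
theorem Z2.pn (h : Z2 z) {a b c : G} (h1 : Commute a c) (h2 : ¬ Commute b c) :
    ¬ Commute (a * b) c := by rw [h.cm_mul]; simp [h1, h2]
theorem Z2.np (h : Z2 z) {a b c : G} (h1 : ¬ Commute a c) (h2 : Commute b c) :
    ¬ Commute (a * b) c := by rw [h.cm_mul]; simp [h1, h2]

theorem Z2.cm_mul' (h : Z2 z) (a b c : G) :
    Commute c (a * b) ↔ (Commute c a ↔ Commute c b) := by
  rw [Commute.symm_iff, h.cm_mul, Commute.symm_iff, Commute.symm_iff (a := b)]

theorem Z2.q_mul (h : Z2 z) (a b : G) :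
    (a * b) * (a * b) = z ↔ ¬ (Commute a b ↔ (a * a = z ↔ b * b = z)) := by
  have h0 : (1 : G) ≠ z := h.z1.symm
  have e1 : Commute a b → (a * b) * (a * b) = (a * a) * (b * b) := fun h1 => by
    rw [mul_assoc, ← mul_assoc b a b, ← h1.eq]; simp only [mul_assoc]
  have e2 : ¬ Commute a b → (a * b) * (a * b) = z * ((a * a) * (b * b)) := fun h1 => by
    rw [mul_assoc, ← mul_assoc b a b, h.ncm (fun h2 => h1 h2.symm)]
    simp only [mul_assoc, h.m]
  have h3 := h.zz
  by_cases h1 : Commute a b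
  · rw [e1 h1]
    rcases h.sqs a with ha | ha <;> rcases h.sqs b with hb | hb <;> simp [ha, hb, h1, h0, h3]
  · rw [e2 h1]
    rcases h.sqs a with ha | ha <;> rcases h.sqs b with hb | hb <;> simp [ha, hb, h1, h0, h3]

theorem Z2.cz (h : Z2 z) (g : G) : Commute z g := h.zc g
theorem Z2.q_z (h : Z2 z) (g : G) : (z * g) * (z * g) = g * g := by
  rw [mul_assoc, h.m, h.e]

theorem a1 [Finite G] (h : Z2 z) (hF : Filled G) (r : G) (hr : ∀ g, Commute r g) : r * r = 1 := by
  by_contra hn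
  have hrz : r * r = z := (h.sqs r).resolve_left hn
  refine not_filled_of (S := {z}) ?_ (g := r) ?_ ?_ hF
  · rw [pf_iff]
    rintro a rfl b rfl
    rw [h.zz]
    exact fun h' => h.z1 h'.symm
  · rintro rfl; simp at hn
  · intro T hT hST
    have hz : z ∈ T := hST rfl
    have hpf := pf_iff.1 hT
    refine ⟨fun hrT => hpf r hrT r hrT (hrz ▸ hz), fun a ha b hb hab => ?_⟩
    have ha1 : a * a = 1 := h.nq.1 fun h' => hpf a ha a ha (h' ▸ hz)
    have hb1 : ¬ b * b = z := fun h' => hpf b hb b hb (h' ▸ hz)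
    have : b = a * r := by rw [← hab, ← mul_assoc, ha1, one_mul]
    rw [this, h.q_mul] at hb1
    have h2 : ¬ a * a = z := h.nq.2 ha1
    have h3 : Commute a r := (hr a).symm
    tauto

set_option maxHeartbeats 1000000 in
theorem a2 [Finite G] (h : Z2 z) (hF : Filled G) {I J : G} (hI : I * I = z) (hJ : J * J = z)
    (hIJ : ¬ Commute I J) :
    ∃ x, Commute x I ∧ Commute x J ∧ x * x = z ∧
      ∀ y, Commute y I → Commute y J → y * y = z → Commute x y := by
  by_contra hcon
  push Not at hcon
  obtain ⟨n, ⟨e⟩⟩ := Finite.exists_equiv_fin G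
  let R : Set G := {f | Commute f I ∧ Commute f J ∧ f * f = z ∧ e f < e (z * f)}
  have hR : ∀ f ∈ R, z * f ∉ R := by
    intro f hf hf'
    have h1 := hf.2.2.2
    have h2 := hf'.2.2.2
    rw [h.e] at h2
    exact lt_asymm h1 h2
  have hR' : ∀ f, Commute f I → Commute f J → f * f = z → f ∈ R ∨ z * f ∈ R := by
    intro f h1 h2 h3
    rcases lt_trichotomy (e f) (e (z * f)) with h4 | h4 | h4
    · exact Or.inl ⟨h1, h2, h3, h4⟩
    · exact absurd (e.injective h4) (h.ne f)
    · refine Or.inr ⟨(h.cz I).mul_left h1, (h.cz J).mul_left h2, by rw [h.q_z]; exact h3, ?_⟩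
      rwa [h.e]
  have hJI : ¬ Commute J I := fun h' => hIJ h'.symm
  have hII := Commute.refl I
  have hJJ := Commute.refl J
  have hzI := h.cz I
  have hzJ := h.cz J
  let S : Set G := {z} ∪ (fun f => f * I) '' R ∪ (fun f => f * J) '' R
  have hS : ∀ s, s ∈ S ↔ s = z ∨ (∃ f ∈ R, s = f * I) ∨ (∃ f ∈ R, s = f * J) := by
    intro s
    simp only [S, Set.mem_union, Set.mem_singleton_iff, Set.mem_image, eq_comm, or_assoc]
  -- commutation pattern of elements of `S`
  have pI : ∀ f ∈ R, Commute (f * I) I ∧ ¬ Commute (f * I) J := by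
    intro f hf
    have h1 := hf.1
    have h2 := hf.2.1
    exact ⟨h1.mul_left hII, h.pn h2 hIJ⟩
  have pJ : ∀ f ∈ R, ¬ Commute (f * J) I ∧ Commute (f * J) J := by
    intro f hf
    have h1 := hf.1
    have h2 := hf.2.1
    exact ⟨h.pn h1 hJI, h2.mul_left hJJ⟩
  have sI : ∀ s ∈ S, Commute s I → Commute s J → s = z := by
    intro s hs h1 h2
    rcases (hS s).1 hs with h3 | ⟨f, hf, rfl⟩ | ⟨f, hf, rfl⟩
    · exact h3
    · exact absurd h2 (pI f hf).2
    · exact absurd h1 (pJ f hf).1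
  have sI' : ∀ s ∈ S, Commute s I → ¬ Commute s J → ∃ f ∈ R, s = f * I := by
    intro s hs h1 h2
    rcases (hS s).1 hs with rfl | ⟨f, hf, rfl⟩ | ⟨f, hf, rfl⟩
    · exact absurd hzJ h2
    · exact ⟨f, hf, rfl⟩
    · exact absurd h1 (pJ f hf).1
  have sJ' : ∀ s ∈ S, ¬ Commute s I → Commute s J → ∃ f ∈ R, s = f * J := by
    intro s hs h1 h2
    rcases (hS s).1 hs with rfl | ⟨f, hf, rfl⟩ | ⟨f, hf, rfl⟩
    · exact absurd hzI h1
    · exact absurd h2 (pI f hf).2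
    · exact ⟨f, hf, rfl⟩
  have sK : ∀ s ∈ S, Commute s I ∨ Commute s J := by
    intro s hs
    rcases (hS s).1 hs with rfl | ⟨f, hf, rfl⟩ | ⟨f, hf, rfl⟩
    · exact Or.inl hzI
    · exact Or.inl (pI f hf).1
    · exact Or.inr (pJ f hf).2
  have qI : ∀ f ∈ R, (f * I) * (f * I) = 1 := by
    intro f hf
    rw [← h.nq, h.q_mul]
    have h1 := hf.1
    have h3 := hf.2.2.1
    simp [h1, h3, hI, hJ]
  have qJ : ∀ f ∈ R, (f * J) * (f * J) = 1 := by
    intro f hf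
    rw [← h.nq, h.q_mul]
    have h1 := hf.2.1
    have h3 := hf.2.2.1
    simp [h1, h3, hI, hJ]
  have zI : ∀ f ∈ R, z * (f * I) ∉ S := by
    intro f hf hz
    obtain ⟨f', hf', h'⟩ := sI' _ hz (hzI.mul_left (pI f hf).1)
      (h.pn hzJ (pI f hf).2)
    rw [← mul_assoc] at h'
    have := mul_right_cancel h'
    exact hR f hf (this ▸ hf')
  have zJ : ∀ f ∈ R, z * (f * J) ∉ S := by
    intro f hf hz
    obtain ⟨f', hf', h'⟩ := sJ' _ hz (h.pn hzI (pJ f hf).1)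
      (hzJ.mul_left (pJ f hf).2)
    rw [← mul_assoc] at h'
    have := mul_right_cancel h'
    exact hR f hf (this ▸ hf')
  have hPF : ProductFree S := by
    rw [pf_iff]
    intro a ha b hb hab
    rcases (hS a).1 ha with rfl | ⟨f, hf, rfl⟩ | ⟨f, hf, rfl⟩ <;>
    rcases (hS b).1 hb with rfl | ⟨f', hf', rfl⟩ | ⟨f', hf', rfl⟩
    · rw [h.zz] at hab
      exact h.z1 (sI 1 hab (Commute.one_left _) (Commute.one_left _)).symm
    · exact zI f' hf' hab
    · exact zJ f' hf' hab
    · rw [← h.zc] at hab; exact zI f hf hab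
    · have h1 := pI f hf
      have h2 := pI f' hf'
      have := sI _ hab (h1.1.mul_left h2.1) (h.nn h1.2 h2.2)
      have h3 : f * I = z * (f' * I) := by
        rw [← this, mul_assoc, qI f' hf', mul_one]
      exact zI f' hf' (h3 ▸ ha)
    · have h1 := pI f hf
      have h2 := pJ f' hf'
      exact (sK _ hab).elim (h.pn h1.1 h2.1) (h.np h1.2 h2.2)
    · rw [← h.zc] at hab; exact zJ f hf hab
    · have h1 := pJ f hf
      have h2 := pI f' hf'
      exact (sK _ hab).elim (h.np h1.1 h2.1) (h.pn h1.2 h2.2)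
    · have h1 := pJ f hf
      have h2 := pJ f' hf'
      have := sI _ hab (h.nn h1.1 h2.1) (h1.2.mul_left h2.2)
      have h3 : f * J = z * (f' * J) := by
        rw [← this, mul_assoc, qJ f' hf', mul_one]
      exact zJ f' hf' (h3 ▸ ha)
  have hzS : z ∈ S := (hS z).2 (Or.inl rfl)
  refine not_filled_of hPF (g := J) ?_ ?_ hF
  · rintro rfl; exact hIJ (Commute.one_right _)
  intro T hT hST
  have hz : z ∈ T := hST hzS
  have hpf := pf_iff.1 hT
  -- no `f K` lies in `T`
  have noK : ∀ f, Commute f I → Commute f J → f * f = z → f * (I * J) ∉ T := by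
    intro f h1 h2 h3 hfT
    obtain ⟨y, hy1, hy2, hy3, hy4⟩ := hcon f h1 h2 h3
    have hfy := h.ncm hy4
    have hyf : y * f = z * (f * y) := by rw [hfy, h.e]
    let y' := z * (y * f)
    have hyy' : y * y' = f := by
      change y * (z * (y * f)) = f
      rw [h.m, ← mul_assoc y y f, hy3, h.e]
    have hy'y : y' * y = z * f := by
      change z * (y * f) * y = z * f
      rw [mul_assoc, mul_assoc, hfy, h.m, ← mul_assoc y y f, hy3, h.e]
    have c1 : Commute y' I := hzI.mul_left (hy1.mul_left h1)
    have c2 : Commute y' J := hzJ.mul_left (hy2.mul_left h2)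
    have q' : y' * y' = z := by
      change z * (y * f) * (z * (y * f)) = z
      rw [h.q_z, h.q_mul]
      have : ¬ Commute y f := fun h' => hy4 h'.symm
      tauto
    have prod : ∀ a b, Commute b I → a * I * (b * J) = a * b * (I * J) := by
      intro a b hb
      rw [mul_assoc, ← mul_assoc I b J, ← hb.eq]; simp only [mul_assoc]
    have two : ∀ a ∈ R, ∀ b ∈ R, a * b ≠ f := by
      intro a ha b hb hab
      have := hpf (a * I) (hST ((hS _).2 (Or.inr (Or.inl ⟨a, ha, rfl⟩)))) (b * J)
        (hST ((hS _).2 (Or.inr (Or.inr ⟨b, hb, rfl⟩))))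
      rw [prod a b hb.1, hab] at this
      exact this hfT
    rcases hR' y hy1 hy2 hy3 with a | a <;> rcases hR' y' c1 c2 q' with b | b
    · exact two _ a _ b hyy'
    · exact two _ b _ a (by rw [mul_assoc, hy'y, h.e])
    · exact two _ b _ a (by rw [h.m, hy'y, h.e])
    · exact two _ a _ b (by rw [mul_assoc, h.m, h.e, hyy'])
  refine ⟨fun hJT => hpf J hJT J hJT (hJ ▸ hz), fun s hs t ht hst => ?_⟩
  have hs1 : s * s = 1 := h.nq.1 fun h' => hpf s hs s hs (h' ▸ hz)
  have ht1 : t * t = 1 := h.nq.1 fun h' => hpf t ht t ht (h' ▸ hz)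
  have htt : t = s * J := by rw [← hst, ← mul_assoc, hs1, one_mul]
  have hsJ : ¬ Commute s J := by
    have h1 := h.nq.2 ht1
    rw [htt, h.q_mul] at h1
    have h2 := h.nq.2 hs1
    tauto
  have hsq := h.nq.2 hs1
  by_cases hsI : Commute s I
  · -- `t = s J = (s I⁻¹) K`
    refine noK (z * (s * I)) ?_ ?_ ?_ ?_
    · exact hzI.mul_left (hsI.mul_left hII)
    · exact hzJ.mul_left (h.nn hsJ hIJ)
    · rw [h.q_z, h.q_mul]; simp [hsI, hsq, hI]
    · have : z * (s * I) * (I * J) = t := by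
        rw [htt, mul_assoc, mul_assoc, ← mul_assoc I I J, hI, h.m, h.e]
      rwa [this]
  · have hKK : (I * J) * (I * J) = z := by rw [h.q_mul]; simp [hIJ, hI, hJ]
    refine noK (z * (s * (I * J))) ?_ ?_ ?_ ?_
    · exact hzI.mul_left (h.nn hsI (h.pn hII hJI))
    · exact hzJ.mul_left (h.nn hsJ (h.np hIJ hJJ))
    · rw [h.q_z, h.q_mul, h.cm_mul']; simp [hsI, hsJ, hsq, hKK]
    · have : z * (s * (I * J)) * (I * J) = s := by
        rw [mul_assoc, mul_assoc, hKK, ← h.zc, h.e]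
      rwa [this]

end caseA
end FG

namespace FG

section caseA
variable {G : Type*} [Group G] {z : G}

theorem phi_commute {N : Type} {ν : N → G} {x : ℕ → G} {g : G} (hν : ∀ n, Commute (ν n) g) :
    ∀ (l : ℕ), (∀ i < l, Commute (x i) g) → ∀ p, Commute (phi ν x l p) g
  | 0, _, p => hν p
  | l + 1, h, (p, false) => phi_commute hν l (fun i hi => h i (by omega)) p
  | l + 1, h, (p, true) =>
    (phi_commute hν l (fun i hi => h i (by omega)) p).mul_left (h l (by omega))

theorem phi_gen {N : Type} [XN N] {ν : N → G} {x : ℕ → G} (h0 : ν XN.z = 1) :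
    ∀ (k i : ℕ), i < k → ∃ p, phi ν x k p = x i
  | k + 1, i, hi => by
    rcases Nat.lt_succ_iff_lt_or_eq.1 hi with h | rfl
    · obtain ⟨p, hp⟩ := phi_gen h0 k i h
      exact ⟨(p, false), hp⟩
    · refine ⟨topE i XN.z, ?_⟩
      change phi ν x i (inN i XN.z) * x i = x i
      rw [phi_inN, h0, one_mul]

theorem Z2.span (h : Z2 z) {a b : G} (hab : ¬ Commute a b) (g : G) :
    ∃ w, (w = 1 ∨ w = a ∨ w = b ∨ w = a * b) ∧ Commute (g * w) a ∧ Commute (g * w) b := by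
  have hba : ¬ Commute b a := fun h' => hab h'.symm
  have haa := Commute.refl a
  have hbb := Commute.refl b
  by_cases h1 : Commute g a <;> by_cases h2 : Commute g b
  · exact ⟨1, Or.inl rfl, by simpa using h1, by simpa using h2⟩
  · exact ⟨a, Or.inr (Or.inl rfl), h1.mul_left haa, h.nn h2 hab⟩
  · exact ⟨b, Or.inr (Or.inr (Or.inl rfl)), h.nn h1 hba, h2.mul_left hbb⟩
  · exact ⟨a * b, Or.inr (Or.inr (Or.inr rfl)), h.nn h1 (h.pn haa hba), h.nn h2 (h.np hab hbb)⟩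

theorem Z2.cancel (h : Z2 z) {f g w : G} (h1 : Commute f (g * w)) (h2 : Commute f w) :
    Commute f g := by
  rw [h.cm_mul'] at h1
  exact h1.2 h2

theorem a3 (h : Z2 z) (F : Set G) (hFm : ∀ a ∈ F, ∀ b ∈ F, a * b ∈ F) {x : G} (hxF : x ∈ F)
    (hx : ∀ y ∈ F, y * y = z → Commute x y) (hxn : ∃ y ∈ F, ¬ Commute x y) :
    ∃ y ∈ F, ¬ Commute x y ∧ y * y = 1 ∧
      ∀ f ∈ F, Commute f x → Commute f y → ∀ g ∈ F, Commute f g := by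
  obtain ⟨y, hyF, hxy⟩ := hxn
  have hyx : ¬ Commute y x := fun h' => hxy h'.symm
  have hy : ¬ y * y = z := fun h' => hxy (hx y hyF h')
  have hC : ∀ f ∈ F, Commute f x → Commute f y → ¬ f * f = z := by
    intro f hf h1 h2 h3
    have h4 : (f * y) * (f * y) = z := by rw [h.q_mul]; simp [h2, h3, hy]
    exact (h.pn h1 hyx) (hx _ (hFm _ hf _ hyF) h4).symm
  refine ⟨y, hyF, hxy, h.nq.1 hy, fun f hf h1 h2 g hg => ?_⟩
  obtain ⟨w, hw, h3, h4⟩ := h.span hxy g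
  have hgw : g * w ∈ F ∧ Commute f w := by
    rcases hw with rfl | rfl | rfl | rfl
    · exact ⟨by simpa using hg, Commute.one_right _⟩
    · exact ⟨hFm _ hg _ hxF, h1⟩
    · exact ⟨hFm _ hg _ hyF, h2⟩
    · exact ⟨hFm _ hg _ (hFm _ hxF _ hyF), h1.mul_right h2⟩
  have q1 := hC f hf h1 h2
  have q2 := hC _ hgw.1 h3 h4
  have q3 := hC _ (hFm _ hf _ hgw.1) (h1.mul_left h3) (h2.mul_left h4)
  rw [h.q_mul] at q3
  simp only [q1, q2, iff_true, not_not, iff_self] at q3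
  exact h.cancel q3 hgw.2

/-- The part of the group outside of the centre is standard. -/
structure Base (k : ℕ) (z : G) (X : ℕ → G) (u u' : G) : Prop where
  rels : Rels (sqS k) (comS k) k (nu z) X
  inj : Function.Injective (phi (nu z) X k)
  span : ∀ g, ∃ p, ∀ h, Commute (g * phi (nu z) X k p) h
  ncm : ¬ Commute u u'
  su : u * u = 1
  su' : u' * u' = 1
  invs : ∀ a, a * a = 1 → ¬ Commute a (u * u') → ∃ h, (∀ g, Commute h g) ∧ (a = h * u ∨ a = h * u')

theorem nu_inj (h : z ≠ 1) : Function.Injective (nu z) := by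
  intro a b
  cases a <;> cases b <;> simp [nu, h, h.symm]

theorem Z2.nuc (h : Z2 z) (n : Bool) (g : G) : Commute (nu z n) g := by
  cases n
  · exact Commute.one_left _
  · exact h.cz g

theorem Z2.xy (h : Z2 z) {x y : G} (hx : x * x = z) (hxy : ¬ Commute x y) (hy : y * y = 1) :
    ¬ Commute y (x * y) ∧ (x * y) * (x * y) = 1 ∧ (∀ a, Commute a (y * (x * y)) ↔ Commute a x) := by
  have hyx : ¬ Commute y x := fun h' => hxy h'.symm
  refine ⟨?_, ?_, ?_⟩
  · rw [h.cm_mul']; simp [hyx]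
  · rw [← h.nq, h.q_mul]; simp [hx, hxy, h.nq.2 hy]
  · intro a; rw [h.cm_mul', h.cm_mul']; tauto

theorem base2 [Finite G] (h : Z2 z) (hF : Filled G) {x : G} (hxq : x * x = z)
    (hx : ∀ y, y * y = z → Commute x y) : ∃ X u u', Base 2 z X u u' := by
  have hxn : ∃ y, ¬ Commute x y := by
    by_contra hcon
    push Not at hcon
    exact h.z1 (hxq.symm.trans (a1 h hF x hcon))
  obtain ⟨y, -, hxy, hy, hC⟩ := a3 h Set.univ (by simp) (Set.mem_univ x) (by simpa using hx)
    (by simpa using hxn)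
  obtain ⟨p1, p2, p3⟩ := h.xy hxq hxy hy
  have hyx : ¬ Commute y x := fun h' => hxy h'.symm
  have hR : Rels (sqS 2) (comS 2) 2 (nu z) (fun i => if i = 0 then x else y) := by
    refine rels_nu h.zz h.zc ?_ ?_
    · intro i hi
      interval_cases i
      · exact hxq
      · exact hy
    · intro i hi j hj
      interval_cases i
      · omega
      · interval_cases j
        change y * x = x * y * z
        rw [h.ncm hyx, h.zc]
  have hspan : ∀ g, ∃ w, (w = 1 ∨ w = x ∨ w = y ∨ w = x * y) ∧ ∀ h, Commute (g * w) h := by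
    intro g
    obtain ⟨w, hw, h1, h2⟩ := h.span hxy g
    exact ⟨w, hw, fun g' => hC _ (Set.mem_univ _) h1 h2 g' (Set.mem_univ _)⟩
  refine ⟨fun i => if i = 0 then x else y, y, x * y, hR, ?_, ?_, p1, hy, p2, ?_⟩
  · refine phi_succ_inj hR (phi_succ_inj (hR.mono (by omega)) (nu_inj h.z1) ?_) ?_
    · intro p hp
      have hp : nu z p = x := hp
      exact hxy (hp ▸ h.nuc p y)
    · intro p hp
      have hp : phi (nu z) (fun i => if i = 0 then x else y) 1 p = y := hp
      refine hyx (hp ▸ phi_commute (fun n => h.nuc n x) 1 ?_ p)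
      intro i hi
      simp [show i = 0 by omega]
  · intro g
    obtain ⟨w, hw, h1⟩ := hspan g
    have : ∃ p, phi (nu z) (fun i => if i = 0 then x else y) 2 p = w := by
      rcases hw with rfl | rfl | rfl | rfl
      · exact ⟨inN 2 false, phi_inN 2 false⟩
      · exact phi_gen rfl 2 0 (by omega)
      · exact phi_gen rfl 2 1 (by omega)
      · obtain ⟨p, hp⟩ := phi_gen (ν := nu z) (x := fun i => if i = 0 then x else y) rfl 2 0 (by omega)
        obtain ⟨q, hq⟩ := phi_gen (ν := nu z) (x := fun i => if i = 0 then x else y) rfl 2 1 (by omega)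
        exact ⟨mul _ _ 2 p q, by rw [phi_mul hR, hp, hq]; rfl⟩
    obtain ⟨p, hp⟩ := this
    exact ⟨p, by rw [hp]; exact h1⟩
  · intro a ha hax
    rw [p3] at hax
    obtain ⟨w, hw, h1⟩ := hspan a
    refine ⟨a * w, h1, ?_⟩
    rcases hw with rfl | rfl | rfl | rfl
    · exact absurd (by simpa using h1 x) hax
    · exact absurd (h.np hax (Commute.refl w)) (by simpa using h1 w)
    · left; rw [mul_assoc, hy, mul_one]
    · right; rw [mul_assoc a, p2, mul_one]

theorem base4 [Finite G] (h : Z2 z) (hF : Filled G) {I J : G} (hI : I * I = z) (hJ : J * J = z)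
    (hIJ : ¬ Commute I J) : ∃ X u u', Base 4 z X u u' := by
  obtain ⟨x, hxI, hxJ, hxq, hx⟩ := a2 h hF hI hJ hIJ
  have hJI : ¬ Commute J I := fun h' => hIJ h'.symm
  let F : Set G := {f | Commute f I ∧ Commute f J}
  have hFm : ∀ a ∈ F, ∀ b ∈ F, a * b ∈ F := fun a ha b hb =>
    ⟨ha.1.mul_left hb.1, ha.2.mul_left hb.2⟩
  have hKK : (I * J) * (I * J) = z := by rw [h.q_mul]; simp [hIJ, hI, hJ]
  -- an element of `F` commuting with `F` is central
  have hcen : ∀ f ∈ F, (∀ g ∈ F, Commute f g) → ∀ g, Commute f g := by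
    intro f hf h1 g
    obtain ⟨w, hw, h2, h3⟩ := h.span hIJ g
    refine h.cancel (h1 _ ⟨h2, h3⟩) ?_
    rcases hw with rfl | rfl | rfl | rfl
    · exact Commute.one_right _
    · exact hf.1
    · exact hf.2
    · exact hf.1.mul_right hf.2
  have hxn : ∃ y ∈ F, ¬ Commute x y := by
    by_contra hcon
    push Not at hcon
    exact h.z1 (hxq.symm.trans (a1 h hF x (hcen x ⟨hxI, hxJ⟩ hcon)))
  obtain ⟨y, hyF, hxy, hy, hC⟩ := a3 h F hFm (x := x) ⟨hxI, hxJ⟩ (fun y hy => hx y hy.1 hy.2) hxn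
  obtain ⟨hyI, hyJ⟩ := hyF
  obtain ⟨p1, p2, p3⟩ := h.xy hxq hxy hy
  have hyx : ¬ Commute y x := fun h' => hxy h'.symm
  let X : ℕ → G := fun i => match i with
    | 0 => x
    | 1 => y
    | 2 => I
    | _ => J
  have hR : Rels (sqS 4) (comS 4) 4 (nu z) X := by
    refine rels_nu h.zz h.zc ?_ ?_
    · intro i hi
      interval_cases i
      · exact hxq
      · exact hy
      · exact hI
      · exact hJ
    · have e1 : ∀ {a b : G}, Commute b a → a * b = b * a * nu z false := fun h' => by
        rw [nu, mul_one]; exact h'.eq.symm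
      intro i hi j hj
      interval_cases i <;> interval_cases j
      · change y * x = x * y * z
        rw [h.ncm hyx, h.zc]
      · exact e1 hxI
      · exact e1 hyI
      · exact e1 hxJ
      · exact e1 hyJ
      · change J * I = I * J * z
        rw [h.ncm hJI, h.zc]
  have hspan : ∀ g, ∃ v w, (v = 1 ∨ v = I ∨ v = J ∨ v = I * J) ∧
      (w = 1 ∨ w = x ∨ w = y ∨ w = x * y) ∧ ∀ h, Commute (g * v * w) h := by
    intro g
    obtain ⟨v, hv, h1, h2⟩ := h.span hIJ g
    obtain ⟨w, hw, h3, h4⟩ := h.span hxy (g * v)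
    refine ⟨v, w, hv, hw, ?_⟩
    have hwF : g * v * w ∈ F := by
      rcases hw with rfl | rfl | rfl | rfl
      · simpa using ⟨h1, h2⟩
      · exact hFm _ ⟨h1, h2⟩ _ ⟨hxI, hxJ⟩
      · exact hFm _ ⟨h1, h2⟩ _ ⟨hyI, hyJ⟩
      · exact hFm _ ⟨h1, h2⟩ _ ⟨hxI.mul_left hyI, hxJ.mul_left hyJ⟩
    exact hcen _ hwF (hC _ hwF h3 h4)
  refine ⟨X, y, x * y, hR, ?_, ?_, p1, hy, p2, ?_⟩
  · refine phi_succ_inj hR (phi_succ_inj (hR.mono (by omega)) (phi_succ_inj (hR.mono (by omega))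
      (phi_succ_inj (hR.mono (by omega)) (nu_inj h.z1) ?_) ?_) ?_) ?_
    · intro p hp
      have hp : nu z p = x := hp
      exact hxy (hp ▸ h.nuc p y)
    · intro p hp
      have hp : phi (nu z) X 1 p = y := hp
      refine hyx (hp ▸ phi_commute (fun n => h.nuc n x) 1 ?_ p)
      intro i hi
      interval_cases i
      exact Commute.refl x
    · intro p hp
      have hp : phi (nu z) X 2 p = I := hp
      refine hIJ (hp ▸ phi_commute (fun n => h.nuc n J) 2 ?_ p)
      intro i hi
      interval_cases i
      · exact hxJ
      · exact hyJ
    · intro p hp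
      have hp : phi (nu z) X 3 p = J := hp
      refine hJI (hp ▸ phi_commute (fun n => h.nuc n I) 3 ?_ p)
      intro i hi
      interval_cases i
      · exact hxI
      · exact hyI
      · exact Commute.refl I
  · intro g
    obtain ⟨v, w, hv, hw, h1⟩ := hspan g
    have g0 : ∃ p, phi (nu z) X 4 p = x := phi_gen rfl 4 0 (by omega)
    have g1 : ∃ p, phi (nu z) X 4 p = y := phi_gen rfl 4 1 (by omega)
    have g2 : ∃ p, phi (nu z) X 4 p = I := phi_gen rfl 4 2 (by omega)
    have g3 : ∃ p, phi (nu z) X 4 p = J := phi_gen rfl 4 3 (by omega)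
    have g4 : ∃ p, phi (nu z) X 4 p = 1 := ⟨inN 4 false, phi_inN 4 false⟩
    have gm : ∀ {a b}, (∃ p, phi (nu z) X 4 p = a) → (∃ p, phi (nu z) X 4 p = b) →
        ∃ p, phi (nu z) X 4 p = a * b := by
      rintro _ _ ⟨p, rfl⟩ ⟨q, rfl⟩
      exact ⟨_, phi_mul hR p q⟩
    have : ∃ p, phi (nu z) X 4 p = v * w := by
      apply gm
      · rcases hv with rfl | rfl | rfl | rfl
        exacts [g4, g2, g3, gm g2 g3]
      · rcases hw with rfl | rfl | rfl | rfl
        exacts [g4, g0, g1, gm g0 g1]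
    obtain ⟨p, hp⟩ := this
    exact ⟨p, by rw [hp, ← mul_assoc]; exact h1⟩
  · intro a ha hax
    rw [p3] at hax
    obtain ⟨v, w, hv, hw, h1⟩ := hspan a
    have hvx : Commute v x ∧ Commute v y := by
      rcases hv with rfl | rfl | rfl | rfl
      · exact ⟨Commute.one_left _, Commute.one_left _⟩
      · exact ⟨hxI.symm, hyI.symm⟩
      · exact ⟨hxJ.symm, hyJ.symm⟩
      · exact ⟨(hxI.mul_right hxJ).symm, (hyI.mul_right hyJ).symm⟩
    have havx : ¬ Commute (a * v) x := h.np hax hvx.1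
    have hw' : w = y ∨ w = x * y := by
      rcases hw with rfl | rfl | hw
      · exact absurd (by simpa using h1 x) havx
      · exact absurd (h1 _) (h.np havx (Commute.refl w))
      · exact hw
    have hvw : Commute v w ∧ w * w = 1 := by
      rcases hw' with rfl | rfl
      · exact ⟨hvx.2, hy⟩
      · exact ⟨hvx.1.mul_right hvx.2, p2⟩
    have hv1 : v = 1 := by
      by_contra hv1
      have hvq : v * v = z := by
        rcases hv with rfl | rfl | rfl | rfl
        · exact absurd rfl hv1
        exacts [hI, hJ, hKK]
      have q1 : (v * w) * (v * w) = z := by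
        rw [h.q_mul]; simp [hvw.1, hvq, h.nq.2 hvw.2]
      have hc : ∀ g, Commute (a * (v * w)) g := by rw [← mul_assoc]; exact h1
      have c1 : Commute a (v * w) := by
        have := hc (v * w)
        rw [h.cm_mul] at this
        exact this.2 (Commute.refl _)
      have q2 := h.nq.2 (a1 h hF _ hc)
      rw [h.q_mul] at q2
      simp [c1, q1, h.nq.2 ha] at q2
    subst hv1
    simp only [mul_one] at h1
    refine ⟨a * w, h1, ?_⟩
    rcases hw' with rfl | rfl
    · left; rw [mul_assoc, hy, mul_one]
    · right; rw [mul_assoc a, p2, mul_one]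

end caseA
end FG

namespace FG

section finA
variable {G : Type*} [Group G] {z : G}

theorem Base.central {k : ℕ} {X : ℕ → G} {u u' : G} (B : Base k z X u u') (hk : k = 2 ∨ k = 4)
    (p : El Bool k) (hp : ∀ g, Commute (phi (nu z) X k p) g) :
    phi (nu z) X k p = 1 ∨ phi (nu z) X k p = z := by
  have key : ∀ q, mulS k p q = mulS k q p := fun q => B.inj (by
    rw [mulS, phi_mul B.rels, phi_mul B.rels]; exact hp _)
  have : p = inN k false ∨ p = inN k true := by
    have aux : ∀ {k} {p : El Bool k} , MF k (inN k true) (inN k true) → 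
        mulS k (inN k true) (inN k true) = inN k false → (∀ q, mulS k p q = mulS k q p) →
        p = inN k false ∨ p = inN k true := by
      intro k p h h' hp
      rcases h.2.2.2 p hp with h | h | h | h
      · exact Or.inl h
      · exact Or.inr h
      · exact Or.inr h
      · exact Or.inl (h.trans h')
    rcases hk with rfl | rfl
    · exact aux mf2 (by decide) key
    · exact aux mf4 (by decide) key
  rcases this with rfl | rfl
  · exact Or.inl (phi_inN k false)
  · exact Or.inr (phi_inN k true)

theorem Base.span' {k : ℕ} {X : ℕ → G} {u u' : G} (h : Z2 z) (B : Base k z X u u') (g : G) :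
    ∃ c p, (∀ g, Commute c g) ∧ g = c * phi (nu z) X k p := by
  obtain ⟨p, hp⟩ := B.span g
  rcases h.sqs (phi (nu z) X k p) with e | e
  · exact ⟨_, p, hp, by rw [mul_assoc, e, mul_one]⟩
  · refine ⟨_, addc k p true, hp, ?_⟩
    rw [phi_addc B.rels, ← mul_assoc, mul_assoc g, e]
    change g = g * z * z
    rw [mul_assoc, h.zz, mul_one]

theorem fin1 {k : ℕ} {X : ℕ → G} {u u' : G} (h : Z2 z) (B : Base k z X u u')
    (hc : ∀ c : G, (∀ g, Commute c g) → c = 1 ∨ c = z) : IsStd k G := by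
  refine ⟨z, X, h.z1, B.rels, B.inj, fun g => ?_⟩
  obtain ⟨c, p, h1, rfl⟩ := B.span' h g
  have : ∃ n, c = nu z n := by
    rcases hc c h1 with rfl | rfl
    exacts [⟨false, rfl⟩, ⟨true, rfl⟩]
  obtain ⟨n, rfl⟩ := this
  exact ⟨addc k p n, by rw [phi_addc B.rels, B.rels.cen]⟩

theorem phi_congr {N : Type} {ν : N → G} {x y : ℕ → G} : ∀ (l : ℕ), (∀ i < l, x i = y i) →
    ∀ p, phi ν x l p = phi ν y l p
  | 0, _, _ => rfl
  | l + 1, h, (p, false) => phi_congr l (fun i hi => h i (by omega)) p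
  | l + 1, h, (p, true) => by
    have := phi_congr (ν := ν) l (fun i hi => h i (by omega)) p
    simp only [phi]
    rw [this, h l (by omega)]

theorem fin2 {k : ℕ} (hk : k = 2 ∨ k = 4) {X : ℕ → G} {u u' : G} (h : Z2 z) (B : Base k z X u u')
    {c : G} (hcc : ∀ g, Commute c g) (hc2 : c * c = 1) (c1 : c ≠ 1) (cz : c ≠ z)
    (hc : ∀ h : G, (∀ g, Commute h g) → h = 1 ∨ h = z ∨ h = c ∨ h = z * c) : IsStd (k + 1) G := by
  let x' : ℕ → G := fun i => if i < k then X i else c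
  have hx : ∀ i < k, x' i = X i := fun i hi => by simp [x', hi]
  have hxk : x' k = c := by simp [x']
  have hsq : ∀ i < k, sqS (k + 1) i = sqS k i := by
    rcases hk with rfl | rfl
    · decide
    · decide
  have hcom : ∀ i < k, ∀ j < i, comS (k + 1) i j = comS k i j := by
    rcases hk with rfl | rfl
    · decide
    · decide
  have hsqk : sqS (k + 1) k = false := by rcases hk with rfl | rfl <;> decide
  have hcomk : ∀ j < k, comS (k + 1) k j = false := by rcases hk with rfl | rfl <;> decide
  have hR : Rels (sqS (k + 1)) (comS (k + 1)) (k + 1) (nu z) x' := by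
    refine rels_nu h.zz h.zc ?_ ?_
    · intro i hi
      rcases Nat.lt_succ_iff_lt_or_eq.1 hi with hi | rfl
      · rw [hsq i hi, hx i hi, ← B.rels.sq i hi]
      · rw [hsqk, hxk]; exact hc2
    · intro i hi j hj
      rcases Nat.lt_succ_iff_lt_or_eq.1 hi with hi | rfl
      · rw [hcom i hi j hj, hx i hi, hx j (by omega)]
        exact B.rels.com i hi j hj
      · rw [hcomk j hj, hxk, hx j hj]; simpa [nu] using (hcc _).eq
  have hφ : ∀ p, phi (nu z) x' k p = phi (nu z) X k p := phi_congr k hx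
  refine ⟨z, x', h.z1, hR, phi_succ_inj hR ?_ ?_, ?_⟩
  · intro p q hpq
    rw [hφ, hφ] at hpq
    exact B.inj hpq
  · intro p hp
    rw [hφ, hxk] at hp
    rcases B.central hk p (hp ▸ hcc) with e | e
    · exact c1 (hp ▸ e)
    · exact cz (hp ▸ e)
  · intro g
    obtain ⟨e, p, h1, rfl⟩ := B.span' h g
    have : ∃ n, e = nu z n ∨ e = nu z n * c := by
      rcases hc e h1 with rfl | rfl | rfl | rfl
      exacts [⟨false, Or.inl rfl⟩, ⟨true, Or.inl rfl⟩, ⟨false, Or.inr (one_mul _).symm⟩,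
        ⟨true, Or.inr rfl⟩]
    obtain ⟨n, rfl | rfl⟩ := this
    · refine ⟨(addc k p n, false), ?_⟩
      simp only [phi]
      rw [hφ, phi_addc B.rels, B.rels.cen]
    · refine ⟨(addc k p n, true), ?_⟩
      simp only [phi]
      rw [hφ, phi_addc B.rels, ← B.rels.cen, hxk, mul_assoc, mul_assoc, (hcc _).eq]

def sqD (_ : ℕ) : Bool := false
def comD (i j : ℕ) : Bool := decide (i = 3) && decide (j = 2)
abbrev mulD : El Bool 4 → El Bool 4 → El Bool 4 := mul sqD comD 4
def lD : List (El Bool 4) := [((((true, false), false), false), false),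
  ((((false, true), false), false), false), ((((false, false), true), false), false),
  ((((false, false), false), true), false), ((((true, true), true), true), false),
  ((((false, true), false), false), true), ((((true, false), true), false), true)]

theorem lD_pf : ∀ a ∈ lD, ∀ b ∈ lD, mulD a b ∉ lD := by decide +kernel
theorem lD_ex1 : ∀ p : El Bool 2, exB mulD lD ((p, true), false) = true ∨
    exB mulD lD ((p, false), true) = true := by decide +kernel
theorem lD_ex2 : ∀ p : El Bool 2, exB mulD lD ((p, false), true) = true ∨
    exB mulD lD ((addc 2 p true, true), false) = true := by decide +kernel

theorem fin3 [Finite G] {k : ℕ} {X : ℕ → G} {u u' : G} (h : Z2 z) (B : Base k z X u u')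
    (hsq : ∀ h : G, (∀ g, Commute h g) → h * h = 1)
    (hI : ∀ e : G, (∀ g, Commute e g) → e ≠ 1 → e ≠ z → ∃ c', ∀ h : G, (∀ g, Commute h g) →
      ∃ s, (s = 1 ∨ s = z ∨ s = c' ∨ s = z * c') ∧ (h = s ∨ h = s * e))
    {c d : G} (hc : ∀ g, Commute c g) (hd : ∀ g, Commute d g) (c1 : c ≠ 1) (cz : c ≠ z)
    (d1 : d ≠ 1) (dz : d ≠ z) (dc : d ≠ c) (dzc : d ≠ z * c) : ¬ Filled G := by
  have cc := hsq c hc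
  have dd := hsq d hd
  let Y : ℕ → G := fun i => match i with
    | 0 => c
    | 1 => d
    | 2 => u
    | _ => u'
  have hu'u : ¬ Commute u' u := fun h' => B.ncm h'.symm
  have e1 : ∀ {a b : G}, Commute b a → a * b = b * a * nu z false := fun h' => by
    rw [nu, mul_one]; exact h'.eq.symm
  have hR : Rels sqD comD 4 (nu z) Y := by
    refine rels_nu h.zz h.zc ?_ ?_
    · intro i hi
      interval_cases i
      exacts [cc, dd, B.su, B.su']
    · intro i hi j hj
      interval_cases i <;> interval_cases j
      · exact e1 (hc _)
      · exact e1 (hc _)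
      · exact e1 (hd _)
      · exact e1 (hc _)
      · exact e1 (hd _)
      · change u' * u = u * u' * z
        rw [h.ncm hu'u, h.zc]
  have hR2 : Rels sqD comD 2 (nu z) Y := hR.mono (by omega)
  have hcen : ∀ p g, Commute (phi (nu z) Y 2 p) g := fun p g =>
    phi_commute (fun n => h.nuc n g) 2 (fun i hi => by interval_cases i; exacts [hc g, hd g]) p
  -- the centre
  have gz : ∃ p, phi (nu z) Y 2 p = z := ⟨inN 2 true, phi_inN 2 true⟩
  have g1 : ∃ p, phi (nu z) Y 2 p = 1 := ⟨inN 2 false, phi_inN 2 false⟩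
  have gc : ∃ p, phi (nu z) Y 2 p = c := phi_gen rfl 2 0 (by omega)
  have gd : ∃ p, phi (nu z) Y 2 p = d := phi_gen rfl 2 1 (by omega)
  have gm : ∀ {a b}, (∃ p, phi (nu z) Y 2 p = a) → (∃ p, phi (nu z) Y 2 p = b) →
      ∃ p, phi (nu z) Y 2 p = a * b := by
    rintro _ _ ⟨p, rfl⟩ ⟨q, rfl⟩
    exact ⟨_, phi_mul hR2 p q⟩
  have hK : ∀ e : G, (∀ g, Commute e g) → ∃ p, phi (nu z) Y 2 p = e := by
    obtain ⟨c', hc'⟩ := hI c hc c1 cz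
    have gc' : ∃ p, phi (nu z) Y 2 p = c' := by
      obtain ⟨s, hs, hd'⟩ := hc' d hd
      have hs' : ∃ p, phi (nu z) Y 2 p = s := by
        rcases hd' with e | e
        · rw [← e]; exact gd
        · have : s = d * c := by rw [e, mul_assoc, cc, mul_one]
          rw [this]; exact gm gd gc
      rcases hs with rfl | rfl | rfl | rfl
      · rcases hd' with e | e
        · exact absurd e d1
        · exact absurd (by simpa using e) dc
      · rcases hd' with e | e
        · exact absurd e dz
        · exact absurd e dzc
      · exact hs'
      · have := gm gz hs'
        rwa [h.e] at this
    intro e he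
    obtain ⟨s, hs, he'⟩ := hc' e he
    have hs' : ∃ p, phi (nu z) Y 2 p = s := by
      rcases hs with rfl | rfl | rfl | rfl
      exacts [g1, gz, gc', gm gz gc']
    rcases he' with rfl | rfl
    · exact hs'
    · exact gm hs' gc
  have hinj : Function.Injective (phi (nu z) Y 4) := by
    refine phi_succ_inj hR (phi_succ_inj (hR.mono (by omega)) (phi_succ_inj (hR.mono (by omega))
      (phi_succ_inj (hR.mono (by omega)) (nu_inj h.z1) ?_) ?_) ?_) ?_
    · intro p hp
      have hp : nu z p = c := hp
      cases p
      · exact c1 hp.symm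
      · exact cz hp.symm
    · rintro ⟨n, b⟩ hp
      have hp : phi (nu z) Y 1 (n, b) = d := hp
      cases b
      · change nu z n = d at hp
        cases n
        · exact d1 hp.symm
        · exact dz hp.symm
      · change nu z n * c = d at hp
        cases n
        · exact dc (by rw [← hp]; simp [nu])
        · exact dzc hp.symm
    · intro p hp
      have hp : phi (nu z) Y 2 p = u := hp
      exact B.ncm (hp ▸ hcen p u')
    · intro p hp
      have hp : phi (nu z) Y 3 p = u' := hp
      refine hu'u (hp ▸ phi_commute (fun n => h.nuc n u) 3 ?_ p)
      intro i hi
      interval_cases i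
      exacts [hc u, hd u, Commute.refl u]
  have hm := phi_mul hR
  have hmem : ∀ p, phi (nu z) Y 4 p ∈ phi (nu z) Y 4 '' {p | p ∈ lD} ↔ p ∈ lD := fun p => by
    simp [hinj.eq_iff]
  have hzS : z ∈ phi (nu z) Y 4 '' {p | p ∈ lD} := ⟨inN 4 true, by decide, phi_inN 4 true⟩
  have hgg : (u * u') * (u * u') = z := by
    rw [h.q_mul]; simp [B.ncm, h.nq.2 B.su, h.nq.2 B.su']
  refine not_filled_of (S := phi (nu z) Y 4 '' {p | p ∈ lD}) ?_ (g := u * u') ?_ ?_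
  · rw [pf_iff]
    rintro _ ⟨a, ha, rfl⟩ _ ⟨b, hb, rfl⟩
    rw [← hm, hmem]
    exact lD_pf a ha b hb
  · intro h'
    rw [h', one_mul] at hgg
    exact h.z1 hgg.symm
  · intro T hT hST
    have hnz : ∀ a ∈ T, a * a ≠ z := fun a ha h' => pf_iff.1 hT a ha a ha (h' ▸ hST hzS)
    refine ⟨fun hg => hnz _ hg hgg, fun a ha b hb hab => ?_⟩
    have qa := h.nq.1 (hnz a ha)
    have qb := h.nq.1 (hnz b hb)
    have hnab : ¬ Commute a b := by
      intro h'
      rw [← hab, h'.symm.mul_mul_mul_comm, qa, qb, one_mul] at hgg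
      exact h.z1 hgg.symm
    have hb' : b = a * (u * u') := by rw [← hab, ← mul_assoc, qa, one_mul]
    have hE : ∀ p, exB mulD lD p = true → phi (nu z) Y 4 p ∉ T := fun p hp =>
      (ex_of_exB hm hp).not_mem hT hST
    obtain ⟨e, he, h'⟩ := B.invs a qa (by rw [← hab, h.cm_mul']; simp [hnab])
    obtain ⟨p, rfl⟩ := hK e he
    rcases h' with h' | h'
    · have hbe : b = phi (nu z) Y 2 p * u' := by
        rw [hb', h', mul_assoc, ← mul_assoc u u u', B.su, one_mul]
      rcases lD_ex1 p with h3 | h3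
      · exact hE _ h3 (by rw [h'] at ha; exact ha)
      · exact hE _ h3 (by rw [hbe] at hb; exact hb)
    · have hbe : b = phi (nu z) Y 2 (addc 2 p true) * u := by
        have : u' * (u * u') = z * u := by
          rw [← mul_assoc, h.ncm hu'u, mul_assoc, mul_assoc, B.su', mul_one]
        rw [hb', h', mul_assoc, this, phi_addc hR2, mul_assoc]; rfl
      rcases lD_ex2 p with h3 | h3
      · exact hE _ h3 (by rw [h'] at ha; exact ha)
      · exact hE _ h3 (by rw [hbe] at hb; exact hb)

theorem finishA [Finite G] (h : Z2 z) (hF : Filled G) (hx : ∃ x : G, x * x = z)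
    (hI : ∀ e : G, (∀ g, Commute e g) → e ≠ 1 → e ≠ z → ∃ c', ∀ h : G, (∀ g, Commute h g) →
      ∃ s, (s = 1 ∨ s = z ∨ s = c' ∨ s = z * c') ∧ (h = s ∨ h = s * e)) :
    ∃ k, (2 ≤ k ∧ k ≤ 5) ∧ IsStd k G := by
  have hB : ∃ k X u u', (k = 2 ∨ k = 4) ∧ Base k z X u u' := by
    by_cases hIJ : ∃ I J : G, I * I = z ∧ J * J = z ∧ ¬ Commute I J
    · obtain ⟨I, J, h1, h2, h3⟩ := hIJ
      obtain ⟨X, u, u', B⟩ := base4 h hF h1 h2 h3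
      exact ⟨4, X, u, u', Or.inr rfl, B⟩
    · push Not at hIJ
      obtain ⟨x, hx⟩ := hx
      obtain ⟨X, u, u', B⟩ := base2 h hF hx fun y hy => hIJ x y hx hy
      exact ⟨2, X, u, u', Or.inl rfl, B⟩
  obtain ⟨k, X, u, u', hk, B⟩ := hB
  have hsq : ∀ h : G, (∀ g, Commute h g) → h * h = 1 := a1 h hF
  by_cases h1 : ∀ c : G, (∀ g, Commute c g) → c = 1 ∨ c = z
  · exact ⟨k, by omega, fin1 h B h1⟩
  push Not at h1
  obtain ⟨c, hc, c1, cz⟩ := h1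
  by_cases h2 : ∀ h : G, (∀ g, Commute h g) → h = 1 ∨ h = z ∨ h = c ∨ h = z * c
  · exact ⟨k + 1, by omega, fin2 hk h B hc (hsq c hc) c1 cz h2⟩
  push Not at h2
  obtain ⟨d, hd, d1, dz, dc, dzc⟩ := h2
  exact absurd hF (fin3 h B hsq hI hc hd c1 cz d1 dz dc dzc)

end finA
end FG

namespace FG
universe v

/-- The quotient of `G` by the central involution `e` is on the list. -/
def QuoStd {G : Type v} [Group G] (e : G) (k : ℕ) : Prop :=
  ∃ (H : Type v) (_ : Group H) (π : G →* H), Function.Surjective π ∧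
    (∀ g, π g = 1 ↔ g = 1 ∨ g = e) ∧ IsStd k H

section lifts
variable {G : Type v} [Group G] {H : Type v} [Group H] {π : G →* H} {t : G}

theorem ker_eq (hker : ∀ g, π g = 1 ↔ g = 1 ∨ g = t) {a b : G}
    (h : π a = π b) : a = b ∨ a = b * t := by
  have : π (b⁻¹ * a) = 1 := by rw [map_mul, map_inv, h, inv_mul_cancel]
  rcases (hker _).1 this with h | h
  · left; exact (inv_mul_eq_one.1 h).symm
  · right; exact inv_mul_eq_iff_eq_mul.1 h

theorem map_phi (π : G →* H) {N : Type} {ν : N → G} {ν' : N → H} {x : ℕ → G} {x' : ℕ → H}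
    (hν : ∀ n, π (ν n) = ν' n) : ∀ (k : ℕ), (∀ i < k, π (x i) = x' i) → ∀ p,
    π (phi ν x k p) = phi ν' x' k p
  | 0, _, p => hν p
  | k + 1, h, (p, false) => map_phi π hν k (fun i hi => h i (by omega)) p
  | k + 1, h, (p, true) => by
    have := map_phi π hν k (fun i hi => h i (by omega)) p
    simp only [phi]
    rw [map_mul, this, h k (by omega)]

theorem phi_mem {N : Type} {ν : N → G} {x : ℕ → G} {S : Set G} (hS : ∀ a ∈ S, ∀ b ∈ S, a * b ∈ S)
    (hν : ∀ n, ν n ∈ S) : ∀ (k : ℕ), (∀ i < k, x i ∈ S) → ∀ p, phi ν x k p ∈ S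
  | 0, _, p => hν p
  | k + 1, h, (p, false) => phi_mem hS hν k (fun i hi => h i (by omega)) p
  | k + 1, h, (p, true) =>
    hS _ (phi_mem hS hν k (fun i hi => h i (by omega)) p) _ (h k (by omega))

/-- lifts of a standard generating system -/
structure Lift (t c : G) (k : ℕ) (X : ℕ → G) : Prop where
  tc : ∀ g, Commute t g
  t1 : t ≠ 1
  tt : t * t = 1
  c1 : c ≠ 1
  ct : c ≠ t
  card : Nat.card G = 2 ^ (k + 2)
  cc : c * c = 1 ∨ c * c = t
  com : ∀ g, c * g = g * c ∨ c * g = g * c * t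
  sqs : ∀ g : G, (g * g = 1 ∨ g * g = t) ∨ (g * g = c ∨ g * g = c * t)
  sq : ∀ i < k, X i * X i = nu c (sqS k i) ∨ X i * X i = nu c (sqS k i) * t
  xcom : ∀ i < k, ∀ j < i, X i * X j = X j * X i * nu c (comS k i j) ∨
    X i * X j = X j * X i * nu c (comS k i j) * t
  gen : ∀ S : Set G, (∀ a ∈ S, ∀ b ∈ S, a * b ∈ S) → 1 ∈ S → t ∈ S → c ∈ S → (∀ i < k, X i ∈ S) →
    ∀ g, g ∈ S

theorem exists_lift [Finite G] {k : ℕ} (hk : 2 ≤ k ∧ k ≤ 5) (tc : ∀ g, Commute t g) (t1 : t ≠ 1)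
    (tt : t * t = 1) (h : QuoStd t k) : ∃ c X, Lift t c k X := by
  obtain ⟨H, _, π, hπ, hker, hst⟩ := h
  have hcard := hst.card
  obtain ⟨z, x, hz⟩ := hst
  obtain ⟨c, rfl⟩ := hπ z
  choose X hX using fun i => hπ (x i)
  have K : ∀ {a b : G}, π a = π b → a = b ∨ a = b * t := ker_eq hker
  have hν : ∀ n, π (nu c n) = nu (π c) n := fun n => by cases n <;> simp [nu]
  obtain ⟨c', hFa⟩ := hz.facts hk
  refine ⟨c, X, tc, t1, tt, ?_, ?_, ?_, ?_, ?_, ?_, ?_, ?_, ?_⟩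
  · rintro rfl; exact hz.z1 (map_one π)
  · rintro rfl; exact hz.z1 ((hker _).2 (Or.inr rfl))
  · have h1 := Subgroup.card_eq_card_quotient_mul_card_subgroup π.ker
    have h2 : Nat.card (G ⧸ π.ker) = Nat.card H :=
      Nat.card_congr (QuotientGroup.quotientKerEquivOfSurjective π hπ).toEquiv
    have h3 : Nat.card π.ker = 2 := by
      have : (π.ker : Set G) = {1, t} := by
        ext g; simp [MonoidHom.mem_ker, hker]
      have h4 : Nat.card π.ker = Nat.card (π.ker : Set G) := rfl
      rw [h4, this, Nat.card_coe_set_eq, Set.ncard_pair t1.symm]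
    rw [h1, h2, h3, hcard, ← pow_succ]
  · have : π (c * c) = π 1 := by rw [map_mul, hz.zz, map_one]
    simpa using K this
  · intro g
    exact K (by rw [map_mul, map_mul, hz.zc])
  · intro g
    rcases hFa.sqs (π g) with h | h
    · left
      simpa using (K (a := g * g) (b := 1) (by rw [map_mul, h, map_one]))
    · right
      exact K (by rw [map_mul, h])
  · intro i hi
    exact K (by rw [map_mul, hν, hX, hz.rels.sq i hi])
  · intro i hi j hj
    exact K (by simp only [map_mul, hν, hX]; rw [hz.rels.com i hi j hj])
  · intro S hS h1 ht hc hx g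
    obtain ⟨p, hp⟩ := hz.bij.2 (π g)
    have hp' : π g = π (phi (nu c) X k p) := by
      rw [← hp]; exact (map_phi π hν k (fun i _ => hX i) p).symm
    have hm : phi (nu c) X k p ∈ S := phi_mem hS (fun n => by cases n; exacts [h1, hc]) k hx p
    rcases K hp' with e | e
    · rw [e]; exact hm
    · rw [e]; exact hS _ hm _ ht

variable {c : G} {k : ℕ} {X : ℕ → G}

theorem Lift.central (L : Lift t c k X) {a : G} (hc : Commute a c) (hx : ∀ i < k, Commute a (X i)) :
    ∀ g, Commute a g :=
  L.gen {g | Commute a g} (fun _ h1 _ h2 => Commute.mul_right h1 h2) (Commute.one_right a)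
    (L.tc a).symm hc hx

theorem Lift.tcm (L : Lift t c k X) (g : G) : t * g = g * t := L.tc g

/-- case B2 -/
theorem Lift.b2 (L : Lift t c k X) (hk : 2 ≤ k) (hc : ∀ g, Commute c g) : c * c = 1 := by
  refine L.cc.resolve_right fun hct => L.t1 ?_
  have hsq : ∀ g, Commute (X 0 * X 0) g := by
    have h0 := L.sq 0 (by omega)
    simp only [sqS, decide_true, Bool.true_or, nu] at h0
    rcases h0 with e | e <;> rw [e]
    · exact hc
    · exact fun g => (hc g).mul_left (L.tc g)
  obtain ⟨d, hd, hdd, h1⟩ : ∃ d, (∀ g, Commute d g) ∧ d * d = t ∧ X 1 * X 0 = X 0 * X 1 * d := by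
    rcases L.xcom 1 (by omega) 0 (by omega) with e | e
    · exact ⟨c, hc, hct, e⟩
    · refine ⟨c * t, fun g => (hc g).mul_left (L.tc g), ?_, by rw [e, mul_assoc]; rfl⟩
      rw [(hc t).symm.mul_mul_mul_comm, hct, L.tt, mul_one]
  have h2 := hsq (X 1)
  have h3 : X 1 * (X 0 * X 0) = X 0 * X 0 * X 1 * t := by
    rw [← mul_assoc, h1, mul_assoc _ d, (hd (X 0)).eq, ← mul_assoc, mul_assoc (X 0), h1, ← hdd]
    simp only [mul_assoc]
  have h4 : X 0 * X 0 * X 1 * t = X 0 * X 0 * X 1 := h3.symm.trans h2.eq.symm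
  simpa using h4

end lifts
end FG

namespace FG
universe v

def extM {M : Type} (m : M → M → M) (σ : M → M) (s : M) : M × Bool → M × Bool → M × Bool
  | (p, false), (q, b) => (m p q, b)
  | (p, true), (q, false) => (m p (σ q), true)
  | (p, true), (q, true) => (m (m p (σ q)) s, false)

def extF {M : Type} {G : Type v} [Group G] (φ : M → G) (x : G) : M × Bool → G
  | (p, false) => φ p
  | (p, true) => φ p * x

theorem extF_mul {M : Type} {G : Type v} [Group G] {m : M → M → M} {φ : M → G} {x : G} {σ : M → M}
    {s : M} (hm : ∀ p q, φ (m p q) = φ p * φ q) (hσ : ∀ q, x * φ q = φ (σ q) * x)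
    (hs : x * x = φ s) : ∀ p q, extF φ x (extM m σ s p q) = extF φ x p * extF φ x q
  | (p, false), (q, false) => by simp only [extM, extF]; exact hm p q
  | (p, false), (q, true) => by simp only [extM, extF]; rw [hm, mul_assoc]
  | (p, true), (q, false) => by simp only [extM, extF]; rw [hm, mul_assoc, mul_assoc, hσ]
  | (p, true), (q, true) => by
    simp only [extM, extF]
    rw [hm, hm, mul_assoc (φ p) x, ← mul_assoc x, hσ, mul_assoc (φ (σ q)), hs, mul_assoc]

abbrev M1 := ZMod 8 × Bool
abbrev M2 := M1 × Bool

def f4 (b : Bool) : ZMod 8 := if b then 4 else 0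

def m1 (pp yy : Bool) : M1 → M1 → M1 :=
  extM (fun i j => i + j) (fun j => (3 + f4 pp) * j) (f4 yy)

def m2 (pp yy ew ey ee : Bool) : M2 → M2 → M2 :=
  extM (m1 pp yy) (fun q => ((1 + f4 ew) * q.1 + f4 (ey && q.2), q.2)) (f4 ee, false)

def al0 : List (ZMod 8) := [0, 1, 2, 3, 4, 5, 6, 7]
def dbl {M : Type} (l : List M) : List (M × Bool) := l.map (·, false) ++ l.map (·, true)
theorem mem_dbl {M : Type} {l : List M} (h : ∀ p, p ∈ l) : ∀ p, p ∈ dbl l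
  | (p, false) => List.mem_append_left _ (List.mem_map.2 ⟨p, h p, rfl⟩)
  | (p, true) => List.mem_append_right _ (List.mem_map.2 ⟨p, h p, rfl⟩)
theorem mem_al0 : ∀ i, i ∈ al0 := by decide

theorem cert1 : ∀ pp yy, certB (m1 pp yy) (dbl al0) [(2, false), (3, false), (0, true), (4, true)]
    (1, false) = true := by decide +kernel
theorem cert2 : ∀ pp yy ew ey ee, certB (m2 pp yy ew ey ee) (dbl (dbl al0))
    [((5, false), false), ((6, false), false), ((0, true), false), ((4, true), false),
      ((1, true), true), ((5, true), true)]
    ((1, false), false) = true := by decide +kernel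

section
variable {G : Type v} [Group G] {t c : G} {k : ℕ} {X : ℕ → G}

theorem Lift.cm_of_sq (L : Lift t c k X) {g : G} (h : g * g = c ∨ g * g = c * t) : Commute c g := by
  have hg : Commute (g * g) g := (Commute.refl g).mul_left (Commute.refl g)
  rcases h with h | h
  · rwa [h] at hg
  · have : c = (g * g) * t := by rw [h, mul_assoc, L.tt, mul_one]
    rw [this]
    exact hg.mul_left (L.tc g)

theorem Lift.flip (L : Lift t c k X) {a b : G} (h : a * b = b * a ∨ a * b = b * a * t) :
    b * a = a * b ∨ b * a = a * b * t := by
  rcases h with h | h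
  · exact Or.inl h.symm
  · right; rw [h, mul_assoc, L.tt, mul_one]

theorem Lift.cm_swap (L : Lift t c k X) {a b : G} (ha : a * a = 1 ∨ a * a = t)
    (hb : b * b = c ∨ b * b = c * t) (hab : a * b = b * a ∨ a * b = b * a * t) : Commute c a := by
  have hcb := L.cm_of_sq hb
  have key : ∀ g : G, (∃ s, (s = 1 ∨ s = t) ∧ g = c * s) → g = c ∨ g = c * t := by
    rintro _ ⟨s, rfl | rfl, rfl⟩
    · left; simp
    · right; rfl
  have hst : ∀ {s r : G}, (s = 1 ∨ s = t) → (r = 1 ∨ r = t) → (s * r = 1 ∨ s * r = t) := by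
    rintro _ _ (rfl | rfl) (rfl | rfl) <;> simp [L.tt]
  have hcs : ∀ {s : G}, (s = 1 ∨ s = t) → ∀ g, Commute s g := by
    rintro _ (rfl | rfl) g
    exacts [Commute.one_left g, L.tc g]
  obtain ⟨s, hs, hb'⟩ : ∃ s, (s = 1 ∨ s = t) ∧ b * b = c * s := by
    rcases hb with h | h
    · exact ⟨1, Or.inl rfl, by rw [h, mul_one]⟩
    · exact ⟨t, Or.inr rfl, h⟩
  obtain ⟨r, hr, hab'⟩ : ∃ r, (r = 1 ∨ r = t) ∧ b * a = a * b * r := by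
    rcases L.flip hab with h | h
    · exact ⟨1, Or.inl rfl, by rw [h, mul_one]⟩
    · exact ⟨t, Or.inr rfl, h⟩
  have h1 : Commute c (a * b) := by
    refine L.cm_of_sq (key _ ⟨s * r * (a * a), hst (hst hs hr) ha, ?_⟩)
    calc a * b * (a * b) = a * (b * a) * b := by simp only [mul_assoc]
      _ = a * a * (b * r) * b := by rw [hab']; simp only [mul_assoc]
      _ = a * a * (r * b) * b := by rw [(hcs hr b).eq]
      _ = (a * a) * (r * (b * b)) := by simp only [mul_assoc]
      _ = (a * a) * (r * (c * s)) := by rw [hb']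
      _ = (r * (c * s)) * (a * a) := (hcs ha _).eq
      _ = c * (s * r * (a * a)) := by rw [(hcs hr _).eq]; simp only [mul_assoc]
  have : a = (a * b) * b⁻¹ := by simp
  rw [this]
  exact h1.mul_right hcb.inv_right

theorem Lift.b1_big (L : Lift t c k X) (hk : k = 4 ∨ k = 5) : ∀ g, Commute c g := by
  have q0 : Commute c (X 0) := L.cm_of_sq (L.sq 0 (by omega))
  have h4 : decide (4 ≤ k) = true := by simp; omega
  have s2 : X 2 * X 2 = c ∨ X 2 * X 2 = c * t := by
    have := L.sq 2 (by omega)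
    simpa [sqS, h4, nu] using this
  have s3 : X 3 * X 3 = c ∨ X 3 * X 3 = c * t := by
    have := L.sq 3 (by omega)
    simpa [sqS, h4, nu] using this
  have q1 : Commute c (X 1) := by
    refine L.cm_swap (b := X 2) (by simpa [sqS, nu] using L.sq 1 (by omega)) s2 (L.flip ?_)
    simpa [comS, nu] using L.xcom 2 (by omega) 1 (by omega)
  refine L.central (Commute.refl c) fun i hi => ?_
  have : i = 0 ∨ i = 1 ∨ i = 2 ∨ i = 3 ∨ i = 4 := by omega
  rcases this with rfl | rfl | rfl | rfl | rfl
  · exact q0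
  · exact q1
  · exact L.cm_of_sq s2
  · exact L.cm_of_sq s3
  · refine L.cm_swap (b := X 0) (by simpa [sqS, nu] using L.sq 4 (by omega)) (L.sq 0 (by omega)) ?_
    simpa [comS, nu] using L.xcom 4 (by omega) 0 (by omega)

/-- the relations between `w` and `y` in case B1 -/
theorem Lift.b1_rel (L : Lift t c k X) (hk : 2 ≤ k) (hcy : ¬ Commute c (X 1)) :
    X 0 ^ 4 = t ∧ (X 1 * X 0 = X 0 ^ 3 * X 1 ∨ X 1 * X 0 = X 0 ^ 7 * X 1) ∧
      (c = X 0 ^ 2 ∨ c = X 0 ^ 6) := by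
  obtain ⟨w, hw⟩ : ∃ w, w = X 0 := ⟨_, rfl⟩
  obtain ⟨y, hy⟩ : ∃ y, y = X 1 := ⟨_, rfl⟩
  have hsq : c = w * w ∨ c = w * w * t := by
    have := L.sq 0 (by omega)
    rw [← hw] at this
    rcases this with h | h
    · left; exact h.symm
    · right; rw [h]; change c = c * t * t; rw [mul_assoc, L.tt, mul_one]
  have hcy' : c * y = y * c * t := by
    rw [hy]
    exact (L.com _).resolve_left hcy
  have hwy : w * w * y = y * (w * w) * t := by
    have h1 : w * w = c ∨ w * w = c * t := by
      rcases hsq with h | h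
      · left; exact h.symm
      · right; rw [h, mul_assoc, L.tt, mul_one]
    rcases h1 with h | h <;> rw [h]
    · exact hcy'
    · rw [mul_assoc, L.tcm, ← mul_assoc, hcy', mul_assoc y c t]
  have hyw : y * w = w * y * c ∨ y * w = w * y * c * t := by
    rw [hw, hy]; exact L.xcom 1 (by omega) 0 (by omega)
  have hyw2 : ∃ s, (s = 1 ∨ s = t) ∧ y * w = w * w * w * y * s := by
    have e : w * y * (w * w) = w * w * w * y * t := by
      have : y * (w * w) = w * w * y * t := by rw [hwy, mul_assoc _ t t, L.tt, mul_one]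
      rw [mul_assoc w y, this]; simp only [mul_assoc]
    rcases hsq with h | h <;> rcases hyw with h' | h'
    · exact ⟨t, Or.inr rfl, by rw [h', h, e]⟩
    · exact ⟨1, Or.inl rfl, by rw [h', h, e, mul_assoc _ t t, L.tt]⟩
    · exact ⟨1, Or.inl rfl, by rw [h', h, ← mul_assoc _ _ t, e, mul_assoc _ t t, L.tt]⟩
    · exact ⟨t, Or.inr rfl, by rw [h', h, ← mul_assoc _ _ t, e, mul_assoc _ t t, L.tt, mul_one]⟩
  obtain ⟨s, hs, hyw3⟩ := hyw2
  have hsc : ∀ g, s * g = g * s := by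
    rcases hs with rfl | rfl
    · simp
    · exact L.tc
  have hss : s * s = 1 := by
    rcases hs with rfl | rfl
    · simp
    · exact L.tt
  have h4 : w ^ 4 = t := by
    have e1 : y * (w * w) = w ^ 6 * y := by
      calc y * (w * w) = (y * w) * w := by rw [mul_assoc]
        _ = w * w * w * (y * (s * w)) := by rw [hyw3]; simp only [mul_assoc]
        _ = w * w * w * ((y * w) * s) := by rw [hsc w]; simp only [mul_assoc]
        _ = w * w * w * (w * w * w) * y * (s * s) := by rw [hyw3]; simp only [mul_assoc]
        _ = w ^ 6 * y := by
          rw [hss, mul_one]; simp only [pow_succ, pow_zero, one_mul, mul_assoc]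
    rw [e1] at hwy
    have e2 : w * w * y = w ^ 6 * t * y := by rw [hwy, mul_assoc, ← L.tcm, ← mul_assoc]
    have e3 : w * w = w ^ 6 * t := mul_right_cancel e2
    have e4 : (1 : G) = w ^ 4 * t := by
      have : w * w = w * w * (w ^ 4 * t) := by
        rw [← mul_assoc]; rw [show w * w * w ^ 4 = w ^ 6 by group]; exact e3
      exact (mul_eq_left.1 this.symm).symm
    calc w ^ 4 = w ^ 4 * (t * t) := by rw [L.tt, mul_one]
      _ = t := by rw [← mul_assoc, ← e4, one_mul]
  rw [← hw, ← hy]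
  refine ⟨h4, ?_, ?_⟩
  · rcases hs with rfl | rfl
    · left; rw [hyw3, mul_one]; simp only [pow_succ, pow_zero, one_mul]
    · right; rw [hyw3, ← L.tcm, ← h4]; group
  · rcases hsq with h | h
    · left; rw [h, pow_two]
    · right; rw [h, ← h4]; group

def W (w : G) (i : ZMod 8) : G := w ^ i.val

theorem W_nat {w : G} (h8 : w ^ 8 = 1) (n : ℕ) : W w (n : ZMod 8) = w ^ n := by
  unfold W
  rw [ZMod.val_natCast]
  exact (pow_eq_pow_mod n h8).symm

theorem W_add {w : G} (h8 : w ^ 8 = 1) (i j : ZMod 8) : W w (i + j) = W w i * W w j := by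
  have : i + j = ((i.val + j.val : ℕ) : ZMod 8) := by simp
  rw [this, W_nat h8, pow_add]; rfl

theorem W_semi {w x : G} (h8 : w ^ 8 = 1) {n : ℕ} (h : x * w = w ^ n * x) (j : ZMod 8) :
    x * W w j = W w (n * j) * x := by
  have h1 : SemiconjBy x w (w ^ n) := h
  have h2 := (h1.pow_right j.val).eq
  have : (n : ZMod 8) * j = ((n * j.val : ℕ) : ZMod 8) := by simp
  rw [this, W_nat h8, pow_mul]
  exact h2

theorem W_f4 {w : G} (h4 : w ^ 4 = t) (b : Bool) : W w (f4 b) = nu t b := by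
  cases b
  · simp [W, f4, nu]
  · change w ^ 4 = t
    exact h4

theorem nu_of {g : G} (h : g = 1 ∨ g = t) : ∃ b, g = nu t b := by
  rcases h with h | h
  exacts [⟨false, h⟩, ⟨true, h⟩]

theorem Lift.b1 [Finite G] (L : Lift t c k X) (hk : 2 ≤ k ∧ k ≤ 5) (hc : ¬ ∀ g, Commute c g) :
    ¬ Filled G := by
  have hk' : k = 2 ∨ k = 3 := by
    by_contra h
    exact hc (L.b1_big (by omega))
  have q0 : Commute c (X 0) := L.cm_of_sq (L.sq 0 (by omega))
  have s1 : X 1 * X 1 = 1 ∨ X 1 * X 1 = t := by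
    rcases hk' with rfl | rfl <;> simpa [sqS, nu] using L.sq 1 (by omega)
  have hcy : ¬ Commute c (X 1) := by
    intro hcy
    refine hc (L.central (Commute.refl c) fun i hi => ?_)
    have : i = 0 ∨ i = 1 ∨ i = 2 := by omega
    rcases this with rfl | rfl | rfl
    · exact q0
    · exact hcy
    · refine L.cm_swap (b := X 0) ?_ (L.sq 0 (by omega)) ?_
      · rcases hk' with rfl | rfl <;> simpa [sqS, nu] using L.sq 2 (by omega)
      · simpa [comS, nu] using L.xcom 2 (by omega) 0 (by omega)
  obtain ⟨h4, hyw, hcw⟩ := L.b1_rel hk.1 hcy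
  have h8 : X 0 ^ 8 = 1 := by
    have : X 0 ^ 8 = X 0 ^ 4 * X 0 ^ 4 := by rw [← pow_add]
    rw [this, h4, L.tt]
  have hyw' : ∃ pp, ∀ j, X 1 * W (X 0) j = W (X 0) ((3 + f4 pp) * j) * X 1 := by
    rcases hyw with h | h
    · exact ⟨false, fun j => W_semi h8 h j⟩
    · exact ⟨true, fun j => W_semi h8 h j⟩
  obtain ⟨pp, hpp⟩ := hyw'
  obtain ⟨yy, hyy⟩ := nu_of s1
  rw [← W_f4 h4] at hyy
  have hm0 := W_add h8
  have hm1 : ∀ p q, extF (W (X 0)) (X 1) (m1 pp yy p q) = _ := extF_mul hm0 hpp hyy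
  have w1 : W (X 0) 0 = 1 := by simp [W]
  have wt : W (X 0) 4 = t := h4
  have wc : ∃ i, W (X 0) i = c := by
    rcases hcw with h | h
    · exact ⟨2, h.symm⟩
    · exact ⟨6, h.symm⟩
  have w0 : W (X 0) 1 = X 0 := pow_one _
  rcases hk' with rfl | rfl
  · have hsurj : Function.Surjective (extF (W (X 0)) (X 1)) := by
      refine L.gen (Set.range (extF (W (X 0)) (X 1))) ?_ ⟨(0, false), w1⟩ ⟨(4, false), wt⟩ ?_ ?_
      · rintro _ ⟨p, rfl⟩ _ ⟨q, rfl⟩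
        exact ⟨_, hm1 p q⟩
      · obtain ⟨i, hi⟩ := wc
        exact ⟨(i, false), hi⟩
      · intro i hi
        interval_cases i
        · exact ⟨(1, false), w0⟩
        · exact ⟨(0, true), by simp [extF, w1]⟩
    have hbij := hsurj.bijective_of_nat_card_le (by
      rw [L.card, Nat.card_prod, Nat.card_zmod]; simp)
    exact cert_model (mem_dbl mem_al0) hbij hm1 (cert1 pp yy)
  · have hew : ∃ ew, ∀ j, X 2 * W (X 0) j = W (X 0) ((1 + f4 ew) * j) * X 2 := by
      have := L.xcom 2 (by omega) 0 (by omega)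
      simp only [comS, nu] at this
      rcases this with h | h
      · refine ⟨false, fun j => ?_⟩
        have h : X 2 * X 0 = X 0 ^ 1 * X 2 := by rw [pow_one, h]; simp [nu]
        have := W_semi h8 h j
        rwa [Nat.cast_one] at this
      · refine ⟨true, fun j => ?_⟩
        have h : X 2 * X 0 = X 0 ^ 5 * X 2 := by
          rw [show X 0 ^ 5 = X 0 ^ 4 * X 0 from pow_succ _ _, h4, mul_assoc, L.tcm, h]; simp [nu]
        exact W_semi h8 h j
    obtain ⟨ew, hew⟩ := hew
    have hey : ∃ ey, X 2 * X 1 = W (X 0) (f4 ey) * (X 1 * X 2) := by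
      have := L.xcom 2 (by omega) 1 (by omega)
      simp only [comS, nu] at this
      rcases this with h | h
      · exact ⟨false, by rw [W_f4 h4, h]; simp [nu]⟩
      · exact ⟨true, by rw [W_f4 h4, h]; simp [nu, L.tcm]⟩
    obtain ⟨ey, hey⟩ := hey
    have hee : ∃ ee, X 2 * X 2 = W (X 0) (f4 ee) := by
      have : X 2 * X 2 = 1 ∨ X 2 * X 2 = t := L.sq 2 (by omega) |>.imp id (by simp [sqS, nu])
      obtain ⟨ee, h⟩ := nu_of this
      exact ⟨ee, by rw [W_f4 h4, h]⟩
    obtain ⟨ee, hee⟩ := hee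
    have hσ : ∀ q : M1, X 2 * extF (W (X 0)) (X 1) q =
        extF (W (X 0)) (X 1) ((1 + f4 ew) * q.1 + f4 (ey && q.2), q.2) * X 2 := by
      rintro ⟨j, b⟩
      cases b
      · simp only [extF, Bool.and_false]
        rw [hew]; simp [f4]
      · simp only [extF, Bool.and_true]
        rw [← mul_assoc, hew, mul_assoc, hey, hm0]; simp only [mul_assoc]
    have hm2 : ∀ p q, extF (extF (W (X 0)) (X 1)) (X 2) (m2 pp yy ew ey ee p q) = _ :=
      extF_mul hm1 hσ hee
    have hsurj : Function.Surjective (extF (extF (W (X 0)) (X 1)) (X 2)) := by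
      refine L.gen (Set.range (extF (extF (W (X 0)) (X 1)) (X 2))) ?_ ⟨((0, false), false), w1⟩
        ⟨((4, false), false), wt⟩ ?_ ?_
      · rintro _ ⟨p, rfl⟩ _ ⟨q, rfl⟩
        exact ⟨_, hm2 p q⟩
      · obtain ⟨i, hi⟩ := wc
        exact ⟨((i, false), false), hi⟩
      · intro i hi
        interval_cases i
        · exact ⟨((1, false), false), w0⟩
        · exact ⟨((0, true), false), by simp [extF, w1]⟩
        · exact ⟨((0, false), true), by simp [extF, w1]⟩
    have hbij := hsurj.bijective_of_nat_card_le (by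
      rw [L.card, Nat.card_prod, Nat.card_prod, Nat.card_zmod]; simp)
    exact cert_model (mem_dbl (mem_dbl mem_al0)) hbij hm2 (cert2 pp yy ew ey ee)

end
end FG

namespace FG

/-! ### Tables of quadratic forms -/

/-- evaluate a list of booleans before passing it on -/
def force {β : Type} : List Bool → (List Bool → β) → β
  | [], f => f []
  | true :: l, f => force l fun l' => f (true :: l')
  | false :: l, f => force l fun l' => f (false :: l')

theorem force_eq {β : Type} : ∀ (l : List Bool) (f : List Bool → β), force l f = f l
  | [], _ => rfl
  | true :: l, f => by rw [force, force_eq l]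
  | false :: l, f => by rw [force, force_eq l]

def lin (s : Bool) (r : List Bool) : List Bool :=
  r.foldl (fun tab b => tab ++ tab.map (fun a => xor a b)) [s]

def ext (T : List Bool) : List Bool → List Bool
  | [] => T
  | s :: r => T ++ List.zipWith xor T (lin s r)

def tabRows : List (List Bool) → List Bool
  | [] => [false]
  | r :: rows => ext (tabRows rows) r

def cz : List Bool → ℕ
  | [] => 0
  | true :: l => cz l
  | false :: l => cz l + 1

theorem cz_eq : ∀ l : List Bool, cz l = l.countP (fun b => !b)
  | [] => rfl
  | true :: l => by simp [cz, cz_eq l]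
  | false :: l => by simp [cz, cz_eq l]

def rowOf (P : ℕ → Bool) (Q : ℕ → ℕ → Bool) (i : ℕ) : List Bool := P i :: (List.range i).map (Q i)

def rowsOf (P : ℕ → Bool) (Q : ℕ → ℕ → Bool) : ℕ → List (List Bool)
  | 0 => []
  | n + 1 => rowOf P Q n :: rowsOf P Q n

def allB : ℕ → (List Bool → Bool) → Bool
  | 0, f => f []
  | n + 1, f => (allB n fun l => f (false :: l)) && allB n fun l => f (true :: l)

theorem allB_sound : ∀ (n : ℕ) (f : List Bool → Bool), allB n f = true →
    ∀ l : List Bool, l.length = n → f l = true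
  | 0, f, h, l, hl => by
    rw [List.length_eq_zero_iff] at hl; subst hl; exact h
  | n + 1, f, h, [], hl => by simp at hl
  | n + 1, f, h, b :: l, hl => by
    simp only [allB, Bool.and_eq_true] at h
    have hl' : l.length = n := by simpa using hl
    cases b
    · exact allB_sound n _ h.1 l hl'
    · exact allB_sound n _ h.2 l hl'

def srch (leaf : List Bool → List (List Bool) → Bool) :
    ℕ → ℕ → List Bool → List (List Bool) → Bool
  | 0, _, T, rows => leaf T rows
  | n + 1, i, T, rows => allB (i + 1) fun r => force (ext T r) fun T' =>
      srch leaf n (i + 1) T' (r :: rows)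

theorem srch_sound {leaf : List Bool → List (List Bool) → Bool} {P : ℕ → Bool} {Q : ℕ → ℕ → Bool} :
    ∀ (n i : ℕ), srch leaf n i (tabRows (rowsOf P Q i)) (rowsOf P Q i) = true →
    leaf (tabRows (rowsOf P Q (i + n))) (rowsOf P Q (i + n)) = true
  | 0, i, h => h
  | n + 1, i, h => by
    have h1 := allB_sound (i + 1) _ h (rowOf P Q i) (by simp [rowOf])
    rw [force_eq] at h1
    have := srch_sound n (i + 1) h1
    rwa [show i + 1 + n = i + (n + 1) by omega] at this

/-! ### Models over a four group -/

def n2 (m : ℕ) : Bool × Bool := (m.testBit 0, m.testBit 1)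

def dec : (k : ℕ) → ℕ → El (Bool × Bool) k
  | 0, _ => (false, false)
  | k + 1, m => (dec k m, m.testBit k)

def decI (k m : ℕ) : El (Bool × Bool) k := addc k (dec k m) (n2 (m >>> k))

structure Pres where
  sq : List ℕ
  com : List (List ℕ)
  g : ℕ
  S : List ℕ

def Pres.sqv (p : Pres) (i : ℕ) : Bool × Bool := n2 (p.sq.getD i 0)
def Pres.comv (p : Pres) (i j : ℕ) : Bool × Bool := n2 ((p.com.getD i []).getD j 0)

def good (k : ℕ) (sq : ℕ → Bool × Bool) (com : ℕ → ℕ → Bool × Bool) (p : Pres)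
    (y : ℕ → El (Bool × Bool) k) : Bool :=
  (List.range k).all fun i => decide (mul sq com k (y i) (y i) = inN k (p.sqv i)) &&
    (List.range i).all fun j =>
      decide (mul sq com k (y i) (y j) = addc k (mul sq com k (y j) (y i)) (p.comv i j))

def sqR (k : ℕ) (rows : List (List Bool)) (i : ℕ) : Bool := (rows.getD (k - 1 - i) []).getD 0 false
def comR (k : ℕ) (rows : List (List Bool)) (i j : ℕ) : Bool :=
  (rows.getD (k - 1 - i) []).getD (j + 1) false

def keyB : List Bool → ℕ → ℕ
  | [], a => a
  | true :: l, a => keyB l (2 * a + 1)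
  | false :: l, a => keyB l (2 * a)

/-- the key of a form: the entries `com (i, 0), …, com (i, i - 1), sq i` in binary -/
def keyR : List (List Bool) → ℕ → ℕ
  | [], a => a
  | [] :: rows, a => keyR rows a
  | (s :: r) :: rows, a => keyR rows (keyB r.reverse (keyB [s] a))

def pr3a : Pres := ⟨[0, 0, 0], [[], [], [1, 2]], 5, [1, 6, 8, 10, 17, 18]⟩
def pr3b : Pres := ⟨[1, 2, 0], [[], [], [1, 2]], 1, [2, 11, 12, 17, 20]⟩
def pr4 : Pres := ⟨[1, 2, 2, 1], [[], [], [1, 3], [2, 1, 2]], 1, [9, 13, 15, 16]⟩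
def pr5 : Pres := ⟨[1, 2, 3, 1, 2], [[], [], [], [1, 0, 3], [0, 2, 3, 1]], 6,
  [32, 50, 55, 71, 115, 118]⟩

def pres (k m : ℕ) : Pres :=
  if k = 3 then (if m = 1 then pr3a else pr3b) else if k = 4 then pr4 else pr5

def tb3 : List (ℕ × ℕ × ℕ) := [
  (8, 1, 3202), (9, 1, 7298), (10, 1, 7302), (11, 1, 3206), (24, 1, 2179), (27, 1, 2183),
  (29, 1, 6275), (30, 1, 6279), (48, 2, 2177), (51, 2, 2181)]

def tb4 : List (ℕ × ℕ × ℕ) := [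
  (175, 1, 363590), (191, 1, 329831), (348, 1, 133537), (372, 1, 395425), (460, 1, 264609),
  (500, 1, 264353), (599, 1, 205988), (639, 1, 460903), (727, 1, 238756), (751, 1, 494662),
  (908, 1, 395553), (924, 1, 133409)]

def tb5 : List (ℕ × ℕ × ℕ) := [
  (17425, 1, 9595400), (17431, 1, 9579016), (17465, 1, 3369480), (17471, 1, 10103304),
  (17537, 1, 5528068), (17543, 1, 5511684), (17553, 1, 13793804), (17559, 1, 13777420),
  (17577, 1, 5511700), (17583, 1, 5528084), (17593, 1, 3357212), (17599, 1, 13924892),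
  (17754, 1, 13787658), (17756, 1, 13787674), (17778, 1, 5464586), (17780, 1, 5661210),
  (17866, 1, 13914630), (17868, 1, 13914646), (17882, 1, 9581086), (17884, 1, 9581070),
  (17890, 1, 13898262), (17892, 1, 13898246), (17906, 1, 5468686), (17908, 1, 5534238),
  (18001, 1, 9579032), (18007, 1, 9595416), (18041, 1, 3353112), (18047, 1, 9857560),
  (18113, 1, 3496452), (18119, 1, 6035972), (18129, 1, 13777436), (18135, 1, 13793820),
  (18153, 1, 3480084), (18159, 1, 5659156), (18169, 1, 3373580), (18175, 1, 14301708),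
  (18202, 1, 13771290), (18204, 1, 13771274), (18226, 1, 5448218), (18228, 1, 14295562),
  (18314, 1, 9785862), (18316, 1, 9851414), (18330, 1, 9597454), (18332, 1, 9597470),
  (18338, 1, 9769494), (18340, 1, 14422534), (18354, 1, 5452318), (18356, 1, 10105358),
  (19477, 1, 9596424), (19479, 1, 9580040), (19501, 1, 2354696), (19503, 1, 10104328),
  (19589, 1, 5529092), (19591, 1, 5512708), (19605, 1, 13794828), (19607, 1, 13778444),
  (19629, 1, 2342428), (19631, 1, 13925916), (19645, 1, 5512724), (19647, 1, 5529108),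
  (19788, 1, 9581071), (19790, 1, 9581087), (19804, 1, 13914647), (19806, 1, 13914631),
  (19812, 1, 13898247), (19814, 1, 13898263), (19828, 1, 5534239), (19830, 1, 5501455),
  (19916, 1, 13787675), (19918, 1, 13787659), (19956, 1, 5661211), (19958, 1, 5497355),
  (20037, 1, 2481668), (20039, 1, 6036996), (20053, 1, 13778460), (20055, 1, 13794844),
  (20077, 1, 2358796), (20079, 1, 14302732), (20093, 1, 2465300), (20095, 1, 5660180),
  (20181, 1, 9580056), (20183, 1, 9596440), (20205, 1, 2338328), (20207, 1, 9858584),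
  (20236, 1, 13771275), (20238, 1, 13771291), (20276, 1, 14295563), (20278, 1, 5480987),
  (20364, 1, 9597471), (20366, 1, 9597455), (20380, 1, 9851415), (20382, 1, 9818631),
  (20388, 1, 14422535), (20390, 1, 9802263), (20404, 1, 10105359), (20406, 1, 5485087),
  (22535, 1, 3868168), (22540, 1, 2344456), (22551, 1, 3343880), (22556, 1, 3360264),
  (22692, 1, 5464577), (22703, 1, 5464593), (22708, 1, 14115329), (22719, 1, 5497361),
  (22855, 1, 5511711), (22860, 1, 3185167), (22871, 1, 5495311), (22876, 1, 3201567),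
  (22884, 1, 3193351), (22895, 1, 3357207), (22900, 1, 3209751), (22911, 1, 13924871),
  (22983, 1, 5512734), (22988, 1, 2154014), (22999, 1, 5463566), (23004, 1, 2137614),
  (23012, 1, 2145798), (23023, 1, 13925894), (23028, 1, 2162198), (23039, 1, 2342422),
  (23111, 1, 2661902), (23116, 1, 2153998), (23127, 1, 5463582), (23132, 1, 2137630),
  (23140, 1, 2162182), (23151, 1, 2670086), (23156, 1, 2145814), (23167, 1, 2358806),
  (23239, 1, 3709455), (23244, 1, 3185183), (23255, 1, 5495327), (23260, 1, 3201551),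
  (23268, 1, 3209735), (23279, 1, 3373591), (23284, 1, 3193367), (23295, 1, 3717639),
  (23332, 1, 5448193), (23343, 1, 5448209), (23348, 1, 5972481), (23359, 1, 5480977),
  (23431, 1, 3606040), (23436, 1, 2344472), (23447, 1, 3343896), (23452, 1, 3360280),
  (26631, 1, 3999236), (26671, 1, 2665998), (26687, 1, 3713551), (26692, 1, 2475524),
  (26732, 1, 2158094), (26748, 1, 3189279), (26759, 1, 3474948), (26799, 1, 9793054),
  (26815, 1, 9824799), (26820, 1, 3491332), (26860, 1, 2141726), (26876, 1, 3205647),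
  (26895, 1, 9579039), (26911, 1, 9580062), (26935, 1, 3606036), (26956, 1, 3189263),
  (26972, 1, 2158110), (26996, 1, 2475540), (27023, 1, 9595407), (27039, 1, 9596430),
  (27063, 1, 3474964), (27084, 1, 3205663), (27100, 1, 2141710), (27124, 1, 3491348),
  (27156, 1, 9785857), (27180, 1, 2162186), (27196, 1, 3209739), (27223, 1, 9785873),
  (27247, 1, 2670090), (27263, 1, 3504667), (27284, 1, 14111233), (27308, 1, 2145818),
  (27324, 1, 3193371), (27351, 1, 9818641), (27375, 1, 2489882), (27391, 1, 3717643),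
  (27404, 1, 3193355), (27420, 1, 2145802), (27428, 1, 9769473), (27471, 1, 13777435),
  (27487, 1, 13794826), (27495, 1, 9769489), (27532, 1, 3209755), (27548, 1, 2162202),
  (27556, 1, 10293761), (27599, 1, 13793803), (27615, 1, 13778458), (27623, 1, 9802257),
  (30727, 1, 3868172), (30767, 1, 2665990), (30783, 1, 3713543), (30796, 1, 2344460),
  (30820, 1, 2158086), (30836, 1, 3189271), (30871, 1, 3343884), (30895, 1, 3369495),
  (30911, 1, 2354710), (30940, 1, 3360268), (30948, 1, 3205639), (30964, 1, 2141718),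
  (30999, 1, 3343900), (31023, 1, 3353111), (31039, 1, 2338326), (31068, 1, 3360284),
  (31076, 1, 3189255), (31092, 1, 2158102), (31111, 1, 3474972), (31151, 1, 9793030),
  (31167, 1, 9824775), (31180, 1, 2344476), (31204, 1, 2141702), (31220, 1, 3205655),
  (31244, 1, 2153994), (31260, 1, 3201547), (31284, 1, 9794049), (31303, 1, 2661898),
  (31319, 1, 5495323), (31359, 1, 5501457), (31372, 1, 3185179), (31388, 1, 2137626),
  (31396, 1, 5468673), (31431, 1, 3709451), (31447, 1, 5463578), (31471, 1, 5468689),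
  (31500, 1, 3185163), (31516, 1, 2137610), (31524, 1, 5452289), (31559, 1, 3480091),
  (31575, 1, 5463562), (31599, 1, 5452305), (31628, 1, 2154010), (31644, 1, 3201563),
  (31668, 1, 5976577), (31687, 1, 2465306), (31703, 1, 5495307), (31743, 1, 5485073)]

def tb (k : ℕ) : List (ℕ × ℕ × ℕ) :=
  if k = 3 then tb3 else if k = 4 then tb4 else if k = 5 then tb5 else []

def stdRows (k : ℕ) : List (List Bool) := rowsOf (sqS k) (comS k) k

/-- what is left of the leaf once the counts are right -/
def leafG (k : ℕ) (rows : List (List Bool)) : Bool :=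
  (decide (k = 5) && (rows.headD []).all (fun b => !b)) ||
    (tb k).any fun e => Nat.beq e.1 (keyR rows 0) &&
      good k (fun i => (sqS k i, sqR k rows i)) (fun i j => (comS k i j, comR k rows i j))
        (pres k e.2.1) (fun i => dec k ((e.2.2 >>> (5 * i)) % 32))

def leafB (k Z : ℕ) (std : List (List Bool)) (T : List Bool) (rows : List (List Bool)) : Bool :=
  !(Nat.beq (cz T) Z) || !(Nat.beq (cz (tabRows (List.zipWith (List.zipWith xor) std rows))) Z) ||
    leafG k rows

theorem srch2 : srch (leafB 2 3 (stdRows 2)) 2 0 [false] [] = true := by decide +kernel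
theorem srch3 : srch (leafB 3 6 (stdRows 3)) 3 0 [false] [] = true := by decide +kernel
theorem srch4 : srch (leafB 4 6 (stdRows 4)) 4 0 [false] [] = true := by decide +kernel

end FG

namespace FG

/-! ### A faster search for the last row -/

def forceN {β : Type} (x : ℕ) (f : ℕ → β) : β :=
  match x with
  | 0 => f 0
  | n + 1 => f (n + 1)

theorem forceN_eq {β : Type} (x : ℕ) (f : ℕ → β) : forceN x f = f x := by
  cases x <;> rfl

def forceL {β : Type} : List ℕ → (List ℕ → β) → β
  | [], f => f []
  | a :: l, f => forceN a fun a' => forceL l fun l' => f (a' :: l')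

theorem forceL_eq {β : Type} : ∀ (l : List ℕ) (f : List ℕ → β), forceL l f = f l
  | [], _ => rfl
  | a :: l, f => by rw [forceL, forceN_eq, forceL_eq l]

def pairF (m : ℕ) (b : Bool) : List ℕ → List ℕ
  | a :: a' :: l => (match b with
      | true => a + (m - a')
      | false => a + a') :: pairF m b l
  | _ => []

def bits : List Bool → List ℕ
  | [] => []
  | true :: l => 0 :: bits l
  | false :: l => 1 :: bits l

def tot (m : ℕ) : List ℕ → List Bool → ℕ
  | a :: A, true :: L => (m - a) + tot m A L
  | a :: A, false :: L => a + tot m A L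
  | _, _ => 0

def wht (f : List Bool → ℕ → ℕ → Bool) : ℕ → ℕ → List ℕ → List ℕ → List Bool → Bool
  | 0, _, A, A', acc => f acc (A.headD 0) (A'.headD 0)
  | n + 1, m, A, A', acc =>
    (forceL (pairF m false A) fun B => forceL (pairF m false A') fun B' =>
      wht f n (2 * m) B B' (acc ++ [false])) &&
    (forceL (pairF m true A) fun B => forceL (pairF m true A') fun B' =>
      wht f n (2 * m) B B' (acc ++ [true]))

theorem lin_cons (s b : Bool) (r : List Bool) :
    lin s (b :: r) = (lin s r).flatMap fun e => [e, xor e b] := by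
  have key : ∀ (r L : List Bool),
      r.foldl (fun tab b => tab ++ tab.map (fun a => xor a b)) (L.flatMap fun e => [e, xor e b]) =
      (r.foldl (fun tab b => tab ++ tab.map (fun a => xor a b)) L).flatMap fun e => [e, xor e b] := by
    intro r
    induction r with
    | nil => intro L; rfl
    | cons c r ih =>
      intro L
      rw [List.foldl_cons, List.foldl_cons, ← ih]
      congr 1
      rw [List.flatMap_append, List.map_flatMap, List.flatMap_map]
      congr 2
      funext e
      cases e <;> cases b <;> cases c <;> rfl
  exact key r [s]

theorem length_lin (s : Bool) (r : List Bool) : (lin s r).length = 2 ^ r.length := by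
  induction r with
  | nil => rfl
  | cons b r ih => rw [lin_cons]; simp [ih, pow_succ]

theorem tot_pair (m : ℕ) (b : Bool) : ∀ (L : List Bool) (A : List ℕ), A.length = 2 * L.length →
    (∀ a ∈ A, a ≤ m) →
    tot m A (L.flatMap fun e => [e, xor e b]) = tot (2 * m) (pairF m b A) L
  | [], A, h, _ => by
    have : A = [] := by simpa using h
    subst this; rfl
  | e :: L, [], h, _ => by simp at h
  | e :: L, [a], h, _ => by simp at h; omega
  | e :: L, a :: a' :: A, h, hA => by
    have ih := tot_pair m b L A (by simp at h; omega) fun x hx => hA x (by simp [hx])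
    have h1 := hA a (by simp)
    have h2 := hA a' (by simp)
    rw [List.flatMap_cons]
    cases e <;> cases b <;> simp [tot, pairF] at * <;> omega

theorem pairF_le (m : ℕ) (b : Bool) : ∀ (A : List ℕ), (∀ a ∈ A, a ≤ m) →
    ∀ a ∈ pairF m b A, a ≤ 2 * m
  | [], _ => by simp [pairF]
  | [_], _ => by simp [pairF]
  | a :: a' :: A, h => by
    have h1 := h a (by simp)
    have h2 := h a' (by simp)
    have ih := pairF_le m b A fun x hx => h x (by simp [hx])
    cases b <;> simp only [pairF, List.mem_cons] <;> rintro x (rfl | hx) <;>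
      first | omega | exact ih x hx

theorem pairF_length (m : ℕ) (b : Bool) : ∀ (n : ℕ) (A : List ℕ), A.length = 2 * n →
    (pairF m b A).length = n
  | 0, A, h => by
    have : A = [] := by simpa using h
    subst this; rfl
  | n + 1, [], h => by simp at h
  | n + 1, [_], h => by simp at h; omega
  | n + 1, _ :: _ :: A, h => by
    simp only [pairF, List.length_cons]
    rw [pairF_length m b n A (by simp at h; omega)]

theorem wht_sound (f : List Bool → ℕ → ℕ → Bool) : ∀ (n m : ℕ) (A A' : List ℕ) (acc : List Bool),
    wht f n m A A' acc = true → A.length = 2 ^ n → A'.length = 2 ^ n → (∀ a ∈ A, a ≤ m) →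
    (∀ a ∈ A', a ≤ m) → ∀ r : List Bool, r.length = n →
    f (acc ++ r) (tot m A (lin false r)) (tot m A' (lin false r)) = true
  | 0, m, A, A', acc, h, hA, hA', _, _, r, hr => by
    rw [List.length_eq_zero_iff] at hr; subst hr
    obtain ⟨a, rfl⟩ := List.length_eq_one_iff.1 hA
    obtain ⟨a', rfl⟩ := List.length_eq_one_iff.1 hA'
    simpa [wht, tot, lin] using h
  | n + 1, m, A, A', acc, h, hA, hA', hm, hm', [], hr => by simp at hr
  | n + 1, m, A, A', acc, h, hA, hA', hm, hm', b :: r, hr => by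
    have hr' : r.length = n := by simpa using hr
    have hl : (lin false r).length = 2 ^ n := by rw [length_lin, hr']
    have h' : wht f n (2 * m) (pairF m b A) (pairF m b A') (acc ++ [b]) = true := by
      simp only [wht, forceL_eq, Bool.and_eq_true] at h
      cases b
      exacts [h.1, h.2]
    have := wht_sound f n (2 * m) _ _ _ h'
      (pairF_length m b _ A (by rw [hA, pow_succ, mul_comm]))
      (pairF_length m b _ A' (by rw [hA', pow_succ, mul_comm]))
      (pairF_le m b A hm) (pairF_le m b A' hm') r hr'
    rw [lin_cons, tot_pair m b _ A (by rw [hA, hl, pow_succ, mul_comm]) hm,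
      tot_pair m b _ A' (by rw [hA', hl, pow_succ, mul_comm]) hm']
    simpa using this

theorem tot_bits : ∀ (T L : List Bool), tot 1 (bits T) L = cz (List.zipWith xor T L)
  | [], L => by simp [bits, tot, cz]
  | a :: T, [] => by cases a <;> simp [bits, tot, cz]
  | a :: T, b :: L => by
    have := tot_bits T L
    cases a <;> cases b <;> simp [bits, tot, cz, this, add_comm]

theorem bits_length : ∀ T : List Bool, (bits T).length = T.length
  | [] => rfl
  | a :: T => by cases a <;> simp [bits, bits_length T]

theorem bits_le : ∀ T : List Bool, ∀ a ∈ bits T, a ≤ 1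
  | [] => by simp [bits]
  | a :: T => by cases a <;> simp [bits] <;> exact bits_le T

theorem lin_true (r : List Bool) : lin true r = (lin false r).map (fun b => !b) := by
  have key : ∀ (r L : List Bool),
      r.foldl (fun tab b => tab ++ tab.map (fun a => xor a b)) (L.map fun b => !b) =
      (r.foldl (fun tab b => tab ++ tab.map (fun a => xor a b)) L).map fun b => !b := by
    intro r
    induction r with
    | nil => intro L; rfl
    | cons c r ih =>
      intro L
      rw [List.foldl_cons, List.foldl_cons, ← ih]
      congr 1
      simp
  exact key r [false]

theorem cz_compl : ∀ (T L : List Bool), T.length = L.length →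
    cz (List.zipWith xor T (L.map fun b => !b)) = T.length - cz (List.zipWith xor T L) ∧
    cz (List.zipWith xor T L) ≤ T.length
  | [], L, h => by simp [cz]
  | a :: T, [], h => by simp at h
  | a :: T, b :: L, h => by
    have := cz_compl T L (by simpa using h)
    cases a <;> cases b <;> simp [cz] at * <;> omega

theorem cz_append : ∀ T L : List Bool, cz (T ++ L) = cz T + cz L
  | [], L => by simp [cz]
  | a :: T, L => by
    have := cz_append T L
    cases a <;> simp [cz] <;> omega

theorem cz_ext {T : List Bool} {r : List Bool} {s : Bool} (h : T.length = 2 ^ r.length) :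
    cz (ext T (s :: r)) = cz T + (match s with
      | true => 2 ^ r.length - tot 1 (bits T) (lin false r)
      | false => tot 1 (bits T) (lin false r)) := by
  rw [ext, cz_append, tot_bits]
  cases s
  · rfl
  · rw [lin_true, (cz_compl T (lin false r) (by rw [h, length_lin])).1, h]

theorem tabRows_length (P : ℕ → Bool) (Q : ℕ → ℕ → Bool) : ∀ n,
    (tabRows (rowsOf P Q n)).length = 2 ^ n
  | 0 => rfl
  | n + 1 => by
    simp [rowsOf, tabRows, rowOf, ext, tabRows_length P Q n, length_lin, pow_succ]
    omega

def leafW (std : List (List Bool)) (T : List Bool) (rows : List (List Bool)) : Bool :=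
  force (tabRows (List.zipWith (List.zipWith xor) std rows)) fun T' =>
    forceN (cz T) fun z => forceN (cz T') fun z' =>
      wht (fun r a a' =>
        (!(Nat.beq (z + a) 12) || !(Nat.beq (z' + a') 12) || leafG 5 ((false :: r) :: rows)) &&
        (!(Nat.beq (z + (16 - a)) 12) || !(Nat.beq (z' + (16 - a')) 12) ||
          leafG 5 ((true :: r) :: rows))) 4 1 (bits T) (bits T') []

theorem srch5 : srch (leafW (stdRows 5).tail) 4 0 [false] [] = true := by decide +kernel

theorem rowsOf_xor (P P' : ℕ → Bool) (Q Q' : ℕ → ℕ → Bool) : ∀ n,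
    List.zipWith (List.zipWith xor) (rowsOf P Q n) (rowsOf P' Q' n) =
      rowsOf (fun i => xor (P i) (P' i)) (fun i j => xor (Q i j) (Q' i j)) n
  | 0 => rfl
  | n + 1 => by
    rw [rowsOf, rowsOf, rowsOf, List.zipWith_cons_cons, rowsOf_xor P P' Q Q' n]
    congr 1
    simp [rowOf, List.zipWith_map, List.zipWith_self]

theorem stdRows5 : stdRows 5 = List.replicate 5 false :: (stdRows 5).tail := by decide

theorem stdRows5' : (stdRows 5).tail = rowsOf (sqS 5) (comS 5) 4 := rfl

theorem leaf_all {k : ℕ} (hk : 2 ≤ k ∧ k ≤ 5) (P : ℕ → Bool) (Q : ℕ → ℕ → Bool)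
    (h1 : cz (tabRows (rowsOf P Q k)) = cz (tabRows (stdRows k)))
    (h2 : cz (tabRows (List.zipWith (List.zipWith xor) (stdRows k) (rowsOf P Q k))) =
      cz (tabRows (stdRows k))) : leafG k (rowsOf P Q k) = true := by
  have key : ∀ {k Z : ℕ}, cz (tabRows (stdRows k)) = Z →
      cz (tabRows (rowsOf P Q k)) = cz (tabRows (stdRows k)) →
      cz (tabRows (List.zipWith (List.zipWith xor) (stdRows k) (rowsOf P Q k))) =
        cz (tabRows (stdRows k)) →
      srch (leafB k Z (stdRows k)) k 0 [false] [] = true → leafG k (rowsOf P Q k) = true := by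
    intro k Z hZ h1 h2 h
    have h3 := srch_sound (P := P) (Q := Q) k 0 h
    rw [zero_add, leafB, h1, h2, hZ] at h3
    simpa using h3
  obtain ⟨hk1, hk2⟩ := hk
  interval_cases k
  · exact key (by decide) h1 h2 srch2
  · exact key (by decide) h1 h2 srch3
  · exact key (by decide) h1 h2 srch4
  · have h3 := srch_sound (P := P) (Q := Q) 4 0 srch5
    have hZ : cz (tabRows (stdRows 5)) = 12 := by decide +kernel
    rw [zero_add, leafW, force_eq, forceN_eq, forceN_eq, stdRows5', rowsOf_xor] at h3
    rw [stdRows5, show rowsOf P Q 5 = rowOf P Q 4 :: rowsOf P Q 4 from rfl,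
      List.zipWith_cons_cons, stdRows5', rowsOf_xor, ← stdRows5', ← stdRows5, hZ] at h2
    rw [hZ, show rowsOf P Q 5 = rowOf P Q 4 :: rowsOf P Q 4 from rfl] at h1
    have hr : (List.zipWith xor (List.replicate 5 false) (rowOf P Q 4)) = rowOf P Q 4 := by
      simp [rowOf, List.range_succ, List.replicate]
    rw [hr] at h2
    have h4 := wht_sound _ 4 1 _ _ [] h3 (by rw [bits_length, tabRows_length])
      (by rw [bits_length, tabRows_length]) (bits_le _) (bits_le _) ((List.range 4).map (Q 4))
      (by simp)
    rw [tabRows, rowOf, cz_ext (by rw [tabRows_length]; simp)] at h1 h2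
    rw [List.nil_append, Bool.and_eq_true] at h4
    obtain ⟨h5, h6⟩ := h4
    rw [show rowsOf P Q 5 = rowOf P Q 4 :: rowsOf P Q 4 from rfl, rowOf]
    have h16 : 2 ^ ((List.range 4).map (Q 4)).length = 16 := by simp
    cases hs : P 4
    · simp only [hs] at h1 h2
      rw [h1, h2] at h5
      simpa using h5
    · simp only [hs, h16] at h1 h2
      rw [h1, h2] at h6
      simpa using h6

end FG

namespace FG

/-! ### The exceptional groups -/

abbrev l2 : List (Bool × Bool) := FinN.l

def certP (k : ℕ) (p : Pres) : Bool :=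
  certB (mul p.sqv p.comv k) (elems l2 k) (p.S.map (decI k)) (decI k p.g)

def ndB (k : ℕ) (p : Pres) : Bool :=
  (elems l2 k).all fun a => l2.any (fun n => decide (a = inN k n)) ||
    (elems l2 k).any fun b => l2.any fun n => decide (n ≠ (false, false)) &&
      decide (mul p.sqv p.comv k a b = addc k (mul p.sqv p.comv k b a) n)

theorem cert3a : certP 3 pr3a = true := by decide +kernel
theorem cert3b : certP 3 pr3b = true := by decide +kernel
theorem cert4 : certP 4 pr4 = true := by decide +kernel
theorem cert5 : certP 5 pr5 = true := by decide +kernel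
theorem nd3a : ndB 3 pr3a = true := by decide +kernel
theorem nd3b : ndB 3 pr3b = true := by decide +kernel
theorem nd4 : ndB 4 pr4 = true := by decide +kernel
theorem nd5 : ndB 5 pr5 = true := by decide +kernel

end FG

namespace FG

theorem add_cancel {a b n : Bool × Bool} (h : XN.add a n = XN.add b n) : a = b := by
  revert a b n; decide

theorem z_add (n : Bool × Bool) : XN.add XN.z n = n := by revert n; decide

theorem el_inj {N : Type} {k : ℕ} {p q : El N k} {a b : Bool}
    (h : ((p, a) : El N (k + 1)) = (q, b)) : p = q ∧ a = b := Prod.mk.inj h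

theorem map_elems {N β : Type} (l : List N) (k : ℕ) (f : El N (k + 1) → β) :
    (elems l (k + 1)).map f = (elems l k).map (fun p => f (p, false)) ++
      (elems l k).map (fun p => f (p, true)) :=
  List.map_append.trans (congrArg₂ (fun a b => a ++ b) List.map_map List.map_map)

theorem countP_elems_succ {N : Type} (l : List N) (k : ℕ) (f : El N (k + 1) → Bool) :
    (elems l (k + 1)).countP f = (elems l k).countP (fun p => f (p, false)) +
      (elems l k).countP (fun p => f (p, true)) :=
  List.countP_append.trans (congrArg₂ (fun a b => a + b) List.countP_map List.countP_map)

theorem addc_cancel : ∀ (k : ℕ) {p q : El (Bool × Bool) k} {n : Bool × Bool},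
    addc k p n = addc k q n → p = q
  | 0, _, _, _, h => add_cancel h
  | k + 1, (p, a), (q, b), n, h => by
    have h := el_inj h
    exact Prod.ext (addc_cancel k h.1) h.2

theorem mul_cancel (sq : ℕ → Bool × Bool) (com : ℕ → ℕ → Bool × Bool) : ∀ (k : ℕ)
    {p q r : El (Bool × Bool) k}, mul sq com k p r = mul sq com k q r → p = q
  | 0, _, _, _, h => add_cancel h
  | k + 1, (p, a), (q, b), (r, e), h => by
    cases a <;> cases b <;> cases e <;> have h := el_inj h
    · exact Prod.ext (mul_cancel sq com k h.1) rfl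
    · exact Prod.ext (mul_cancel sq com k h.1) rfl
    · exact absurd h.2 (by simp)
    · exact absurd h.2 (by simp)
    · exact absurd h.2 (by simp)
    · exact absurd h.2 (by simp)
    · exact Prod.ext (mul_cancel sq com k (addc_cancel k h.1)) rfl
    · exact Prod.ext (mul_cancel sq com k (addc_cancel k h.1)) rfl

theorem one_mulM (sq : ℕ → Bool × Bool) (com : ℕ → ℕ → Bool × Bool) : ∀ (k : ℕ)
    (p : El (Bool × Bool) k), mul sq com k (inN k XN.z) p = p
  | 0, p => z_add p
  | k + 1, (p, a) => by
    have := one_mulM sq com k p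
    simp only [inN, mul, this]
    rfl

section
variable {G : Type*} [Group G]

theorem pres_not_filled [Finite G] {k : ℕ} {p : Pres} (hc : certP k p = true)
    (hd : ndB k p = true) {ν : Bool × Bool → G} {x : ℕ → G} (hν : Function.Injective ν)
    (h : Rels p.sqv p.comv k ν x) (hcard : Nat.card G = 2 ^ (k + 2)) : ¬ Filled G := by
  have hker : ∀ r, phi ν x k r = 1 → r = inN k XN.z := by
    intro r hr
    simp only [ndB, List.all_eq_true, Bool.or_eq_true, List.any_eq_true, Bool.and_eq_true,
      decide_eq_true_eq] at hd
    rcases hd r (mem_elems FinN.mem k r) with ⟨n, -, hn⟩ | ⟨b, -, n, -, hn, hb⟩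
    · subst hn
      rw [phi_inN, ← h.zero] at hr
      rw [hν hr]
    · exfalso
      apply hn
      have h1 := congrArg (phi ν x k) hb
      rw [phi_addc h, phi_mul h, phi_mul h, hr, one_mul, mul_one, left_eq_mul, ← h.zero] at h1
      exact hν h1
  have hinj : Function.Injective (phi ν x k) := by
    intro a b hab
    have h1 : Function.Injective fun r => mul p.sqv p.comv k r b :=
      fun _ _ h => mul_cancel p.sqv p.comv k h
    obtain ⟨r, hr⟩ := (Finite.injective_iff_surjective.1 h1) a
    simp only at hr
    rw [← hr, phi_mul h] at hab
    rw [hker r (by simpa using hab), one_mulM] at hr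
    exact hr.symm
  have hbij : Function.Bijective (phi ν x k) := by
    refine hinj.bijective_of_nat_card_le ?_
    rw [hcard, card_El, Nat.card_prod]
    simp [pow_succ]
    omega
  exact cert_model (mem_elems FinN.mem k) hbij (phi_mul h) hc

theorem pres_ok {k m : ℕ} (hk : 3 ≤ k ∧ k ≤ 5) :
    certP k (pres k m) = true ∧ ndB k (pres k m) = true := by
  obtain ⟨h1, h2⟩ := hk
  interval_cases k
  · by_cases hm : m = 1
    · simp only [pres, hm, if_true]; exact ⟨cert3a, nd3a⟩
    · simp only [pres, hm, if_true, if_false]; exact ⟨cert3b, nd3b⟩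
  · exact ⟨cert4, nd4⟩
  · exact ⟨cert5, nd5⟩

theorem rels_good {k : ℕ} {sq : ℕ → Bool × Bool} {com : ℕ → ℕ → Bool × Bool} {p : Pres}
    {y : ℕ → El (Bool × Bool) k} (hg : good k sq com p y = true) {ν : Bool × Bool → G} {x : ℕ → G}
    (h : Rels sq com k ν x) : Rels p.sqv p.comv k ν (fun i => phi ν x k (y i)) := by
  simp only [good, List.all_eq_true, List.mem_range, Bool.and_eq_true, decide_eq_true_eq] at hg
  refine ⟨h.zero, h.add, h.cen, ?_, ?_⟩
  · intro i hi
    rw [← phi_mul h, (hg i hi).1, phi_inN]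
  · intro i hi j hj
    rw [← phi_mul h, (hg i hi).2 j hj, phi_addc h, phi_mul h]

/-! ### Counting square roots of one -/

def sqB (sq : ℕ → Bool) (com : ℕ → ℕ → Bool) : (k : ℕ) → El Bool k → Bool
  | 0, _ => false
  | k + 1, p => match p.2 with
    | true => xor (sqB sq com k p.1) (xor (lam com k k p.1) (sq k))
    | false => sqB sq com k p.1

theorem addc_inN {N : Type} [XN N] : ∀ (k : ℕ) (a n : N),
    addc k (inN k a) n = inN k (XN.add a n)
  | 0, _, _ => rfl
  | k + 1, a, n => by simp only [addc, inN, addc_inN k]; rfl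

theorem mul_self_model (sq : ℕ → Bool) (com : ℕ → ℕ → Bool) : ∀ (k : ℕ) (p : El Bool k),
    mul sq com k p p = inN k (sqB sq com k p)
  | 0, p => Bool.xor_self p
  | k + 1, (p, true) => by
    simp only [mul, sqB, mul_self_model sq com k p, addc_inN]; rfl
  | k + 1, (p, false) => by
    simp only [mul, sqB, mul_self_model sq com k p]; rfl

theorem lin_elems (b : Bool) (com : ℕ → ℕ → Bool) (s : Bool) (i : ℕ) : ∀ k : ℕ,
    (elems [b] k).map (fun p => xor (lam com i k p) s) = lin s ((List.range k).map (com i))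
  | 0 => by
    simp only [elems, lin, lam, XN.z, Bool.false_xor]; rfl
  | k + 1 => by
    have ih := lin_elems b com s i k
    rw [List.range_succ, List.map_append, lin, List.foldl_append]
    simp only [lin] at ih
    rw [← ih]
    rw [map_elems]
    simp only [List.map_map, List.map_cons, List.map_nil, List.foldl_cons, List.foldl_nil]
    congr 1
    apply List.map_congr_left
    intro p _
    simp only [Function.comp, lam, XN.add]
    cases lam com i k p <;> cases s <;> cases com i k <;> rfl

theorem tab_elems (b : Bool) (sq : ℕ → Bool) (com : ℕ → ℕ → Bool) : ∀ k : ℕ,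
    (elems [b] k).map (sqB sq com k) = tabRows (rowsOf sq com k)
  | 0 => rfl
  | k + 1 => by
    have ih := tab_elems b sq com k
    rw [rowsOf, tabRows, rowOf, ext, ← ih, ← lin_elems b com (sq k) k k]
    rw [map_elems]
    simp only [List.zipWith_map, List.zipWith_self]
    rfl

theorem countP_elems : ∀ (k : ℕ) (f : El Bool k → Bool),
    (elems [false, true] k).countP f = (elems [false] k).countP f + (elems [true] k).countP f
  | 0, f => by
    exact List.countP_append (l₁ := [false]) (l₂ := [true])
  | k + 1, f => by
    simp only [countP_elems_succ, countP_elems k]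
    omega

theorem nodup_elems : ∀ k : ℕ, (elems [false, true] k).Nodup
  | 0 => (by decide : [false, true].Nodup)
  | k + 1 => by
    have ih := nodup_elems k
    refine List.Nodup.append (ih.map fun a b h => (Prod.mk.inj h).1)
      (ih.map fun a b h => (Prod.mk.inj h).1) ?_
    intro a h1 h2
    obtain ⟨p, -, rfl⟩ := List.mem_map.1 h1
    obtain ⟨q, -, h⟩ := List.mem_map.1 h2
    exact absurd (Prod.mk.inj h).2 (by simp)

theorem cz_elems (sq : ℕ → Bool) (com : ℕ → ℕ → Bool) (k : ℕ) :
    (elems [false, true] k).countP (fun p => !(sqB sq com k p)) =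
      2 * cz (tabRows (rowsOf sq com k)) := by
  have : ∀ b, (elems [b] k).countP (fun p => !(sqB sq com k p)) =
      cz (tabRows (rowsOf sq com k)) := fun b => by
    rw [cz_eq, ← tab_elems b, List.countP_map]; rfl
  rw [countP_elems, this, this, two_mul]

theorem sq_phi {sq : ℕ → Bool} {com : ℕ → ℕ → Bool} {k : ℕ} {z : G} {x : ℕ → G} (hz : z ≠ 1)
    (h : Rels sq com k (nu z) x) (p : El Bool k) :
    sqB sq com k p = false ↔ phi (nu z) x k p * phi (nu z) x k p = 1 := by
  rw [← phi_mul h, mul_self_model, phi_inN]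
  cases sqB sq com k p <;> simp [nu, hz]

theorem count_eq {sq sq' : ℕ → Bool} {com com' : ℕ → ℕ → Bool} {k : ℕ} {z z' : G} {x x' : ℕ → G}
    (hz : z ≠ 1) (hz' : z' ≠ 1) (h : Rels sq com k (nu z) x) (h' : Rels sq' com' k (nu z') x')
    (hb : Function.Bijective (phi (nu z) x k)) (hb' : Function.Bijective (phi (nu z') x' k)) :
    cz (tabRows (rowsOf sq com k)) = cz (tabRows (rowsOf sq' com' k)) := by
  let e := (Equiv.ofBijective _ hb).trans (Equiv.ofBijective _ hb').symm
  have he : ∀ p, phi (nu z') x' k (e p) = phi (nu z) x k p := fun p =>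
    Equiv.ofBijective_apply_symm_apply _ hb' _
  have h1 : ∀ p, (!(sqB sq com k p)) = !(sqB sq' com' k (e p)) := fun p => by
    have h1 := sq_phi hz h p
    rw [← he p] at h1
    have := h1.trans (sq_phi hz' h' (e p)).symm
    revert this
    cases sqB sq com k p <;> cases sqB sq' com' k (e p) <;> simp
  have h2 := cz_elems sq com k
  have h3 := cz_elems sq' com' k
  have h4 : ((elems [false, true] k).map e).Perm (elems [false, true] k) := by
    rw [List.perm_ext_iff_of_nodup ((nodup_elems k).map e.injective) (nodup_elems k)]
    intro a
    have hm := mem_elems (l := [false, true]) (by decide) k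
    simp only [hm, iff_true, List.mem_map]
    exact ⟨e.symm a, trivial, by simp⟩
  have h5 := h4.countP_eq (fun p => !(sqB sq' com' k p))
  rw [List.countP_map] at h5
  have h6 : ((fun p => !(sqB sq' com' k p)) ∘ e) = fun p => !(sqB sq com k p) :=
    funext fun p => (h1 p).symm
  rw [h6] at h5
  omega

end
end FG

namespace FG
universe v

theorem getD_rowsOf (P : ℕ → Bool) (Q : ℕ → ℕ → Bool) : ∀ (k i : ℕ), i < k →
    (rowsOf P Q k).getD (k - 1 - i) [] = rowOf P Q i
  | 0, _, h => absurd h (by omega)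
  | k + 1, i, h => by
    rw [rowsOf]
    by_cases hi : i = k
    · subst hi; simp
    · have : k + 1 - 1 - i = (k - 1 - i) + 1 := by omega
      rw [this, List.getD_cons_succ]
      exact getD_rowsOf P Q k i (by omega)

theorem sqR_rowsOf {P : ℕ → Bool} {Q : ℕ → ℕ → Bool} {k i : ℕ} (hi : i < k) :
    sqR k (rowsOf P Q k) i = P i := by
  rw [sqR, getD_rowsOf P Q k i hi]; rfl

theorem comR_rowsOf {P : ℕ → Bool} {Q : ℕ → ℕ → Bool} {k i j : ℕ} (hi : i < k) (hj : j < i) :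
    comR k (rowsOf P Q k) i j = Q i j := by
  rw [comR, getD_rowsOf P Q k i hi, rowOf, List.getD_cons_succ]
  simp [List.getD_eq_getElem?_getD, hj]

section caseB3
variable {G : Type v} [Group G] {t c : G} {k : ℕ} {X : ℕ → G}

theorem Lift.count [Finite G] (L : Lift t c k X) (hc : ∀ g, Commute c g)
    (hcc : c * c = 1) {P : ℕ → Bool} {Q : ℕ → ℕ → Bool}
    (hsq : ∀ i < k, X i * X i = nu c (sqS k i) * nu t (P i))
    (hcom : ∀ i < k, ∀ j < i, X i * X j = X j * X i * (nu c (comS k i j) * nu t (Q i j)))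
    (β : Bool) (hQ : ∃ k', (2 ≤ k' ∧ k' ≤ 5) ∧ QuoStd (c * nu t β) k') :
    cz (tabRows (rowsOf (fun i => xor (β && sqS k i) (P i))
      (fun i j => xor (β && comS k i j) (Q i j)) k)) = cz (tabRows (stdRows k)) := by
  obtain ⟨k', hk', hq⟩ := hQ
  have htt := L.tt
  have e1 : c * nu t β ≠ 1 := by
    cases β
    · simpa [nu] using L.c1
    · intro h
      apply L.ct
      calc c = c * t * t := by rw [mul_assoc, htt, mul_one]
        _ = t := by rw [show c * t = 1 from h, one_mul]
  have et : t ≠ c * nu t β := by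
    cases β
    · simpa [nu] using L.ct.symm
    · intro h; exact L.c1 (right_eq_mul.1 h)
  have ec : ∀ g, Commute (c * nu t β) g := fun g =>
    (hc g).mul_left (by cases β; exacts [Commute.one_left g, L.tc g])
  have ee : (c * nu t β) * (c * nu t β) = 1 := by
    have : nu t β * nu t β = 1 := by cases β <;> simp [nu, htt]
    rw [mul_assoc, ← mul_assoc (nu t β), ← (hc (nu t β)).eq, mul_assoc, this, mul_one, hcc]
  have hkk : k' = k := by
    obtain ⟨c', X', L'⟩ := exists_lift hk' ec e1 ee hq
    have := L'.card.symm.trans L.card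
    have := Nat.pow_right_injective le_rfl this
    omega
  subst hkk
  obtain ⟨H, _, π, hπ, hker, hst⟩ := hq
  have hcardH := hst.card
  obtain ⟨z, x, hz⟩ := hst
  have T1 : π t ≠ 1 := by
    intro h
    rcases (hker t).1 h with h | h
    · exact L.t1 h
    · exact et h
  have TT : π t * π t = 1 := by rw [← map_mul, htt, map_one]
  have hnt : ∀ b, π (nu t b) = nu (π t) b := fun b => by cases b <;> simp [nu]
  have hπc : π c = nu (π t) β := by
    have h1 : π c * nu (π t) β = 1 := by
      rw [← hnt, ← map_mul]; exact (hker _).2 (Or.inr rfl)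
    have h2 : nu (π t) β * nu (π t) β = 1 := by cases β <;> simp [nu, TT]
    exact mul_right_cancel (h1.trans h2.symm)
  have hnc : ∀ b, π (nu c b) = nu (π t) (β && b) := fun b => by
    cases b
    · simp [nu]
    · simp [nu, hπc]
  have hadd : ∀ a b, nu (π t) (xor a b) = nu (π t) a * nu (π t) b := nu_add TT
  have hR : Rels (fun i => xor (β && sqS k' i) (P i))
      (fun i j => xor (β && comS k' i j) (Q i j)) k' (nu (π t)) (fun i => π (X i)) := by
    refine rels_nu TT ?_ ?_ ?_
    · intro g
      obtain ⟨g, rfl⟩ := hπ g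
      rw [← map_mul, L.tcm, map_mul]
    · intro i hi
      rw [← map_mul, hsq i hi, map_mul, hnc, hnt, hadd]
    · intro i hi j hj
      rw [← map_mul, hcom i hi j hj, map_mul, map_mul, map_mul, hnc, hnt, hadd]
  have hsurj : Function.Surjective (phi (nu (π t)) (fun i => π (X i)) k') := by
    intro g
    obtain ⟨g, rfl⟩ := hπ g
    refine L.gen {g | ∃ p, phi (nu (π t)) (fun i => π (X i)) k' p = π g} ?_ ?_ ?_ ?_ ?_ g
    · rintro a ⟨p, hp⟩ b ⟨q, hq⟩
      exact ⟨_, (phi_mul hR p q).trans (by rw [hp, hq, map_mul])⟩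
    · exact ⟨inN k' false, by rw [phi_inN, map_one]; rfl⟩
    · exact ⟨inN k' true, by rw [phi_inN]; rfl⟩
    · exact ⟨inN k' β, by rw [phi_inN, hπc]⟩
    · intro i hi
      exact phi_gen (x := fun i => π (X i)) hR.zero k' i hi
  have hbij : Function.Bijective (phi (nu (π t)) (fun i => π (X i)) k') := by
    have : Finite H := Finite.of_surjective _ hz.bij.2
    have : Finite (El Bool k') := Finite.of_injective _ hz.bij.1
    refine hsurj.bijective_of_nat_card_le ?_
    rw [hcardH, card_El]
    simp [pow_succ, mul_comm]
  exact count_eq T1 hz.z1 hR hz.rels hbij hz.bij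

theorem Lift.b3 [Finite G] (L : Lift t c k X) (hk : 2 ≤ k ∧ k ≤ 5) (hc : ∀ g, Commute c g)
    (hcc : c * c = 1)
    (hQ : ∀ e : G, (∀ g, Commute e g) → e ≠ 1 → e * e = 1 → ∃ k', (2 ≤ k' ∧ k' ≤ 5) ∧ QuoStd e k')
    (hn : ∀ z : G, ¬ Z2 z) : ¬ Filled G := by
  have hP : ∀ i, ∃ b, i < k → X i * X i = nu c (sqS k i) * nu t b := fun i => by
    by_cases hi : i < k
    · rcases L.sq i hi with h | h
      · exact ⟨false, fun _ => by rw [h]; simp [nu]⟩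
      · exact ⟨true, fun _ => h⟩
    · exact ⟨false, fun h => absurd h hi⟩
  have hQ' : ∀ i j, ∃ b, i < k → j < i → X i * X j = X j * X i * (nu c (comS k i j) * nu t b) :=
    fun i j => by
    by_cases hi : i < k
    · by_cases hj : j < i
      · rcases L.xcom i hi j hj with h | h
        · exact ⟨false, fun _ _ => by rw [h]; simp [nu]⟩
        · exact ⟨true, fun _ _ => by rw [h, mul_assoc]; rfl⟩
      · exact ⟨false, fun _ h => absurd h hj⟩
    · exact ⟨false, fun h => absurd h hi⟩
  choose P hP using hP
  choose Q hQ' using hQ'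
  have htt := L.tt
  have ct1 : c * t ≠ 1 := by
    intro h
    apply L.ct
    calc c = c * t * t := by rw [mul_assoc, htt, mul_one]
      _ = t := by rw [h, one_mul]
  -- the counting conditions
  have h1 := L.count hc hcc hP (fun i hi j hj => hQ' i j hi hj) false
    (hQ _ (fun g => by simpa [nu] using hc g) (by simpa [nu] using L.c1) (by simpa [nu] using hcc))
  have h2 := L.count hc hcc hP (fun i hi j hj => hQ' i j hi hj) true
    (hQ _ (fun g => (hc g).mul_left (L.tc g)) ct1 (by
      change c * t * (c * t) = 1
      rw [mul_assoc, ← mul_assoc t, L.tcm c, mul_assoc, htt, mul_one, hcc]))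
  simp only [Bool.false_and, Bool.false_xor] at h1
  simp only [Bool.true_and] at h2
  rw [← rowsOf_xor (sqS k) P (comS k) Q k] at h2
  have hleaf := leaf_all hk P Q h1 h2
  -- the relations
  let ν : Bool × Bool → G := fun n => nu c n.1 * nu t n.2
  have hct : c * t = t * c := hc t
  have hνi : Function.Injective ν := by
    have h3 : ∀ n, ν n = 1 → n = (false, false) := by
      rintro ⟨a, b⟩ h
      cases a <;> cases b
      · rfl
      · exact absurd (by simpa [ν, nu] using h) L.t1
      · exact absurd (by simpa [ν, nu] using h) L.c1
      · exact absurd h ct1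
    have h4 : ∀ a b, ν (XN.add a b) = ν a * ν b := by
      rintro ⟨a, b⟩ ⟨a', b'⟩
      have := nu_add hcc a a'
      have h6 := nu_add htt b b'
      have h7 : nu c a' * nu t b = nu t b * nu c a' := by
        cases a' <;> cases b <;> simp [nu, hct]
      change nu c (XN.add a a') * nu t (XN.add b b') = _
      rw [this, h6]
      simp only [ν]
      rw [mul_assoc, ← mul_assoc (nu c a'), h7]
      simp only [mul_assoc]
    intro a b hab
    have h5 : ν (XN.add a b) = 1 := by
      rw [h4, hab, ← h4]
      obtain ⟨b1, b2⟩ := b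
      cases b1 <;> cases b2 <;> simp [ν, nu, XN.add]
    have := h3 _ h5
    revert this
    clear hab h5
    revert a b
    decide
  have hR0 : Rels (fun i => (sqS k i, P i)) (fun i j => (comS k i j, Q i j)) k ν X := by
    refine ⟨by simp [ν, nu, XN.z], ?_, ?_, fun i hi => hP i hi, fun i hi j hj => hQ' i j hi hj⟩
    · rintro ⟨a, b⟩ ⟨a', b'⟩
      have := nu_add hcc a a'
      have h6 := nu_add htt b b'
      have h7 : nu c a' * nu t b = nu t b * nu c a' := by
        cases a' <;> cases b <;> simp [nu, hct]
      change nu c (XN.add a a') * nu t (XN.add b b') = _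
      rw [this, h6]
      simp only [ν]
      rw [mul_assoc, ← mul_assoc (nu c a'), h7]
      simp only [mul_assoc]
    · rintro ⟨a, b⟩ g
      refine Commute.mul_left (?_ : Commute _ _) ?_
      · cases a; exacts [Commute.one_left g, hc g]
      · cases b; exacts [Commute.one_left g, L.tc g]
  have hR : Rels (fun i => (sqS k i, sqR k (rowsOf P Q k) i))
      (fun i j => (comS k i j, comR k (rowsOf P Q k) i j)) k ν X := by
    refine ⟨hR0.zero, hR0.add, hR0.cen, fun i hi => ?_, fun i hi j hj => ?_⟩
    · rw [sqR_rowsOf hi]; exact hR0.sq i hi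
    · rw [comR_rowsOf hi hj]; exact hR0.com i hi j hj
  rw [leafG, Bool.or_eq_true, Bool.and_eq_true, decide_eq_true_eq, List.any_eq_true] at hleaf
  rcases hleaf with ⟨rfl, hrow⟩ | ⟨e, he, hg⟩
  · -- `X 4` is a central involution outside the four group
    intro _
    have hrow' : ∀ b ∈ rowOf P Q 4, b = false := by
      simpa [rowsOf] using hrow
    have hP4 : P 4 = false := hrow' _ (by simp [rowOf])
    have hQ4 : ∀ j < 4, Q 4 j = false := fun j hj =>
      hrow' _ (by rw [rowOf]; exact List.mem_cons_of_mem _ (List.mem_map_of_mem (List.mem_range.2 hj)))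
    have hx2 : X 4 * X 4 = 1 := by
      rw [hP 4 (by omega), hP4]; simp [nu, sqS]
    have hxc : ∀ g, Commute (X 4) g := by
      refine L.central (hc _).symm fun i hi => ?_
      by_cases h4 : i = 4
      · rw [h4]
      · have h3 := hQ' 4 i (by omega) (by omega)
        rw [hQ4 i (by omega)] at h3
        have : comS 5 4 i = false := by simp [comS]
        rw [this] at h3
        have h5 : X 4 * X i = X i * X 4 := by simpa [nu] using h3
        exact h5
    have hsurj : Function.Surjective (phi ν X 5) := by
      refine L.gen {g | ∃ p, phi ν X 5 p = g} ?_ ?_ ?_ ?_ ?_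
      · rintro a ⟨p, hp⟩ b ⟨q, hq⟩
        exact ⟨_, (phi_mul hR p q).trans (by rw [hp, hq])⟩
      · exact ⟨inN 5 (false, false), by rw [phi_inN]; simp [ν, nu]⟩
      · exact ⟨inN 5 (false, true), by rw [phi_inN]; simp [ν, nu]⟩
      · exact ⟨inN 5 (true, false), by rw [phi_inN]; simp [ν, nu]⟩
      · intro i hi
        exact phi_gen hR.zero 5 i hi
    have hbij : Function.Bijective (phi ν X 5) := by
      refine hsurj.bijective_of_nat_card_le ?_
      rw [L.card, card_El, Nat.card_prod]
      simp
    have hxN : ∀ n, X 4 ≠ ν n := by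
      intro n h
      have e1 : phi ν X 5 (topE 4 XN.z) = X 4 := by
        change phi ν X 4 (inN 4 XN.z) * X 4 = X 4
        rw [phi_inN, hR.zero, one_mul]
      have e2 : phi ν X 5 (inN 5 n) = ν n := phi_inN 5 n
      have := hbij.1 (e1.trans (h.trans e2.symm))
      exact absurd (Prod.mk.inj this).2 (by simp)
    have hsqN : ∀ g : G, ∃ n, g * g = ν n := by
      intro g
      rcases L.sqs g with (h | h) | (h | h)
      · exact ⟨(false, false), by simp [ν, nu, h]⟩
      · exact ⟨(false, true), by simp [ν, nu, h]⟩
      · exact ⟨(true, false), by simp [ν, nu, h]⟩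
      · exact ⟨(true, true), by simp [ν, nu, h]⟩
    have hx1 : X 4 ≠ 1 := fun h => hxN XN.z (h.trans hR.zero.symm)
    have hνν : ∀ n, ν n * ν n = 1 := by
      intro n
      rw [← hR.add, ← hR.zero]
      congr 1
      revert n; decide
    -- two different nontrivial squares
    have hs1 : X 0 * X 0 ≠ 1 := by
      rw [hP 0 (by omega)]
      cases P 0
      · simpa [nu, sqS] using L.c1
      · simpa [nu, sqS] using ct1
    obtain ⟨n1, hn1⟩ := hsqN (X 0)
    have : ∃ g : G, g * g ≠ 1 ∧ g * g ≠ X 0 * X 0 := by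
      by_contra hcon
      push Not at hcon
      refine hn (X 0 * X 0) ⟨hs1, ?_, ?_, ?_⟩
      · rw [hn1, hνν]
      · intro g; rw [hn1]; exact hR.cen n1 g
      · intro g
        by_cases h : g * g = 1
        · exact Or.inl h
        · exact Or.inr (hcon g h)
    obtain ⟨g, hg1, hg2⟩ := this
    obtain ⟨n2, hn2⟩ := hsqN g
    obtain ⟨k', hk', H, _, π, hπ, hker, z, x, hz⟩ := hQ (X 4) hxc hx1 hx2
    obtain ⟨c', hF⟩ := hz.facts hk'
    have hne : ∀ n, ν n ≠ 1 → π (ν n) ≠ 1 := by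
      intro n h3 h4
      rcases (hker _).1 h4 with h | h
      · exact h3 h
      · exact hxN n h.symm
    have e1 : π (ν n1) = z := by
      have h3 := hF.sqs (π (X 0))
      rw [← map_mul, hn1] at h3
      exact h3.resolve_left (hne _ (hn1 ▸ hs1))
    have e2 : π (ν n2) = z := by
      have h3 := hF.sqs (π g)
      rw [← map_mul, hn2] at h3
      exact h3.resolve_left (hne _ (hn2 ▸ hg1))
    have e3 : π (ν (XN.add n1 n2)) = 1 := by
      rw [hR.add, map_mul, e1, e2, hz.zz]
    refine hne _ ?_ e3
    intro h3
    rw [hR.add] at h3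
    apply hg2
    rw [hn1, hn2]
    exact mul_left_cancel (h3.trans (hνν n1).symm)
  · rw [Bool.and_eq_true] at hg
    have hk3 : 3 ≤ k ∧ k ≤ 5 := by
      refine ⟨?_, hk.2⟩
      by_contra hcon
      have : k = 2 := by omega
      subst this
      simp [tb] at he
    have ok := pres_ok (m := e.2.1) hk3
    exact pres_not_filled ok.1 ok.2 hνi (rels_good hg.2 hR) L.card

end caseB3
end FG

namespace FG
universe v

section main
variable {G : Type v} [Group G]

theorem caseB [Finite G] (hF : Filled G)
    (hQ : ∀ e : G, (∀ g, Commute e g) → e ≠ 1 → e * e = 1 → ∃ k', (2 ≤ k' ∧ k' ≤ 5) ∧ QuoStd e k')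
    (hn : ∀ z : G, ¬ Z2 z) {t : G} (tc : ∀ g, Commute t g) (t1 : t ≠ 1) (tt : t * t = 1) : False := by
  obtain ⟨k, hk, hq⟩ := hQ t tc t1 tt
  obtain ⟨c, X, L⟩ := exists_lift hk tc t1 tt hq
  by_cases hc : ∀ g, Commute c g
  · exact L.b3 hk hc (L.b2 hk.1 hc) hQ hn hF
  · exact L.b1 hk hc hF

theorem classify : ∀ (n : ℕ) (G : Type v) [Group G] [Finite G], Nat.card G = n → IsPGroup 2 G →
    Filled G → (∀ g : G, g * g = 1) ∨ ∃ k, (2 ≤ k ∧ k ≤ 5) ∧ IsStd k G := by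
  intro n
  induction n using Nat.strong_induction_on with
  | _ n ih =>
  intro G _ _ hcard hp hF
  by_cases hexp : ∀ g : G, g * g = 1
  · exact Or.inl hexp
  right
  -- quotients by central involutions
  have hquo : ∀ e : G, (∀ g, Commute e g) → e ≠ 1 → e * e = 1 →
      ∃ (H : Type v) (_ : Group H) (π : G →* H), Function.Surjective π ∧
        (∀ g, π g = 1 ↔ g = 1 ∨ g = e) ∧
        ((∀ g : H, g * g = 1) ∨ ∃ k, (2 ≤ k ∧ k ≤ 5) ∧ IsStd k H) := by
    intro e ec e1 ee
    have hN : (Subgroup.zpowers e).Normal := by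
      constructor
      intro n hn g
      obtain ⟨m, rfl⟩ := hn
      have := ((ec g).zpow_left m).eq
      exact Subgroup.mem_zpowers_iff.2 ⟨m, by rw [← this, mul_inv_cancel_right]⟩
    have hmem : ∀ g, g ∈ Subgroup.zpowers e ↔ g = 1 ∨ g = e := by
      intro g
      constructor
      · rintro ⟨m, rfl⟩
        have h2 : e ^ (2 : ℤ) = 1 := by rw [zpow_two, ee]
        rcases Int.even_or_odd' m with ⟨r, rfl | rfl⟩
        · left; simp [zpow_mul, h2]
        · right; simp [zpow_add, zpow_mul, h2]
      · rintro (rfl | rfl)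
        · exact one_mem _
        · exact Subgroup.mem_zpowers _
    refine ⟨G ⧸ Subgroup.zpowers e, inferInstance, QuotientGroup.mk' _,
      QuotientGroup.mk'_surjective _, fun g => ?_, ?_⟩
    · rw [← hmem]; exact QuotientGroup.eq_one_iff g
    · refine ih (Nat.card (G ⧸ Subgroup.zpowers e)) ?_ _ rfl (hp.to_quotient _)
        (filled_of_surj (QuotientGroup.mk' _) (QuotientGroup.mk'_surjective _) hF)
      have h1 := Subgroup.card_eq_card_quotient_mul_card_subgroup (Subgroup.zpowers e)
      have h2 : 1 < Nat.card (Subgroup.zpowers e) := by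
        rw [Nat.card_zpowers]
        have : orderOf e ≠ 1 := fun h => e1 (orderOf_eq_one_iff.1 h)
        have := orderOf_pos e
        omega
      have h3 : 0 < Nat.card (G ⧸ Subgroup.zpowers e) := Nat.card_pos
      rw [← hcard, h1]
      exact lt_mul_of_one_lt_right h3 h2
  push Not at hexp
  obtain ⟨x0, hx0⟩ := hexp
  by_cases hz : ∃ z : G, Z2 z
  · obtain ⟨z, hz⟩ := hz
    have hxz : x0 * x0 = z := (hz.sqs x0).resolve_left hx0
    refine finishA hz hF ⟨x0, hxz⟩ ?_
    intro e ec e1 ez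
    obtain ⟨H, _, π, hπ, hker, hH⟩ := hquo e ec e1 (a1 hz hF e ec)
    have hπz : π z ≠ 1 := by
      intro h
      rcases (hker z).1 h with h | h
      · exact hz.z1 h
      · exact ez h.symm
    rcases hH with hH | ⟨k, hk, zH, xH, hH⟩
    · refine absurd ?_ hπz
      rw [← hxz, map_mul, hH]
    · obtain ⟨cH, hfa⟩ := hH.facts hk
      have hzH : π z = zH := by
        have := hfa.sqs (π x0)
        rw [← map_mul, hxz] at this
        exact this.resolve_left hπz
      obtain ⟨c', rfl⟩ := hπ cH
      refine ⟨c', fun h hh => ?_⟩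
      have hcen : ∀ g, π h * g = g * π h := by
        intro g
        obtain ⟨g, rfl⟩ := hπ g
        rw [← map_mul, (hh g).eq, map_mul]
      rcases hfa.three _ hcen with h3 | h3 | h3 | h3
      · exact ⟨1, Or.inl rfl, ker_eq hker (h3.trans (map_one π).symm)⟩
      · exact ⟨z, Or.inr (Or.inl rfl), ker_eq hker (h3.trans hzH.symm)⟩
      · exact ⟨c', Or.inr (Or.inr (Or.inl rfl)), ker_eq hker h3⟩
      · exact ⟨z * c', Or.inr (Or.inr (Or.inr rfl)), ker_eq hker (by rw [h3, map_mul, hzH])⟩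
  · exfalso
    push Not at hz
    have hQ : ∀ e : G, (∀ g, Commute e g) → e ≠ 1 → e * e = 1 →
        ∃ k', (2 ≤ k' ∧ k' ≤ 5) ∧ QuoStd e k' := by
      intro e ec e1 ee
      obtain ⟨H, _, π, hπ, hker, hH | ⟨k, hk, hH⟩⟩ := hquo e ec e1 ee
      · refine absurd ⟨e1, ee, fun g => ec g, fun g => ?_⟩ (hz e)
        exact (hker _).1 (by rw [map_mul, hH])
      · exact ⟨k, hk, H, _, π, hπ, hker, hH⟩
    have : Fact (Nat.Prime 2) := ⟨Nat.prime_two⟩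
    have : Nontrivial G := ⟨x0 * x0, 1, hx0⟩
    have := hp.center_nontrivial
    obtain ⟨⟨a, ha⟩, ha1⟩ := exists_ne (1 : Subgroup.center G)
    have ha1 : a ≠ 1 := fun h => ha1 (Subtype.ext h)
    have hac : ∀ g, Commute a g := fun g => (Subgroup.mem_center_iff.1 ha g).symm
    -- a central involution
    have hinv : ∃ t : G, (∀ g, Commute t g) ∧ t ≠ 1 ∧ t * t = 1 := by
      obtain ⟨m, hm⟩ := hp a
      have hex : ∃ m, a ^ 2 ^ m = 1 := ⟨m, hm⟩
      classical
      have h1 := Nat.find_spec hex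
      have h0 : Nat.find hex ≠ 0 := by
        intro h
        rw [h] at h1
        exact ha1 (by simpa using h1)
      obtain ⟨r, hr⟩ := Nat.exists_eq_succ_of_ne_zero h0
      refine ⟨a ^ 2 ^ r, fun g => (hac g).pow_left _, Nat.find_min hex (by omega), ?_⟩
      rw [hr] at h1
      rw [← pow_add, ← two_mul, ← Nat.pow_succ', h1]
    obtain ⟨t, tc, t1, tt⟩ := hinv
    exact caseB hF hQ hz tc t1 tt

end main
end FG

theorem two_group_filled_iff {G : Type*} [Group G] [Finite G] (h2 : IsPGroup 2 G) :
    Filled G ↔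
      (∀ g : G, g ^ 2 = 1) ∨ Nonempty (G ≃* DihedralGroup 4) ∨
        Nonempty (G ≃* DihedralGroup 4 × Multiplicative (ZMod 2)) ∨
        Nonempty (G ≃* D8Q8) ∨
        Nonempty (G ≃* D8Q8 × Multiplicative (ZMod 2)) := by
  constructor
  · intro hF
    rcases FG.classify _ G rfl h2 hF with h | ⟨k, ⟨hk1, hk2⟩, h⟩
    · exact Or.inl fun g => by rw [pow_two, h g]
    · right
      interval_cases k
      · exact Or.inl (h.iso FG.isStd_D8)
      · exact Or.inr (Or.inl (h.iso (FG.isStd_prod (Or.inl rfl) FG.isStd_D8)))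
      · exact Or.inr (Or.inr (Or.inl (h.iso FG.isStd_D8Q8)))
      · exact Or.inr (Or.inr (Or.inr (h.iso (FG.isStd_prod (Or.inr rfl) FG.isStd_D8Q8))))
  · rintro (h | ⟨⟨f⟩⟩ | ⟨⟨f⟩⟩ | ⟨⟨f⟩⟩ | ⟨⟨f⟩⟩)
    · exact FG.filled_of_exp2 fun g => by rw [← pow_two, h g]
    · exact (FG.isStd_D8.of_iso f.symm).filled (by omega)
    · exact ((FG.isStd_prod (Or.inl rfl) FG.isStd_D8).of_iso f.symm).filled (by omega)
    · exact (FG.isStd_D8Q8.of_iso f.symm).filled (by omega)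
    · exact ((FG.isStd_prod (Or.inr rfl) FG.isStd_D8Q8).of_iso f.symm).filled (by omega)
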